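/- Let D ⊂ ℝ² be a bounded domain whose boundary is a finite disjoint union of Jordan curves, and suppose ω₀ = 1_D is a uniformly rotating multi-patch solution of the 2D Euler equation with angular velocity Ω ∈ ℝ, i.e. N*1_D + (Ω/2)|x|² is constant on each connected component of ∂D. If Ω ≤ 0 or Ω ≥ 1/2, then 1_D is radially symmetric: if Ω ≠ 0 then D coincides (up to a Lebesgue-null set) with a disk or an annulus centered at the origin, i.e. 1_D agrees almost everywhere with a function of |x|, and if Ω = 0 then there exists a ∈ ℝ² such that 1_D agrees almost everywhere with a function of |x − a|. -/

import Mathlib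

open MeasureTheory Metric Set Filter

noncomputable section

/-- The plane `ℝ²`. -/
abbrev E2 : Type := EuclideanSpace ℝ (Fin 2)

/-- The Newtonian potential `N(x) = (1/(2π)) log(1/|x|)` on `ℝ²`. -/
def NewtonianPotential (x : E2) : ℝ := (1 / (2 * Real.pi)) * Real.log (1 / ‖x‖)

/-- The convolution `(N * ω)(x) = ∫ N(x-y) ω(y) dy`. -/
def newtonConv (ω : E2 → ℝ) (x : E2) : ℝ := ∫ y, NewtonianPotential (x - y) * ω y

/-- A Jordan curve: the image of a continuous injective map from the unit circle into `ℝ²`. -/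
def IsJordanCurve (Γ : Set E2) : Prop :=
  ∃ f : Metric.sphere (0 : E2) 1 → E2, Continuous f ∧ Function.Injective f ∧ Γ = Set.range f

/-- The boundary of `D` is a finite union of mutually disjoint Jordan curves. -/
def BoundaryIsFiniteUnionOfJordanCurves (D : Set E2) : Prop :=
  ∃ (k : ℕ) (Γ : Fin k → Set E2), (∀ i, IsJordanCurve (Γ i)) ∧
    (Pairwise fun i j => Disjoint (Γ i) (Γ j)) ∧ frontier D = ⋃ i, Γ i

set_option linter.all false

namespace RP
open scoped Topology

/-- The vector kernel `z / |z|^2`. -/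
def K (z : ℂ) : ℂ := (starRingEnd ℂ z)⁻¹

lemma norm_K (z : ℂ) : ‖K z‖ = ‖z‖⁻¹ := by simp [K]

lemma K_neg (z : ℂ) : K (-z) = - K z := by simp [K, inv_neg]

lemma inner_K (e z : ℂ) : inner ℝ e (K z) = inner ℝ e z / ‖z‖ ^ 2 := by
  rw [Complex.inner, Complex.inner, K, ← Complex.normSq_eq_norm_sq, Complex.inv_def]
  simp [Complex.normSq_apply]
  ring

lemma inner_K_self (z : ℂ) (hz : z ≠ 0) : inner ℝ z (K z) = 1 := by
  rw [inner_K, real_inner_self_eq_norm_sq]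
  exact div_self (by positivity)

lemma measurable_K : Measurable K := by
  unfold K; fun_prop

lemma integrableOn_inv_norm_zero (a : ℝ) :
    Integrable ((ball (0:ℂ) a).indicator (fun x => ‖x‖⁻¹)) := by
  have h : (ball (0:ℂ) a).indicator (fun x => ‖x‖⁻¹)
      = fun x : ℂ => (Iio a).indicator (fun r : ℝ => r⁻¹) ‖x‖ := by
    ext x; simp [indicator, mem_ball_zero_iff]
  rw [h, integrable_fun_norm_addHaar]
  have : IntegrableOn (fun _ : ℝ => (1:ℝ)) (Ioo 0 a) := by simp
  have h2 : IntegrableOn (fun y : ℝ => (Ioo 0 a).indicator (fun _ => (1:ℝ)) y) (Ioi 0) :=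
    (this.integrable_indicator measurableSet_Ioo).integrableOn
  refine h2.congr_fun ?_ measurableSet_Ioi
  intro r hr
  have hr : 0 < r := hr
  simp only [indicator, mem_Ioo, mem_Iio, Complex.finrank_real_complex, hr, true_and, smul_eq_mul]
  split_ifs <;> simp [hr.ne']

lemma integral_inv_norm_zero (a : ℝ) (ha : 0 ≤ a) :
    ∫ x : ℂ, (ball (0:ℂ) a).indicator (fun x => ‖x‖⁻¹) x = 2 * Real.pi * a := by
  have h : (ball (0:ℂ) a).indicator (fun x => ‖x‖⁻¹)
      = fun x : ℂ => (Iio a).indicator (fun r : ℝ => r⁻¹) ‖x‖ := by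
    ext x; simp [indicator, mem_ball_zero_iff]
  rw [h, integral_fun_norm_addHaar]
  have : ∫ y in Ioi (0:ℝ), y ^ (Module.finrank ℝ ℂ - 1) • (Iio a).indicator (fun r : ℝ => r⁻¹) y
      = ∫ y in Ioi (0:ℝ), (Ioo 0 a).indicator (fun _ => (1:ℝ)) y := by
    refine setIntegral_congr_fun measurableSet_Ioi ?_
    intro r hr
    have hr : 0 < r := hr
    simp only [indicator, mem_Ioo, mem_Iio, Complex.finrank_real_complex, hr, true_and, smul_eq_mul]
    split_ifs <;> simp [hr.ne']
  rw [this, setIntegral_indicator measurableSet_Ioo, inter_eq_self_of_subset_right Ioo_subset_Ioi_self]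
  simp [Measure.real, ha, Complex.volume_ball]
  ring

lemma integrable_inv_norm_ball (y : ℂ) (a : ℝ) :
    Integrable ((ball y a).indicator (fun x => ‖x - y‖⁻¹)) := by
  have := (integrableOn_inv_norm_zero a).comp_sub_right y
  convert this using 1
  ext x; simp [indicator, dist_eq_norm]

lemma integral_inv_norm_ball (y : ℂ) (a : ℝ) (ha : 0 ≤ a) :
    ∫ x : ℂ, (ball y a).indicator (fun x => ‖x - y‖⁻¹) x = 2 * Real.pi * a := by
  rw [← integral_inv_norm_zero a ha, ← integral_sub_right_eq_self (fun x : ℂ =>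
    (ball (0:ℂ) a).indicator (fun x => ‖x‖⁻¹) x) y]
  congr 1
  ext x; simp [indicator, dist_eq_norm]

lemma inv_norm_le_split (y x : ℂ) (a : ℝ) (ha : 0 < a) (c : ℝ) (hc : |c| ≤ 1) :
    |c| * ‖x - y‖⁻¹ ≤ (ball y a).indicator (fun x => ‖x - y‖⁻¹) x + |c| / a := by
  by_cases h : x ∈ ball y a
  · simp only [indicator, h, if_true]
    have : |c| * ‖x - y‖⁻¹ ≤ 1 * ‖x - y‖⁻¹ := by gcongr
    have : 0 ≤ |c| / a := by positivity
    linarith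
  · simp only [indicator, h, if_false, zero_add]
    rw [mem_ball_iff_norm, not_lt] at h
    rw [div_eq_mul_inv]
    gcongr

lemma integrable_mul_inv_norm {f : ℂ → ℝ} (hf : Integrable f) (hb : ∀ x, |f x| ≤ 1) (y : ℂ) :
    Integrable (fun x => |f x| * ‖x - y‖⁻¹) := by
  have h1 := (integrable_inv_norm_ball y 1).add (hf.abs.div_const 1)
  refine h1.mono' ?_ ?_
  · exact (hf.abs.aestronglyMeasurable).mul (by fun_prop)
  · filter_upwards with x
    rw [Real.norm_of_nonneg (by positivity)]
    exact inv_norm_le_split y x 1 one_pos _ (hb x)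

lemma integral_mul_inv_norm_le {f : ℂ → ℝ} (hf : Integrable f) (hb : ∀ x, |f x| ≤ 1) (y : ℂ)
    (a : ℝ) (ha : 0 < a) :
    ∫ x, |f x| * ‖x - y‖⁻¹ ≤ 2 * Real.pi * a + (∫ x, |f x|) / a := by
  rw [← integral_inv_norm_ball y a ha.le, ← integral_div, ← integral_add
    (integrable_inv_norm_ball y a) (hf.abs.div_const a)]
  exact integral_mono (integrable_mul_inv_norm hf hb y)
    ((integrable_inv_norm_ball y a).add (hf.abs.div_const a))
    (fun x => inv_norm_le_split y x a ha _ (hb x))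

/-- `G f y = ∫ f(x) (x-y)/|x-y|^2 dx`, i.e. `2π` times the gradient of the Newtonian potential. -/
def G (f : ℂ → ℝ) (y : ℂ) : ℂ := ∫ x, f x • K (x - y)

lemma integrable_G {f : ℂ → ℝ} (hf : Integrable f) (hb : ∀ x, |f x| ≤ 1) (y : ℂ) :
    Integrable (fun x => f x • K (x - y)) := by
  refine (integrable_mul_inv_norm hf hb y).mono ?_ ?_
  · exact hf.aestronglyMeasurable.smul
      (measurable_K.comp (measurable_id.sub_const y)).aestronglyMeasurable
  · filter_upwards with x
    simp [norm_smul, norm_K]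

lemma norm_G_le {f : ℂ → ℝ} (hf : Integrable f) (hb : ∀ x, |f x| ≤ 1) (y : ℂ)
    (a : ℝ) (ha : 0 < a) :
    ‖G f y‖ ≤ 2 * Real.pi * a + (∫ x, |f x|) / a := by
  refine le_trans (norm_integral_le_integral_norm _) ?_
  refine le_trans (le_of_eq ?_) (integral_mul_inv_norm_le hf hb y a ha)
  simp [norm_smul, norm_K]

lemma inner_G {f : ℂ → ℝ} (hf : Integrable f) (hb : ∀ x, |f x| ≤ 1) (e y : ℂ) :
    inner ℝ e (G f y) = ∫ x, f x * inner ℝ e (K (x - y)) := by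
  rw [G, ← integral_inner (integrable_G hf hb y)]
  simp only [real_inner_smul_right]

end RP

namespace RP
open scoped Topology Gradient

lemma continuous_grad {φ : ℂ → ℝ} (h : ContDiff ℝ 1 φ) : Continuous (∇ φ) := by
  have : Continuous (fderiv ℝ φ) := h.continuous_fderiv (by simp)
  exact (InnerProductSpace.toDual ℝ ℂ).symm.continuous.comp this

lemma norm_grad {φ : ℂ → ℝ} (x : ℂ) : ‖∇ φ x‖ = ‖fderiv ℝ φ x‖ := by
  simp [gradient]

lemma hasCompactSupport_grad {φ : ℂ → ℝ} (h : HasCompactSupport φ) : HasCompactSupport (∇ φ) := by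
  have := (h.fderiv ℝ)
  refine this.mono ?_
  intro x hx
  simp only [Function.mem_support, ne_eq] at hx ⊢
  intro h0
  apply hx
  simp [gradient, h0]

lemma integrable_grad {φ : ℂ → ℝ} (h : ContDiff ℝ 1 φ) (hc : HasCompactSupport φ) :
    Integrable (∇ φ) :=
  (continuous_grad h).integrable_of_hasCompactSupport (hasCompactSupport_grad hc)

lemma rep_zero {φ : ℂ → ℝ} (h : ContDiff ℝ 1 φ) (hc : HasCompactSupport φ) :
    ∫ y, inner ℝ (∇ φ y) (K y) = - 2 * Real.pi * φ 0 := by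
  rw [← Complex.integral_comp_polarCoord_symm]
  set U : ℝ → ℂ := fun θ => (Real.cos θ + Real.sin θ * Complex.I) with hU
  have hUc : Continuous U := by rw [hU]; fun_prop
  have hU1 : ∀ θ, ‖U θ‖ = 1 := by
    intro θ
    simp only [hU]
    rw [Complex.ofReal_cos, Complex.ofReal_sin, Complex.norm_cos_add_sin_mul_I]
  obtain ⟨R, hR0, hR⟩ : ∃ R > 0, ∀ x, R ≤ ‖x‖ → φ x = 0 := hc.exists_pos_le_norm
  have hfd : ∀ x, R < ‖x‖ → fderiv ℝ φ x = 0 := by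
    intro x hx
    have : φ =ᶠ[𝓝 x] fun _ => 0 := by
      filter_upwards [(isOpen_lt continuous_const continuous_norm).mem_nhds hx] with z hz
      exact hR z (le_of_lt hz)
    rw [this.fderiv_eq]; simp
  have hcont : Continuous fun p : ℝ × ℝ => fderiv ℝ φ (p.1 * U p.2) (U p.2) := by
    have : Continuous (fderiv ℝ φ) := h.continuous_fderiv (by simp)
    have h1 : Continuous fun p : ℝ × ℝ => fderiv ℝ φ (p.1 * U p.2) := this.comp (by fun_prop)
    exact h1.clm_apply (by fun_prop)
  have e1 : ∫ p in polarCoord.target, p.1 • inner ℝ (∇ φ (Complex.polarCoord.symm p))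
      (K (Complex.polarCoord.symm p)) =
      ∫ p in Ioi (0:ℝ) ×ˢ Ioo (-Real.pi) Real.pi, fderiv ℝ φ (p.1 * U p.2) (U p.2) := by
    refine setIntegral_congr_fun (measurableSet_Ioi.prod measurableSet_Ioo) ?_
    rintro ⟨r, θ⟩ ⟨hr, -⟩
    have hr : 0 < r := hr
    simp only [Complex.polarCoord_symm_apply]
    rw [inner_K, inner_gradient_left]
    change r • ((fderiv ℝ φ (r * U θ)) (r * U θ) / ‖(r:ℂ) * U θ‖ ^ 2) = _
    rw [norm_mul, hU1]
    have : (r:ℂ) * U θ = r • U θ := by simp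
    rw [this, map_smul]
    simp
    field_simp
  rw [e1]
  have hintg : IntegrableOn (fun p : ℝ × ℝ => fderiv ℝ φ (p.1 * U p.2) (U p.2))
      (Ioi (0:ℝ) ×ˢ Ioo (-Real.pi) Real.pi) := by
    have h1 : IntegrableOn (fun p : ℝ × ℝ => fderiv ℝ φ (p.1 * U p.2) (U p.2))
      (Icc (0:ℝ) R ×ˢ Icc (-Real.pi) Real.pi) :=
      hcont.continuousOn.integrableOn_compact (isCompact_Icc.prod isCompact_Icc)
    refine h1.of_forall_diff_eq_zero (measurableSet_Ioi.prod measurableSet_Ioo) ?_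
    rintro ⟨r, θ⟩ ⟨⟨hr, hθ⟩, hn⟩
    have hr : 0 < r := hr
    have : R < r := by
      by_contra hcon
      exact hn ⟨⟨hr.le, not_lt.mp hcon⟩, Ioo_subset_Icc_self hθ⟩
    simp only
    rw [hfd]
    · simp
    · rw [norm_mul, hU1]; simpa [abs_of_pos hr] using this
  rw [Measure.volume_eq_prod] at hintg ⊢
  rw [← setIntegral_prod_swap, setIntegral_prod]
  · have : ∀ θ : ℝ, ∫ r in Ioi (0:ℝ), fderiv ℝ φ (r * U θ) (U θ) = - φ 0 := by
      intro θ
      have hd : ∀ r : ℝ, HasDerivAt (fun r : ℝ => φ (r * U θ)) (fderiv ℝ φ (r * U θ) (U θ)) r := by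
        intro r
        have h1 := (h.differentiable (by simp) (r * U θ)).hasFDerivAt
        have h2 : HasDerivAt (fun r : ℝ => (r:ℂ) * U θ) (1 * U θ) r :=
          (Complex.ofRealCLM.hasDerivAt (x := r)).mul_const (U θ)
        have h3 := h1.comp_hasDerivAt r h2
        rw [one_mul] at h3
        exact h3
      have hcd : ContDiff ℝ 1 (fun r : ℝ => φ (r * U θ)) := by
        have : ContDiff ℝ 1 (fun r : ℝ => (r:ℂ) * U θ) :=
          (Complex.ofRealCLM.contDiff).mul contDiff_const
        exact h.comp this
      have hcs : HasCompactSupport (fun r : ℝ => φ (r * U θ)) := by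
        refine HasCompactSupport.intro (isCompact_Icc (a := -R) (b := R)) ?_
        intro r hr
        apply hR
        rw [norm_mul, hU1, Complex.norm_real, mul_one]
        by_contra hcon
        rw [Real.norm_eq_abs, not_le, abs_lt] at hcon
        exact hr ⟨hcon.1.le, hcon.2.le⟩
      have := hcs.integral_Ioi_deriv_eq hcd 0
      simp only [Complex.ofReal_zero, zero_mul] at this
      rw [← this]
      refine setIntegral_congr_fun measurableSet_Ioi ?_
      intro r _
      exact (hd r).deriv.symm
    simp only [Prod.swap, this]
    have hpi := Real.pi_pos
    rw [setIntegral_const]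
    simp [Measure.real]
    rw [ENNReal.toReal_ofReal (by positivity)]
    ring_nf
    simp
  · exact hintg.swap

lemma grad_comp_add {φ : ℂ → ℝ} (x y : ℂ) : ∇ (fun z => φ (z + x)) y = ∇ φ (y + x) := by
  simp [gradient, fderiv_comp_add_right]

lemma rep {φ : ℂ → ℝ} (h : ContDiff ℝ 1 φ) (hc : HasCompactSupport φ) (x : ℂ) :
    ∫ y, inner ℝ (∇ φ y) (K (y - x)) = - 2 * Real.pi * φ x := by
  have h1 : ContDiff ℝ 1 (fun z => φ (z + x)) := h.comp (contDiff_id.add contDiff_const)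
  have h2 : HasCompactSupport (fun z => φ (z + x)) :=
    hc.comp_homeomorph (Homeomorph.addRight x)
  have := rep_zero h1 h2
  simp only [grad_comp_add, zero_add] at this
  rw [← this, ← integral_sub_right_eq_self (fun y => inner ℝ (∇ φ (y + x)) (K y)) x]
  simp

/-- Weak form of `-Δ ψ_f = f`. -/
lemma weak_poisson {φ : ℂ → ℝ} (h : ContDiff ℝ 1 φ) (hc : HasCompactSupport φ)
    {f : ℂ → ℝ} (hf : Integrable f) (hb : ∀ x, |f x| ≤ 1) :
    ∫ y, inner ℝ (∇ φ y) (G f y) = 2 * Real.pi * ∫ x, φ x * f x := by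
  have h1 : ∀ y, inner ℝ (∇ φ y) (G f y) = ∫ x, f x * inner ℝ (∇ φ y) (K (x - y)) :=
    fun y => inner_G hf hb _ y
  simp_rw [h1]
  have hmeas : AEStronglyMeasurable (Function.uncurry fun (y x : ℂ) =>
      f x * inner ℝ (∇ φ y) (K (x - y))) (volume.prod volume) := by
    refine (hf.aestronglyMeasurable.comp_snd).mul ?_
    refine AEStronglyMeasurable.inner ?_ ?_
    · exact ((continuous_grad h).comp continuous_fst).aestronglyMeasurable
    · exact (measurable_K.comp (measurable_snd.sub measurable_fst)).aestronglyMeasurable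
  have hbd : ∀ y x : ℂ, ‖f x * inner ℝ (∇ φ y) (K (x - y))‖ ≤ ‖∇ φ y‖ * (|f x| * ‖x - y‖⁻¹) := by
    intro y x
    rw [norm_mul]
    have := norm_inner_le_norm (𝕜 := ℝ) (∇ φ y) (K (x - y))
    rw [norm_K] at this
    calc _ ≤ ‖f x‖ * (‖∇ φ y‖ * ‖x - y‖⁻¹) := by gcongr
      _ = _ := by rw [Real.norm_eq_abs]; ring
  have hpi : ∀ y : ℂ, Integrable (fun x => f x * inner ℝ (∇ φ y) (K (x - y))) := by
    intro y
    have := (integrable_G hf hb y).const_inner (𝕜 := ℝ) (∇ φ y)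
    simpa only [real_inner_smul_right] using this
  have hintg : Integrable (Function.uncurry fun (y x : ℂ) =>
      f x * inner ℝ (∇ φ y) (K (x - y))) (volume.prod volume) := by
    rw [integrable_prod_iff hmeas]
    refine ⟨Eventually.of_forall hpi, ?_⟩
    refine ((integrable_grad h hc).norm.mul_const
      (2 * Real.pi * 1 + (∫ x, |f x|) / 1)).mono' hmeas.norm.integral_prod_right' ?_
    filter_upwards with y
    rw [Real.norm_of_nonneg (integral_nonneg fun _ => norm_nonneg _)]
    calc _ ≤ ∫ x, ‖∇ φ y‖ * (|f x| * ‖x - y‖⁻¹) :=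
          integral_mono (hpi y).norm ((integrable_mul_inv_norm hf hb y).const_mul _) (hbd y)
      _ = ‖∇ φ y‖ * ∫ x, (|f x| * ‖x - y‖⁻¹) := integral_const_mul _ _
      _ ≤ _ := by gcongr; exact integral_mul_inv_norm_le hf hb y 1 one_pos
  rw [integral_integral_swap hintg, ← integral_const_mul]
  congr 1
  ext x
  rw [integral_const_mul]
  have : ∀ y, inner ℝ (∇ φ y) (K (x - y)) = - inner ℝ (∇ φ y) (K (y - x)) := by
    intro y; rw [← inner_neg_right, ← K_neg, neg_sub]
  simp_rw [this, integral_neg, rep h hc x]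
  ring

end RP

namespace RP
open scoped Topology Gradient

/-- Newtonian potential of `f`. -/
def pot (f : ℂ → ℝ) (y : ℂ) : ℝ := -(1 / (2 * Real.pi)) * ∫ x, f x * Real.log ‖x - y‖

lemma integrable_mul_cont {f : ℂ → ℝ} (hf : Integrable f) {R : ℝ} (hs : ∀ x, R < ‖x‖ → f x = 0)
    {g : ℂ → ℝ} (hg : Continuous g) : Integrable (fun x => f x * g x) := by
  obtain ⟨C, hC⟩ := (isCompact_closedBall (0:ℂ) R).exists_bound_of_continuousOn hg.continuousOn
  refine (hf.norm.mul_const C).mono (hf.aestronglyMeasurable.mul hg.aestronglyMeasurable) ?_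
  filter_upwards with x
  by_cases hx : R < ‖x‖
  · simp [hs x hx]
  · have := hC x (by simpa using hx)
    rw [norm_mul, norm_mul, norm_norm]
    gcongr
    exact this.trans (le_abs_self C)

lemma abs_log_le (s : ℝ) (hs : 0 ≤ s) : |Real.log s| ≤ s + s⁻¹ := by
  rcases hs.eq_or_lt with h | h
  · simp [← h]
  · rw [abs_le]
    have h1 := Real.log_le_sub_one_of_pos h
    have h2 := Real.log_le_sub_one_of_pos (inv_pos.mpr h)
    rw [Real.log_inv] at h2
    have := inv_pos.mpr h
    constructor <;> linarith

lemma integrable_mul_log {f : ℂ → ℝ} (hf : Integrable f) (hb : ∀ x, |f x| ≤ 1) {R : ℝ}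
    (hs : ∀ x, R < ‖x‖ → f x = 0) (y : ℂ) : Integrable (fun x => f x * Real.log ‖x - y‖) := by
  have h1 : Integrable (fun x => f x * ‖x - y‖) := integrable_mul_cont hf hs (by fun_prop)
  have h2 := integrable_mul_inv_norm hf hb y
  refine (h1.norm.add h2).mono' (hf.aestronglyMeasurable.mul
    (Real.measurable_log.comp (by fun_prop)).aestronglyMeasurable) ?_
  filter_upwards with x
  simp only [Pi.add_apply]
  rw [norm_mul, norm_mul, norm_norm, Real.norm_eq_abs, Real.norm_eq_abs, ← mul_add]
  gcongr
  exact abs_log_le _ (norm_nonneg _)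

/-- regularized kernels -/
def Le (ε : ℝ) (z : ℂ) : ℝ := (1/2) * Real.log (‖z‖ ^ 2 + ε ^ 2)
def Ke (ε : ℝ) (z : ℂ) : ℂ := (‖z‖ ^ 2 + ε ^ 2)⁻¹ • z

lemma continuous_Le {ε : ℝ} (h : 0 < ε) : Continuous (Le ε) := by
  unfold Le
  refine continuous_const.mul (Continuous.log (by fun_prop) ?_)
  intro x; positivity

lemma continuous_Ke {ε : ℝ} (h : 0 < ε) : Continuous (Ke ε) := by
  unfold Ke
  have h1 : Continuous fun z : ℂ => ‖z‖ ^ 2 + ε ^ 2 := by fun_prop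
  have h2 : Continuous fun z : ℂ => (‖z‖ ^ 2 + ε ^ 2)⁻¹ := h1.inv₀ (fun x => by positivity)
  exact h2.smul continuous_id

lemma norm_Ke_le {ε : ℝ} (h : 0 < ε) (z : ℂ) : ‖Ke ε z‖ ≤ ε⁻¹ := by
  unfold Ke
  rw [norm_smul, Real.norm_of_nonneg (by positivity), inv_mul_le_iff₀ (by positivity),
    ← div_eq_mul_inv, le_div_iff₀ h]
  nlinarith [sq_nonneg (‖z‖ - ε), sq_nonneg (‖z‖), sq_nonneg ε]

lemma hasFDerivAt_Le {ε : ℝ} (h : 0 < ε) (z : ℂ) : HasFDerivAt (Le ε) (innerSL ℝ (Ke ε z)) z := by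
  have h1 : HasFDerivAt (fun z : ℂ => ‖z‖ ^ 2 + ε ^ 2) (2 • innerSL ℝ z) z :=
    (hasStrictFDerivAt_norm_sq z).hasFDerivAt.add_const _
  have h2 := (h1.log (by positivity)).const_mul (1/2)
  refine h2.congr_fderiv (ContinuousLinearMap.ext fun w => ?_)
  change (1/2 : ℝ) * ((‖z‖ ^ 2 + ε ^ 2)⁻¹ * ((2 • innerSL ℝ z) w)) = inner ℝ (Ke ε z) w
  rw [Ke, real_inner_smul_left, two_smul]
  change (1/2 : ℝ) * ((‖z‖ ^ 2 + ε ^ 2)⁻¹ * (inner ℝ z w + inner ℝ z w)) = _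
  ring

lemma K_eq (z : ℂ) : K z = (‖z‖ ^ 2)⁻¹ • z := by
  rw [K, Complex.inv_def, ← Complex.normSq_eq_norm_sq]
  simp [mul_comm]

lemma norm_Ke_sub_K {ε : ℝ} (z : ℂ) : ‖Ke ε z - K z‖ ≤ ‖z‖⁻¹ := by
  rw [K_eq, Ke, ← sub_smul, norm_smul]
  by_cases hz : z = 0
  · simp [hz]
  have hz : 0 < ‖z‖ := norm_pos_iff.mpr hz
  have h1 : (‖z‖ ^ 2 + ε ^ 2)⁻¹ ≤ (‖z‖ ^ 2)⁻¹ := by gcongr; nlinarith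
  have h2 : 0 < (‖z‖ ^ 2 + ε ^ 2)⁻¹ := by positivity
  rw [Real.norm_eq_abs, abs_of_nonpos (by linarith)]
  calc _ ≤ (‖z‖ ^ 2)⁻¹ * ‖z‖ := by gcongr; linarith
    _ = _ := by field_simp

lemma norm_Ke_sub_K' {ε : ℝ} (z : ℂ) (a : ℝ) (ha : 0 < a) (hz : a ≤ ‖z‖) :
    ‖Ke ε z - K z‖ ≤ ε ^ 2 / a ^ 3 := by
  rw [K_eq, Ke, ← sub_smul, norm_smul]
  have hz0 : 0 < ‖z‖ := lt_of_lt_of_le ha hz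
  have h1 : (‖z‖ ^ 2 + ε ^ 2)⁻¹ ≤ (‖z‖ ^ 2)⁻¹ := by gcongr; nlinarith
  rw [Real.norm_eq_abs, abs_of_nonpos (by linarith)]
  have : -((‖z‖ ^ 2 + ε ^ 2)⁻¹ - (‖z‖ ^ 2)⁻¹) * ‖z‖ = ε ^ 2 / (‖z‖ * (‖z‖ ^ 2 + ε ^ 2)) := by
    field_simp; ring
  rw [this]
  gcongr
  calc a ^ 3 ≤ ‖z‖ ^ 3 := by gcongr
    _ ≤ _ := by nlinarith [mul_nonneg hz0.le (sq_nonneg ε)]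

def Ge (f : ℂ → ℝ) (ε : ℝ) (y : ℂ) : ℂ := ∫ x, f x • Ke ε (x - y)

lemma integrable_Ge {f : ℂ → ℝ} (hf : Integrable f) {ε : ℝ} (h : 0 < ε) (y : ℂ) :
    Integrable (fun x => f x • Ke ε (x - y)) := by
  refine (hf.norm.mul_const ε⁻¹).mono' (hf.aestronglyMeasurable.smul
    ((continuous_Ke h).comp (by fun_prop)).aestronglyMeasurable) ?_
  filter_upwards with x
  rw [norm_smul]
  gcongr
  exact norm_Ke_le h _

lemma continuous_Ge {f : ℂ → ℝ} (hf : Integrable f) {ε : ℝ} (h : 0 < ε) : Continuous (Ge f ε) := by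
  unfold Ge
  refine continuous_of_dominated (bound := fun x => ‖f x‖ * ε⁻¹)
    (fun y => (integrable_Ge hf h y).aestronglyMeasurable) ?_ (hf.norm.mul_const _) ?_
  · intro y
    filter_upwards with x
    rw [norm_smul]
    gcongr
    exact norm_Ke_le h _
  · filter_upwards with x
    have h1 : Continuous fun y : ℂ => Ke ε (x - y) := (continuous_Ke h).comp (by fun_prop)
    exact h1.const_smul (f x)

lemma norm_Ge_sub_G {f : ℂ → ℝ} (hf : Integrable f) (hb : ∀ x, |f x| ≤ 1) {ε : ℝ} (h : 0 < ε)
    (y : ℂ) (a : ℝ) (ha : 0 < a) :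
    ‖Ge f ε y - G f y‖ ≤ 2 * Real.pi * a + (∫ x, |f x|) * (ε ^ 2 / a ^ 3) := by
  rw [Ge, G, ← integral_sub (integrable_Ge hf h y) (integrable_G hf hb y),
    ← integral_inv_norm_ball y a ha.le, ← integral_mul_const, ← integral_add
    (integrable_inv_norm_ball y a) (hf.abs.mul_const _)]
  refine norm_integral_le_of_norm_le ((integrable_inv_norm_ball y a).add (hf.abs.mul_const _)) ?_
  filter_upwards with x
  rw [← smul_sub, norm_smul, Real.norm_eq_abs]
  by_cases hx : x ∈ ball y a
  · simp only [indicator, hx, if_true]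
    have h1 : |f x| * ‖Ke ε (x - y) - K (x - y)‖ ≤ 1 * ‖x - y‖⁻¹ := by
      gcongr
      · exact hb x
      · exact norm_Ke_sub_K _
    have : 0 ≤ |f x| * (ε ^ 2 / a ^ 3) := by positivity
    linarith
  · simp only [indicator, hx, if_false, zero_add]
    gcongr
    refine norm_Ke_sub_K' _ a ha ?_
    simpa [dist_eq_norm] using hx

/-- the regularizing sequence -/
def en (n : ℕ) : ℝ := 1 / ((n:ℝ) + 1)
lemma en_pos (n : ℕ) : 0 < en n := by unfold en; positivity
lemma en_le (n : ℕ) : en n ≤ 1 := by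
  unfold en
  rw [div_le_one (by positivity)]
  have : (0:ℝ) ≤ n := by positivity
  linarith
lemma en_tendsto : Tendsto en atTop (𝓝 0) := tendsto_one_div_add_atTop_nhds_zero_nat

lemma tendstoUniformly_Ge {f : ℂ → ℝ} (hf : Integrable f) (hb : ∀ x, |f x| ≤ 1) :
    TendstoUniformly (fun n => Ge f (en n)) (G f) atTop := by
  rw [Metric.tendstoUniformly_iff]
  intro η hη
  have hpi := Real.pi_pos
  set a := η / (8 * Real.pi) with ha
  have ha0 : 0 < a := by positivity
  have h1 : Tendsto (fun n => (∫ x, |f x|) * (en n ^ 2 / a ^ 3)) atTop (𝓝 ((∫ x, |f x|) * (0 ^ 2 / a ^ 3))) :=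
    ((en_tendsto.pow 2).div_const _).const_mul _
  rw [zero_pow two_ne_zero, zero_div, mul_zero] at h1
  filter_upwards [h1.eventually (gt_mem_nhds (half_pos hη))] with n hn y
  rw [dist_comm, dist_eq_norm]
  have := norm_Ge_sub_G hf hb (en_pos n) y a ha0
  have h2 : 2 * Real.pi * a = η / 4 := by rw [ha]; field_simp; norm_num
  linarith

lemma continuous_G {f : ℂ → ℝ} (hf : Integrable f) (hb : ∀ x, |f x| ≤ 1) : Continuous (G f) :=
  (tendstoUniformly_Ge hf hb).continuous
    (Frequently.of_forall fun n => continuous_Ge hf (en_pos n))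

lemma hasFDerivAt_Pe {f : ℂ → ℝ} (hf : Integrable f) {R : ℝ}
    (hs : ∀ x, R < ‖x‖ → f x = 0) {ε : ℝ} (h : 0 < ε) (y : ℂ) :
    HasFDerivAt (fun y => ∫ x, f x * Le ε (x - y)) (-innerSL ℝ (Ge f ε y)) y := by
  have hmeas : ∀ y, Integrable (fun x => f x • innerSL ℝ (Ke ε (x - y))) := by
    intro y
    refine (hf.norm.mul_const ε⁻¹).mono' (hf.aestronglyMeasurable.smul
      ((innerSL ℝ).continuous.comp ((continuous_Ke h).comp (by fun_prop))).aestronglyMeasurable) ?_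
    filter_upwards with x
    rw [norm_smul, innerSL_apply_norm]
    gcongr
    exact norm_Ke_le h _
  have := hasFDerivAt_integral_of_dominated_of_fderiv_le (𝕜 := ℝ) (μ := volume)
    (F := fun y x => f x * Le ε (x - y))
    (F' := fun y x => f x • (- innerSL ℝ (Ke ε (x - y)))) (x₀ := y) (s := univ)
    (bound := fun x => ‖f x‖ * ε⁻¹) univ_mem ?_ ?_ ?_ ?_ ?_ ?_
  · refine this.congr_fderiv ?_
    simp only [smul_neg, integral_neg]
    congr 1
    refine ContinuousLinearMap.ext fun w => ?_
    symm
    rw [ContinuousLinearMap.integral_apply (hmeas y)]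
    change inner ℝ (Ge f ε y) w = ∫ x, f x * inner ℝ (Ke ε (x - y)) w
    rw [real_inner_comm, Ge, ← integral_inner (integrable_Ge hf h y)]
    simp only [real_inner_smul_right]
    congr 1; ext x; rw [real_inner_comm]
  · filter_upwards with y
    exact hf.aestronglyMeasurable.mul ((continuous_Le h).comp (by fun_prop)).aestronglyMeasurable
  · exact integrable_mul_cont hf hs ((continuous_Le h).comp (by fun_prop))
  · simp only [smul_neg]
    exact (hmeas y).aestronglyMeasurable.neg
  · filter_upwards with x y _
    rw [norm_smul, norm_neg, innerSL_apply_norm]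
    gcongr
    exact norm_Ke_le h _
  · exact hf.norm.mul_const _
  · filter_upwards with x y _
    have h1 := (hasFDerivAt_Le h (x - y)).comp y ((hasFDerivAt_id y).const_sub x)
    have h2 := h1.const_mul (f x)
    refine h2.congr_fderiv (ContinuousLinearMap.ext fun w => ?_)
    change f x * inner ℝ (Ke ε (x - y)) (-w) = f x * (- inner ℝ (Ke ε (x - y)) w)
    rw [inner_neg_right]

lemma tendsto_Pe {f : ℂ → ℝ} (hf : Integrable f) (hb : ∀ x, |f x| ≤ 1) {R : ℝ}
    (hs : ∀ x, R < ‖x‖ → f x = 0) (y : ℂ) :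
    Tendsto (fun n => ∫ x, f x * Le (en n) (x - y)) atTop (𝓝 (∫ x, f x * Real.log ‖x - y‖)) := by
  refine tendsto_integral_of_dominated_convergence
    (fun x => ‖f x * Real.log ‖x - y‖‖ + ‖f x * Le 1 (x - y)‖) ?_ ?_ ?_ ?_
  · intro n
    exact hf.aestronglyMeasurable.mul
      ((continuous_Le (en_pos n)).comp (by fun_prop)).aestronglyMeasurable
  · exact (integrable_mul_log hf hb hs y).norm.add
      (integrable_mul_cont hf hs ((continuous_Le one_pos).comp (by fun_prop))).norm
  · intro n
    filter_upwards [compl_mem_ae_iff.mpr (measure_singleton y)] with x hx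
    have hx : 0 < ‖x - y‖ := norm_pos_iff.mpr (sub_ne_zero.mpr hx)
    rw [norm_mul, norm_mul, norm_mul, ← mul_add]
    gcongr
    have h1 : Real.log ‖x - y‖ ≤ Le (en n) (x - y) := by
      have : Real.log ‖x - y‖ = (1/2) * Real.log (‖x-y‖^2) := by rw [Real.log_pow]; push_cast; ring
      rw [this, Le]
      gcongr
      nlinarith [sq_nonneg (en n)]
    have h2 : Le (en n) (x - y) ≤ Le 1 (x - y) := by
      unfold Le
      gcongr
      · have := en_pos n; positivity
      · exact en_le n
    simp only [Real.norm_eq_abs]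
    rw [abs_le]
    constructor
    · have := neg_abs_le (Real.log ‖x - y‖); have := abs_nonneg (Le 1 (x-y)); linarith
    · have := le_abs_self (Le 1 (x-y)); have := abs_nonneg (Real.log ‖x - y‖); linarith
  · filter_upwards [compl_mem_ae_iff.mpr (measure_singleton y)] with x hx
    have hx : 0 < ‖x - y‖ := norm_pos_iff.mpr (sub_ne_zero.mpr hx)
    refine Tendsto.const_mul _ ?_
    have : Real.log ‖x - y‖ = (1/2) * Real.log (‖x-y‖^2 + 0 ^ 2) := by
      rw [zero_pow two_ne_zero, add_zero, Real.log_pow]; push_cast; ring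
    rw [this]
    unfold Le
    refine Tendsto.const_mul _ (Tendsto.log ?_ (by positivity))
    exact tendsto_const_nhds.add (en_tendsto.pow 2)

lemma hasGradientAt_pot {f : ℂ → ℝ} (hf : Integrable f) (hb : ∀ x, |f x| ≤ 1) {R : ℝ}
    (hs : ∀ x, R < ‖x‖ → f x = 0) (y : ℂ) :
    HasGradientAt (pot f) ((1 / (2 * Real.pi)) • G f y) y := by
  have h1 : HasFDerivAt (fun y => ∫ x, f x * Real.log ‖x - y‖) (-innerSL ℝ (G f y)) y := by
    refine hasFDerivAt_of_tendstoUniformly (l := atTop)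
      (f := fun n y => ∫ x, f x * Le (en n) (x - y))
      (f' := fun n y => -innerSL ℝ (Ge f (en n) y)) (g' := fun y => -innerSL ℝ (G f y)) ?_ ?_ ?_ y
    · have := tendstoUniformly_Ge hf hb
      rw [Metric.tendstoUniformly_iff] at this ⊢
      intro η hη
      filter_upwards [this η hη] with n hn y
      have := hn y
      rw [dist_eq_norm] at this ⊢
      rw [← neg_sub', norm_neg, ← map_sub, innerSL_apply_norm]
      exact this
    · intro n y
      exact hasFDerivAt_Pe hf hs (en_pos n) y
    · intro y
      exact tendsto_Pe hf hb hs y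
  rw [hasGradientAt_iff_hasFDerivAt]
  have h2 := h1.const_mul (-(1 / (2 * Real.pi)))
  refine h2.congr_fderiv (ContinuousLinearMap.ext fun w => ?_)
  change -(1 / (2 * Real.pi)) * (- inner ℝ (G f y) w) = inner ℝ ((1 / (2 * Real.pi)) • G f y) w
  rw [real_inner_smul_left]
  ring

lemma grad_pot {f : ℂ → ℝ} (hf : Integrable f) (hb : ∀ x, |f x| ≤ 1) {R : ℝ}
    (hs : ∀ x, R < ‖x‖ → f x = 0) : ∇ (pot f) = fun y => (1 / (2 * Real.pi)) • G f y :=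
  gradient_eq (hasGradientAt_pot hf hb hs)

lemma contDiff_of_grad {u : ℂ → ℝ} {g : ℂ → ℂ} (h : ∀ x, HasGradientAt u (g x) x)
    (hg : Continuous g) : ContDiff ℝ 1 u := by
  rw [contDiff_one_iff_hasFDerivAt]
  refine ⟨fun x => innerSL ℝ (g x), (innerSL ℝ).continuous.comp hg, ?_⟩
  intro x
  have := (h x).hasFDerivAt
  exact this

lemma contDiff_pot {f : ℂ → ℝ} (hf : Integrable f) (hb : ∀ x, |f x| ≤ 1) {R : ℝ}
    (hs : ∀ x, R < ‖x‖ → f x = 0) : ContDiff ℝ 1 (pot f) :=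
  contDiff_of_grad (hasGradientAt_pot hf hb hs)
    (Continuous.const_smul (g := fun x => G f x) (continuous_G hf hb) (1 / (2 * Real.pi)))

end RP

namespace RP
open scoped Topology Gradient

lemma ind_integrable {A : Set ℂ} (hA : MeasurableSet A) (h : volume A ≠ ⊤) :
    Integrable (A.indicator (1 : ℂ → ℝ)) :=
  (integrable_indicator_iff hA).mpr (integrableOn_const (C := (1:ℝ)) h)

lemma ind_abs_le (A : Set ℂ) (x : ℂ) : |A.indicator (1 : ℂ → ℝ) x| ≤ 1 := by
  by_cases h : x ∈ A <;> simp [indicator, h]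

lemma ind_nonneg (A : Set ℂ) (x : ℂ) : 0 ≤ A.indicator (1 : ℂ → ℝ) x := by
  by_cases h : x ∈ A <;> simp [indicator, h]

lemma ind_le_one (A : Set ℂ) (x : ℂ) : A.indicator (1 : ℂ → ℝ) x ≤ 1 := by
  by_cases h : x ∈ A <;> simp [indicator, h]

lemma ind_integral {A : Set ℂ} (hA : MeasurableSet A) :
    ∫ x, A.indicator (1 : ℂ → ℝ) x = volume.real A := by
  rw [integral_indicator_one hA]

lemma ind_ball_zero (a : ℂ) (r : ℝ) (x : ℂ) (hx : ‖a‖ + r < ‖x‖) :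
    (ball a r).indicator (1 : ℂ → ℝ) x = 0 := by
  rw [indicator_of_notMem]
  intro h
  rw [mem_ball_iff_norm] at h
  have := norm_le_norm_sub_add x a
  linarith

lemma ind_ball_integrable (a : ℂ) (r : ℝ) : Integrable ((ball a r).indicator (1 : ℂ → ℝ)) :=
  ind_integrable measurableSet_ball measure_ball_lt_top.ne

lemma volume_real_ball (a : ℂ) (r : ℝ) (hr : 0 ≤ r) : volume.real (ball a r) = Real.pi * r ^ 2 := by
  simp [Measure.real, Complex.volume_ball, ENNReal.toReal_ofReal hr]
  ring

lemma integrableOn_polar {f : ℂ → ℝ} (hf : Integrable f) :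
    IntegrableOn (fun p : ℝ × ℝ => p.1 • f (Complex.polarCoord.symm p)) polarCoord.target := by
  have h1 : Integrable (fun p : ℝ × ℝ => f (Complex.measurableEquivRealProd.symm p)) :=
    (Complex.volume_preserving_equiv_real_prod.symm).integrable_comp_emb
      Complex.measurableEquivRealProd.symm.measurableEmbedding |>.mpr hf
  have h2 := (integrableOn_image_iff_integrableOn_abs_det_fderiv_smul volume
    (polarCoord.open_target.measurableSet)
    (fun p _ ↦ (hasFDerivAt_polarCoord_symm p).hasFDerivWithinAt) polarCoord.symm.injOn
    (fun p : ℝ × ℝ => f (Complex.measurableEquivRealProd.symm p))).mp h1.integrableOn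
  refine h2.congr_fun ?_ polarCoord.open_target.measurableSet
  intro p hp
  simp only [det_fderivPolarCoordSymm]
  rw [abs_of_pos hp.1]
  rfl

lemma integral_circle_log (a y : ℂ) (ρ : ℝ) (hρ : 0 < ρ) :
    ∫ θ in Ioo (-Real.pi) Real.pi, Real.log ‖a + ρ * (Real.cos θ + Real.sin θ * Complex.I) - y‖
      = 2 * Real.pi * Real.log (max ρ ‖y - a‖) := by
  have hpi := Real.pi_pos
  have h1 := circleAverage_log_norm_sub_const_eq_log_radius_add_posLog (a := y) (c := a) hρ.ne'
  have h2 : Real.log ρ + Real.posLog (ρ⁻¹ * ‖a - y‖) = Real.log (max ρ ‖y - a‖) := by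
    rw [norm_sub_rev a y]
    rcases le_total ρ ‖y - a‖ with h | h
    · have h3 : 1 ≤ ρ⁻¹ * ‖y - a‖ := by
        rw [le_inv_mul_iff₀ hρ]; linarith
      rw [max_eq_right h, Real.posLog_eq_log (by rwa [abs_of_nonneg (by positivity)]),
        Real.log_mul (by positivity) (by have := hρ.trans_le h; positivity), Real.log_inv]
      ring
    · have h3 : ρ⁻¹ * ‖y - a‖ ≤ 1 := by
        rw [inv_mul_le_iff₀ hρ]; linarith
      rw [max_eq_left h, Real.posLog_eq_zero_iff _ |>.mpr (by rwa [abs_of_nonneg (by positivity)]),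
        add_zero]
  rw [h2, Real.circleAverage] at h1
  have h3 : ∀ θ : ℝ, a + ρ * (Real.cos θ + Real.sin θ * Complex.I) = circleMap a ρ θ := by
    intro θ
    rw [circleMap, Complex.exp_mul_I, Complex.ofReal_cos, Complex.ofReal_sin]
  simp_rw [h3]
  rw [← integral_Ioc_eq_integral_Ioo, ← intervalIntegral.integral_of_le (by linarith)]
  have hper : Function.Periodic (fun θ => Real.log ‖circleMap a ρ θ - y‖) (2 * Real.pi) := by
    intro θ; simp only; rw [periodic_circleMap a ρ θ]
  have h4 := hper.intervalIntegral_add_eq (-Real.pi) 0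
  rw [show -Real.pi + 2 * Real.pi = Real.pi by ring, zero_add] at h4
  rw [h4]
  rw [smul_eq_mul, inv_mul_eq_iff_eq_mul₀ (by positivity)] at h1
  exact h1

lemma hasDerivAt_F (ρ : ℝ) (hρ : 0 < ρ) :
    HasDerivAt (fun ρ : ℝ => ρ * (ρ * Real.log ρ) / 2 - ρ ^ 2 / 4) (ρ * Real.log ρ) ρ := by
  have h1 := Real.hasDerivAt_mul_log hρ.ne'
  have h2 := (((hasDerivAt_id ρ).mul h1).div_const 2).sub ((hasDerivAt_pow 2 ρ).div_const 4)
  refine h2.congr_deriv ?_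
  simp only [id]
  push_cast
  ring

lemma integral_rho_log (s r : ℝ) (hs : 0 ≤ s) (hsr : s ≤ r) :
    ∫ ρ in s..r, ρ * Real.log ρ = (r * (r * Real.log r) / 2 - r ^ 2 / 4) -
      (s * (s * Real.log s) / 2 - s ^ 2 / 4) := by
  refine intervalIntegral.integral_eq_sub_of_hasDerivAt_of_le hsr
    (f := fun ρ : ℝ => ρ * (ρ * Real.log ρ) / 2 - ρ ^ 2 / 4) ?_ ?_ ?_
  · have := Real.continuous_mul_log
    exact (((continuous_id.mul this).div_const 2).sub (by fun_prop)).continuousOn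
  · intro x hx
    exact hasDerivAt_F x (hs.trans_lt hx.1)
  · exact Real.continuous_mul_log.intervalIntegrable _ _

lemma integral_ball_log (a y : ℂ) (r : ℝ) (hr : 0 < r) :
    ∫ x, (ball a r).indicator 1 x * Real.log ‖x - y‖ =
      2 * Real.pi * ∫ ρ in Ioo 0 r, ρ * Real.log (max ρ ‖y - a‖) := by
  have hi : Integrable (fun x => (ball a r).indicator (1 : ℂ → ℝ) x * Real.log ‖x - y‖) := by
    exact integrable_mul_log (R := ‖a‖ + r) (ind_ball_integrable a r) (ind_abs_le _)
      (ind_ball_zero a r) y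
  have hi2 := hi.comp_add_left a
  rw [← integral_add_left_eq_self _ a, ← Complex.integral_comp_polarCoord_symm]
  have hi3 := integrableOn_polar hi2
  have e : polarCoord.target = Ioi (0:ℝ) ×ˢ Ioo (-Real.pi) Real.pi := rfl
  rw [e] at hi3 ⊢
  rw [Measure.volume_eq_prod] at hi3 ⊢
  rw [setIntegral_prod _ hi3, ← integral_const_mul,
    ← integral_indicator measurableSet_Ioi, ← integral_indicator measurableSet_Ioo]
  congr 1
  ext ρ
  by_cases hρ : 0 < ρ
  · have hn : ∀ θ : ℝ, ‖(ρ:ℂ) * (Real.cos θ + Real.sin θ * Complex.I)‖ = ρ := by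
      intro θ
      rw [norm_mul, Complex.ofReal_cos, Complex.ofReal_sin, Complex.norm_cos_add_sin_mul_I]
      simp [abs_of_pos hρ]
    rw [indicator_of_mem (show ρ ∈ Ioi 0 from hρ)]
    simp only [Complex.polarCoord_symm_apply]
    by_cases hρr : ρ < r
    · rw [indicator_of_mem (show ρ ∈ Ioo 0 r from ⟨hρ, hρr⟩)]
      have : ∀ θ : ℝ, a + ρ * (Real.cos θ + Real.sin θ * Complex.I) ∈ ball a r := by
        intro θ; rw [mem_ball_iff_norm, add_sub_cancel_left, hn]; exact hρr
      simp_rw [indicator_of_mem (this _), Pi.one_apply, one_mul, smul_eq_mul]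
      rw [integral_const_mul, integral_circle_log a y ρ hρ]
      ring
    · rw [indicator_of_notMem (show ρ ∉ Ioo 0 r from fun h => hρr h.2)]
      have : ∀ θ : ℝ, a + ρ * (Real.cos θ + Real.sin θ * Complex.I) ∉ ball a r := by
        intro θ; rw [mem_ball_iff_norm, add_sub_cancel_left, hn]; exact hρr
      simp_rw [indicator_of_notMem (this _)]
      simp
  · rw [indicator_of_notMem (show ρ ∉ Ioi 0 from hρ),
      indicator_of_notMem (show ρ ∉ Ioo 0 r from fun h => hρ h.1)]

lemma pot_ball_out (a y : ℂ) (r : ℝ) (hr : 0 < r) (h : r ≤ ‖y - a‖) :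
    pot ((ball a r).indicator 1) y = - (r ^ 2 / 2) * Real.log ‖y - a‖ := by
  rw [pot, integral_ball_log a y r hr]
  have : ∫ ρ in Ioo 0 r, ρ * Real.log (max ρ ‖y - a‖) = r ^ 2 / 2 * Real.log ‖y - a‖ := by
    have h1 : ∫ ρ in Ioo 0 r, ρ * Real.log (max ρ ‖y - a‖)
        = ∫ ρ in Ioo 0 r, ρ * Real.log ‖y - a‖ := by
      refine setIntegral_congr_fun measurableSet_Ioo ?_
      intro ρ hρ
      simp only
      rw [max_eq_right (hρ.2.le.trans h)]
    rw [h1, integral_mul_const, ← integral_Ioc_eq_integral_Ioo,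
      ← intervalIntegral.integral_of_le hr.le, integral_id]
    simp
  rw [this]
  have := Real.pi_pos
  field_simp

lemma pot_ball_in (a y : ℂ) (r : ℝ) (hr : 0 < r) (h : ‖y - a‖ ≤ r) :
    pot ((ball a r).indicator 1) y = - ‖y - a‖ ^ 2 / 4 + (r ^ 2 / 4 - r ^ 2 / 2 * Real.log r) := by
  rw [pot, integral_ball_log a y r hr]
  set s := ‖y - a‖ with hs
  have hs0 : 0 ≤ s := norm_nonneg _
  have : ∫ ρ in Ioo 0 r, ρ * Real.log (max ρ s) = s ^ 2 / 2 * Real.log s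
      + ((r * (r * Real.log r) / 2 - r ^ 2 / 4) - (s * (s * Real.log s) / 2 - s ^ 2 / 4)) := by
    rw [← integral_Ioc_eq_integral_Ioo, ← intervalIntegral.integral_of_le hr.le]
    have h1 : ∀ ρ ∈ uIcc 0 s, ρ * Real.log (max ρ s) = ρ * Real.log s := by
      intro ρ hρ
      rw [uIcc_of_le hs0] at hρ
      rw [max_eq_right hρ.2]
    have h2 : ∀ ρ ∈ uIcc s r, ρ * Real.log (max ρ s) = ρ * Real.log ρ := by
      intro ρ hρ
      rw [uIcc_of_le h] at hρ
      rw [max_eq_left hρ.1]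
    rw [← intervalIntegral.integral_add_adjacent_intervals (b := s), 
      intervalIntegral.integral_congr h1, intervalIntegral.integral_congr h2,
      integral_rho_log s r hs0 h, intervalIntegral.integral_mul_const, integral_id]
    · simp
    · refine IntervalIntegrable.congr (f := fun ρ => ρ * Real.log s)
        (fun ρ hρ => (h1 ρ (uIoc_subset_uIcc hρ)).symm) ?_
      exact (by fun_prop : Continuous fun ρ => ρ * Real.log s).intervalIntegrable _ _
    · refine IntervalIntegrable.congr (f := fun ρ => ρ * Real.log ρ)
        (fun ρ hρ => (h2 ρ (uIoc_subset_uIcc hρ)).symm) ?_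
      exact Real.continuous_mul_log.intervalIntegrable _ _
  rw [this]
  have := Real.pi_pos
  field_simp
  ring

lemma grad_quad (a : ℂ) (c k : ℝ) (y : ℂ) :
    HasGradientAt (fun y : ℂ => c * ‖y - a‖ ^ 2 + k) ((2 * c) • (y - a)) y := by
  rw [hasGradientAt_iff_hasFDerivAt]
  have h0 : HasFDerivAt (fun y : ℂ => y - a) (ContinuousLinearMap.id ℝ ℂ) y :=
    (hasFDerivAt_id y).sub_const a
  have h1 : HasFDerivAt (fun y : ℂ => ‖y - a‖ ^ 2) ((2 • innerSL ℝ (y - a)).comp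
      (ContinuousLinearMap.id ℝ ℂ)) y := by
    have h' : HasFDerivAt (fun z : ℂ => ‖z‖ ^ 2) (2 • innerSL ℝ (y - a)) (y - a) :=
      (hasStrictFDerivAt_norm_sq (y - a)).hasFDerivAt
    exact HasFDerivAt.comp (g := fun z : ℂ => ‖z‖ ^ 2) y h' h0
  have h2 := (h1.const_mul c).add_const k
  refine h2.congr_fderiv (ContinuousLinearMap.ext fun w => ?_)
  change c * ((2 • innerSL ℝ (y - a)) w) = inner ℝ ((2 * c) • (y - a)) w
  rw [two_smul, real_inner_smul_left]
  change c * (inner ℝ (y - a) w + inner ℝ (y - a) w) = _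
  ring

lemma G_ball (a y : ℂ) (r : ℝ) (hr : 0 < r) (h : ‖y - a‖ ≤ r) :
    G ((ball a r).indicator 1) y = - (Real.pi • (y - a)) := by
  have hpi := Real.pi_pos
  have key : ∀ y ∈ ball a r, G ((ball a r).indicator 1) y = - (Real.pi • (y - a)) := by
    intro y hy
    have h1 := hasGradientAt_pot (ind_ball_integrable a r) (ind_abs_le _)
      (R := ‖a‖ + r) (ind_ball_zero a r) y
    have h2 := grad_quad a (-1/4) (r ^ 2 / 4 - r ^ 2 / 2 * Real.log r) y
    have h3 : pot ((ball a r).indicator 1) =ᶠ[𝓝 y] fun y : ℂ =>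
        (-1/4) * ‖y - a‖ ^ 2 + (r ^ 2 / 4 - r ^ 2 / 2 * Real.log r) := by
      filter_upwards [isOpen_ball.mem_nhds hy] with z hz
      rw [pot_ball_in a z r hr (by rw [mem_ball_iff_norm] at hz; exact hz.le)]
      ring
    have h4 := h1.unique (h2.congr_of_eventuallyEq h3)
    have h5 : G ((ball a r).indicator 1) y = (2 * Real.pi) • ((1 / (2 * Real.pi)) • G ((ball a r).indicator 1) y) := by
      rw [smul_smul, mul_one_div_cancel (by positivity), one_smul]
    rw [h5, h4, smul_smul, ← neg_smul]
    congr 1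
    ring
  have hc : IsClosed {y | G ((ball a r).indicator 1) y = - (Real.pi • (y - a))} :=
    isClosed_eq (continuous_G (ind_ball_integrable a r) (ind_abs_le _)) (by fun_prop)
  have := hc.closure_subset_iff.mpr key
  rw [closure_ball a hr.ne'] at this
  exact this (by rwa [mem_closedBall_iff_norm])

lemma lt_inner_K_iff (e y x : ℂ) (he : ‖e‖ = 1) (a : ℝ) (ha : 0 < a) :
    1 / (2 * a) < inner ℝ e (K (x - y)) ↔ x ∈ ball (y + a • e) a := by
  rw [inner_K, mem_ball_iff_norm]
  by_cases hx : x = y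
  · simp [hx, norm_smul, he, abs_of_pos ha, ha.le]
  have hx : 0 < ‖x - y‖ := norm_pos_iff.mpr (sub_ne_zero.mpr hx)
  rw [div_lt_div_iff₀ (by positivity) (by positivity), ← sub_sub, ← sq_lt_sq₀ (norm_nonneg _) ha.le,
    norm_sub_sq_real (x - y) (a • e), norm_smul, he, real_inner_smul_right, real_inner_comm e,
    Real.norm_eq_abs, abs_of_pos ha]
  constructor <;> intro h <;> nlinarith

/-- Exact deficit in the bathtub inequality. -/
lemma bathtub_deficit {f : ℂ → ℝ} (hf : Integrable f) (h0 : ∀ x, 0 ≤ f x) (h1 : ∀ x, f x ≤ 1)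
    (e y : ℂ) (he : ‖e‖ = 1) (a : ℝ) (ha : 0 < a) :
    Integrable (fun x => |(ball (y + a • e) a).indicator 1 x - f x| *
      |inner ℝ e (K (x - y)) - 1 / (2 * a)|) ∧
    ∫ x, |(ball (y + a • e) a).indicator 1 x - f x| * |inner ℝ e (K (x - y)) - 1 / (2 * a)|
      = Real.pi * a / 2 + (∫ x, f x) / (2 * a) - inner ℝ e (G f y) := by
  have hb : ∀ x, |f x| ≤ 1 := fun x => abs_le.mpr ⟨by linarith [h0 x], h1 x⟩
  set B := ball (y + a • e) a with hB
  have hBi : Integrable (B.indicator (1 : ℂ → ℝ)) := ind_ball_integrable _ _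
  have hk : ∀ {g : ℂ → ℝ}, Integrable g → (∀ x, |g x| ≤ 1) →
      Integrable (fun x => g x * inner ℝ e (K (x - y))) := by
    intro g hg hgb
    have := (integrable_G hg hgb y).const_inner (𝕜 := ℝ) e
    simpa only [real_inner_smul_right] using this
  have e1 : (fun x => |B.indicator 1 x - f x| * |inner ℝ e (K (x - y)) - 1 / (2 * a)|)
      = fun x => (B.indicator 1 x * inner ℝ e (K (x - y)) - f x * inner ℝ e (K (x - y)))
        - (B.indicator 1 x - f x) * (1 / (2 * a)) := by
    ext x
    by_cases hx : x ∈ B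
    · have h2 := (lt_inner_K_iff e y x he a ha).mpr hx
      rw [indicator_of_mem hx, Pi.one_apply, abs_of_nonneg (by linarith [h1 x]),
        abs_of_nonneg (by linarith)]
      ring
    · have h2 := mt (lt_inner_K_iff e y x he a ha).mp hx
      rw [indicator_of_notMem hx, abs_of_nonpos (by linarith [h0 x]),
        abs_of_nonpos (by linarith)]
      ring
  have i1 := hk hBi (ind_abs_le _)
  have i2 := hk hf hb
  rw [e1]
  have i3 : Integrable (fun x => B.indicator 1 x * inner ℝ e (K (x - y)) - f x * inner ℝ e (K (x - y))) :=
    i1.sub i2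
  have i4 : Integrable (fun x => (B.indicator 1 x - f x) * (1 / (2 * a))) :=
    (hBi.sub hf).mul_const _
  refine ⟨i3.sub i4, ?_⟩
  rw [integral_sub i3 i4, integral_sub i1 i2, integral_mul_const,
    integral_sub hBi hf, ← inner_G hBi (ind_abs_le _), ← inner_G hf hb, hB,
    G_ball _ _ _ ha (by simp [norm_smul, he, abs_of_pos ha]), ind_integral measurableSet_ball,
    volume_real_ball _ _ ha.le]
  have : y - (y + a • e) = - (a • e) := by ring
  rw [this, smul_neg, neg_neg, real_inner_smul_right, real_inner_smul_right,
    real_inner_self_eq_norm_sq, he]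
  field_simp
  ring

lemma exists_unit_inner (g : ℂ) : ∃ e : ℂ, ‖e‖ = 1 ∧ inner ℝ e g = ‖g‖ := by
  by_cases hg : g = 0
  · exact ⟨1, by simp, by simp [hg]⟩
  · have : 0 < ‖g‖ := norm_pos_iff.mpr hg
    refine ⟨‖g‖⁻¹ • g, ?_, ?_⟩
    · rw [norm_smul]; simp [this.ne']
    · rw [real_inner_smul_left, real_inner_self_eq_norm_sq]; field_simp

lemma bathtub {f : ℂ → ℝ} (hf : Integrable f) (h0 : ∀ x, 0 ≤ f x) (h1 : ∀ x, f x ≤ 1) (y : ℂ) :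
    ‖G f y‖ ≤ Real.sqrt (Real.pi * ∫ x, f x) := by
  have hpi := Real.pi_pos
  obtain ⟨e, he, heg⟩ := exists_unit_inner (G f y)
  have key : ∀ a > 0, ‖G f y‖ ≤ Real.pi * a / 2 + (∫ x, f x) / (2 * a) := by
    intro a ha
    have h2 := (bathtub_deficit hf h0 h1 e y he a ha).2
    have h3 : 0 ≤ ∫ x, |(ball (y + a • e) a).indicator 1 x - f x| *
      |inner ℝ e (K (x - y)) - 1 / (2 * a)| := integral_nonneg fun x => by positivity
    rw [heg] at h2
    linarith
  have hM : 0 ≤ ∫ x, f x := integral_nonneg h0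
  set M := ∫ x, f x
  rcases hM.eq_or_lt with hM0 | hM0
  · rw [← hM0] at key ⊢
    simp only [mul_zero, Real.sqrt_zero]
    refine le_of_forall_pos_le_add fun ε hε => ?_
    have := key (2 * ε / Real.pi) (by positivity)
    have h4 : Real.pi * (2 * ε / Real.pi) / 2 + 0 / (2 * (2 * ε / Real.pi)) = ε := by field_simp; simp
    rw [h4] at this; linarith
  · have := key (Real.sqrt (M / Real.pi)) (by positivity)
    refine this.trans (le_of_eq ?_)
    rw [Real.sqrt_div hM0.le, Real.sqrt_mul hpi.le]
    have hs := Real.sqrt_pos.mpr hM0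
    have hp := Real.sqrt_pos.mpr hpi
    have e1 := Real.sq_sqrt hM0.le
    have e2 := Real.sq_sqrt hpi.le
    field_simp
    rw [← e1]
    nth_rewrite 1 [← e2]
    simp only [Real.sqrt_sq hs.le]
    try nlinarith

end RP

namespace RP
open scoped Topology Gradient

lemma ball_nest (y e : ℂ) (he : ‖e‖ = 1) {a b : ℝ} (ha : 0 < a) (h : a ≤ b) :
    ball (y + a • e) a ⊆ ball (y + b • e) b := by
  intro x hx
  rw [← lt_inner_K_iff e y x he _ (by linarith)]
  rw [← lt_inner_K_iff e y x he _ ha] at hx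
  refine lt_of_le_of_lt ?_ hx
  gcongr

lemma disc_quant {f : ℂ → ℝ} (hf : Integrable f) (h0 : ∀ x, 0 ≤ f x) (h1 : ∀ x, f x ≤ 1)
    (e y : ℂ) (he : ‖e‖ = 1) (a a1 a2 η : ℝ) (ha1 : 0 < a1) (h12 : a1 < a) (h23 : a < a2)
    (hη : 0 < η) (hη1 : η ≤ 1 / (2 * a1) - 1 / (2 * a)) (hη2 : η ≤ 1 / (2 * a) - 1 / (2 * a2)) :
    ∫ x, |(ball (y + a • e) a).indicator 1 x - f x| ≤ Real.pi * (a2 ^ 2 - a1 ^ 2)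
      + (Real.pi * a / 2 + (∫ x, f x) / (2 * a) - inner ℝ e (G f y)) / η := by
  have ha : 0 < a := ha1.trans h12
  have ha2 : 0 < a2 := ha.trans h23
  obtain ⟨hi, hd⟩ := bathtub_deficit hf h0 h1 e y he a ha
  have hsub := ball_nest y e he ha1 (h12.trans h23).le
  have i1 := ind_ball_integrable (y + a1 • e) a1
  have i2 := ind_ball_integrable (y + a2 • e) a2
  have hp : ∀ x, |(ball (y + a • e) a).indicator 1 x - f x| ≤
      ((ball (y + a2 • e) a2).indicator 1 x - (ball (y + a1 • e) a1).indicator 1 x) +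
      (|(ball (y + a • e) a).indicator 1 x - f x| * |inner ℝ e (K (x - y)) - 1 / (2 * a)|) / η := by
    intro x
    have hle1 : |(ball (y + a • e) a).indicator 1 x - f x| ≤ 1 := by
      rw [abs_le]
      constructor <;> linarith [h0 x, h1 x, ind_nonneg (ball (y + a • e) a) x, ind_le_one (ball (y + a • e) a) x]
    by_cases hk : η ≤ |inner ℝ e (K (x - y)) - 1 / (2 * a)|
    · have t1 : |(ball (y + a • e) a).indicator 1 x - f x| ≤
        (|(ball (y + a • e) a).indicator 1 x - f x| * |inner ℝ e (K (x - y)) - 1 / (2 * a)|) / η := by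
        rw [le_div_iff₀ hη]
        gcongr
      have t2 : (ball (y + a1 • e) a1).indicator (1 : ℂ → ℝ) x ≤ (ball (y + a2 • e) a2).indicator (1 : ℂ → ℝ) x :=
        indicator_le_indicator_of_subset hsub (fun _ => zero_le_one) x
      linarith
    · push Not at hk
      rw [abs_lt] at hk
      have m2 : x ∈ ball (y + a2 • e) a2 := by
        rw [← lt_inner_K_iff e y x he _ ha2]; linarith
      have m1 : x ∉ ball (y + a1 • e) a1 := by
        rw [← lt_inner_K_iff e y x he _ ha1]; linarith
      rw [indicator_of_mem m2, indicator_of_notMem m1]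
      have : 0 ≤ (|(ball (y + a • e) a).indicator 1 x - f x| * |inner ℝ e (K (x - y)) - 1 / (2 * a)|) / η := by
        positivity
      simp only [Pi.one_apply]
      linarith
  have iB : Integrable (fun x => |(ball (y + a • e) a).indicator 1 x - f x|) :=
    ((ind_ball_integrable _ _).sub hf).abs
  have i3 : Integrable (fun x => (ball (y + a2 • e) a2).indicator (1 : ℂ → ℝ) x - (ball (y + a1 • e) a1).indicator 1 x) :=
    i2.sub i1
  have i4 := hi.div_const η
  refine (integral_mono iB (i3.add i4) hp).trans (le_of_eq ?_)
  simp only [Pi.add_apply]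
  rw [integral_add i3 i4, integral_sub i2 i1, integral_div, hd, ind_integral measurableSet_ball,
    ind_integral measurableSet_ball, volume_real_ball _ _ ha2.le, volume_real_ball _ _ ha1.le]
  ring

lemma disc_seq {f : ℕ → ℂ → ℝ} (hf : ∀ n, Integrable (f n)) (h0 : ∀ n x, 0 ≤ f n x)
    (h1 : ∀ n x, f n x ≤ 1) (a : ℝ) (ha : 0 < a)
    (hM : Tendsto (fun n => ∫ x, f n x) atTop (𝓝 (Real.pi * a ^ 2)))
    (y : ℕ → ℂ) (hG : ∀ δ > 0, ∀ᶠ n in atTop, Real.pi * a - δ ≤ ‖G (f n) (y n)‖) :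
    ∃ c : ℕ → ℂ, Tendsto (fun n => ∫ x, |(ball (c n) a).indicator 1 x - f n x|) atTop (𝓝 0) := by
  have hpi := Real.pi_pos
  choose e he heG using fun n => exists_unit_inner (G (f n) (y n))
  refine ⟨fun n => y n + a • e n, ?_⟩
  rw [Metric.tendsto_atTop']
  intro ε hε
  obtain ⟨κ, hκ0, hκ1, hκ⟩ : ∃ κ : ℝ, 0 < κ ∧ κ < a ∧ Real.pi * ((a + κ) ^ 2 - (a - κ) ^ 2) ≤ ε / 3 := by
    refine ⟨min (a / 2) (ε / (12 * Real.pi * a)), by positivity, ?_, ?_⟩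
    · exact lt_of_le_of_lt (min_le_left _ _) (by linarith)
    · have : min (a / 2) (ε / (12 * Real.pi * a)) ≤ ε / (12 * Real.pi * a) := min_le_right _ _
      rw [le_div_iff₀ (by positivity)] at this
      nlinarith
  set η := min (1 / (2 * (a - κ)) - 1 / (2 * a)) (1 / (2 * a) - 1 / (2 * (a + κ))) with hη
  have hηp : 0 < η := by
    have : 0 < a - κ := by linarith
    refine lt_min (sub_pos.mpr ?_) (sub_pos.mpr ?_)
    · apply one_div_lt_one_div_of_lt <;> linarith
    · apply one_div_lt_one_div_of_lt <;> linarith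
  have e1 := hG (ε * η / 6) (by positivity)
  have e2 : ∀ᶠ n in atTop, ∫ x, f n x < Real.pi * a ^ 2 + 2 * a * (ε * η / 6) :=
    hM.eventually_lt_const (by have : 0 < 2 * a * (ε * η / 6) := by positivity
                               linarith)
  obtain ⟨n0, hn0⟩ := eventually_atTop.mp (e1.and e2)
  refine ⟨n0, fun n hn => ?_⟩
  obtain ⟨e3, e4⟩ := hn0 n hn.le
  have key := disc_quant (hf n) (h0 n) (h1 n) (e n) (y n) (he n) a (a - κ) (a + κ) η (by linarith)
    (by linarith) (by linarith) hηp (min_le_left _ _) (min_le_right _ _)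
  rw [heG] at key
  have h5 : 0 ≤ ∫ x, |(ball (y n + a • e n) a).indicator 1 x - f n x| := integral_nonneg fun x => abs_nonneg _
  rw [Real.dist_eq, sub_zero, abs_of_nonneg h5]
  have h6 : (∫ x, f n x) / (2 * a) ≤ Real.pi * a / 2 + ε * η / 6 := by
    rw [div_le_iff₀ (by positivity)]
    nlinarith
  have h7 : (Real.pi * a / 2 + (∫ x, f n x) / (2 * a) - ‖G (f n) (y n)‖) / η ≤ ε / 3 := by
    rw [div_le_iff₀ hηp]
    linarith
  linarith

/-- Cauchy–Schwarz for real functions. -/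
lemma cs {f g : ℂ → ℝ} (hf : Integrable (fun x => f x ^ 2)) (hg : Integrable (fun x => g x ^ 2))
    (hfg : Integrable (fun x => f x * g x)) :
    (∫ x, f x * g x) ^ 2 ≤ (∫ x, f x ^ 2) * ∫ x, g x ^ 2 := by
  set a := ∫ x, f x ^ 2
  set b := ∫ x, f x * g x
  set c := ∫ x, g x ^ 2
  have key : ∀ t : ℝ, 0 ≤ a * (t * t) + (2 * b) * t + c := by
    intro t
    have : 0 ≤ ∫ x, (t * f x + g x) ^ 2 := integral_nonneg fun x => sq_nonneg _
    have e : (fun x => (t * f x + g x) ^ 2) = fun x => (t ^ 2 * f x ^ 2 + (2 * t) * (f x * g x)) + g x ^ 2 := by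
      ext x; ring
    rw [e] at this
    have i1 := hf.const_mul (t ^ 2)
    have i2 := hfg.const_mul (2 * t)
    have i3 : Integrable (fun x => t ^ 2 * f x ^ 2 + (2 * t) * (f x * g x)) := i1.add i2
    rw [integral_add i3 hg, integral_add i1 i2, integral_const_mul, integral_const_mul] at this
    linarith
  have := discrim_le_zero key
  unfold discrim at this
  nlinarith

end RP

namespace RP
open scoped Topology Gradient

lemma hasGrad {φ : ℂ → ℝ} (h : ContDiff ℝ 1 φ) (x : ℂ) : HasGradientAt φ (∇ φ x) x :=
  (h.differentiable (by simp) x).hasGradientAt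

lemma hasGrad_add {φ χ : ℂ → ℝ} {g k x : ℂ} (h : HasGradientAt φ g x) (h' : HasGradientAt χ k x) :
    HasGradientAt (fun x => φ x + χ x) (g + k) x := by
  rw [hasGradientAt_iff_hasFDerivAt] at *
  refine (h.add h').congr_fderiv (ContinuousLinearMap.ext fun w => ?_)
  change inner ℝ g w + inner ℝ k w = inner ℝ (g + k) w
  rw [inner_add_left]

lemma hasGrad_mul_const {φ : ℂ → ℝ} {g x : ℂ} (h : HasGradientAt φ g x) (c : ℝ) :
    HasGradientAt (fun x => c * φ x) (c • g) x := by
  rw [hasGradientAt_iff_hasFDerivAt] at *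
  refine (h.const_mul c).congr_fderiv (ContinuousLinearMap.ext fun w => ?_)
  change c * inner ℝ g w = inner ℝ (c • g) w
  rw [real_inner_smul_left]

lemma hasGrad_mul {φ χ : ℂ → ℝ} {g k x : ℂ} (h : HasGradientAt φ g x) (h' : HasGradientAt χ k x) :
    HasGradientAt (fun x => φ x * χ x) (φ x • k + χ x • g) x := by
  rw [hasGradientAt_iff_hasFDerivAt] at *
  refine (h.mul h').congr_fderiv (ContinuousLinearMap.ext fun w => ?_)
  change φ x * inner ℝ k w + χ x * inner ℝ g w = inner ℝ (φ x • k + χ x • g) w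
  rw [inner_add_left, real_inner_smul_left, real_inner_smul_left]

lemma hasGrad_comp {φ : ℂ → ℝ} {g x : ℂ} (h : HasGradientAt φ g x) {T : ℝ → ℝ} {T' : ℝ}
    (hT : HasDerivAt T T' (φ x)) :
    HasGradientAt (fun x => T (φ x)) (T' • g) x := by
  rw [hasGradientAt_iff_hasFDerivAt] at *
  refine (hT.comp_hasFDerivAt x h).congr_fderiv (ContinuousLinearMap.ext fun w => ?_)
  change T' * inner ℝ g w = inner ℝ (T' • g) w
  rw [real_inner_smul_left]

lemma grad_add {φ χ : ℂ → ℝ} (h : ContDiff ℝ 1 φ) (h' : ContDiff ℝ 1 χ) (x : ℂ) :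
    ∇ (fun x => φ x + χ x) x = ∇ φ x + ∇ χ x := (hasGrad_add (hasGrad h x) (hasGrad h' x)).gradient

lemma grad_smul {φ : ℂ → ℝ} (h : ContDiff ℝ 1 φ) (c : ℝ) (x : ℂ) :
    ∇ (fun x => c * φ x) x = c • ∇ φ x := (hasGrad_mul_const (hasGrad h x) c).gradient

lemma grad_comp {φ : ℂ → ℝ} (h : ContDiff ℝ 1 φ) {T : ℝ → ℝ} (hT : ContDiff ℝ 1 T) (x : ℂ) :
    ∇ (fun x => T (φ x)) x = deriv T (φ x) • ∇ φ x :=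
  (hasGrad_comp (hasGrad h x) (hT.differentiable (by simp) (φ x)).hasDerivAt).gradient

lemma compactSupp_of {E : Type*} [NormedAddCommGroup E] {φ : ℂ → E} {R : ℝ} (h : ∀ x, R < ‖x‖ → φ x = 0) : HasCompactSupport φ := by
  refine HasCompactSupport.intro (isCompact_closedBall (0:ℂ) R) fun x hx => h x ?_
  rw [mem_closedBall_zero_iff] at hx
  linarith

/-- Divergence identity. -/
lemma div_id {φ : ℂ → ℝ} (h : ContDiff ℝ 1 φ) (hc : HasCompactSupport φ) :
    ∫ x, inner ℝ x (∇ φ x) = - 2 * ∫ x, φ x := by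
  obtain ⟨R, hR0, hR⟩ : ∃ R > 0, ∀ x, R ≤ ‖x‖ → φ x = 0 := hc.exists_pos_le_norm
  have hpi := Real.pi_pos
  have h1 := weak_poisson h hc (ind_ball_integrable 0 R) (ind_abs_le _)
  have h2 : ∀ x, φ x * (ball (0:ℂ) R).indicator 1 x = φ x := by
    intro x
    by_cases hx : x ∈ ball (0:ℂ) R
    · simp [indicator_of_mem hx]
    · rw [mem_ball_zero_iff, not_lt] at hx
      simp [hR x hx]
  simp only [h2] at h1
  have h3 : ∀ x, inner ℝ (∇ φ x) (G ((ball (0:ℂ) R).indicator 1) x) = (-Real.pi) * inner ℝ x (∇ φ x) := by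
    intro x
    by_cases hx : ‖x‖ ≤ R
    · rw [G_ball 0 x R hR0 (by simpa using hx), sub_zero, inner_neg_right, real_inner_smul_right,
        real_inner_comm]; ring
    · have : ∇ φ x = 0 := by
        have : φ =ᶠ[𝓝 x] fun _ => 0 := by
          filter_upwards [(isOpen_lt continuous_const continuous_norm).mem_nhds (not_le.mp hx)] with z hz
          exact hR z (le_of_lt hz)
        rw [this.gradient_eq]; simp
      simp [this]
  simp only [h3] at h1
  rw [integral_const_mul] at h1
  have : Real.pi * (∫ x, inner ℝ x (∇ φ x) + 2 * 0) = Real.pi * (-2 * ∫ x, φ x) := by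
    simp only [mul_zero, add_zero]
    linarith
  simpa using mul_left_cancel₀ hpi.ne' this

/-! L² facts -/
lemma memLp_of_cont {E : Type*} [NormedAddCommGroup E] {F : ℂ → E} (h : Continuous F) {R : ℝ} (hs : ∀ x, R < ‖x‖ → F x = 0) :
    MemLp F 2 := h.memLp_of_hasCompactSupport (compactSupp_of hs)

lemma grad_zero_out {φ : ℂ → ℝ} {R : ℝ} (hs : ∀ x, R < ‖x‖ → φ x = 0) (x : ℂ) (hx : R < ‖x‖) : ∇ φ x = 0 := by
  have : φ =ᶠ[𝓝 x] fun _ => 0 := by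
    filter_upwards [(isOpen_lt continuous_const continuous_norm).mem_nhds hx] with z hz
    exact hs z hz
  rw [this.gradient_eq]; simp

lemma ip_toLp {F H : ℂ → ℂ} (hF : MemLp F 2) (hH : MemLp H 2) :
    inner ℝ (hF.toLp F) (hH.toLp H) = ∫ x, inner ℝ (F x) (H x) := by
  rw [L2.inner_def]
  refine integral_congr_ae ?_
  filter_upwards [hF.coeFn_toLp, hH.coeFn_toLp] with x h1 h2
  rw [h1, h2]

lemma ip_int {F H : ℂ → ℂ} (hF : MemLp F 2) (hH : MemLp H 2) :
    Integrable fun x => inner ℝ (F x) (H x) := by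
  refine (L2.integrable_inner (𝕜 := ℝ) (hF.toLp F) (hH.toLp H)).congr ?_
  filter_upwards [hF.coeFn_toLp, hH.coeFn_toLp] with x h1 h2
  rw [h1, h2]

/-- L² norm -/
def nr (F : ℂ → ℂ) : ℝ := Real.sqrt (∫ x, ‖F x‖ ^ 2)

lemma nr_nonneg (F : ℂ → ℂ) : 0 ≤ nr F := Real.sqrt_nonneg _

lemma nr_sq (F : ℂ → ℂ) : nr F ^ 2 = ∫ x, ‖F x‖ ^ 2 :=
  Real.sq_sqrt (integral_nonneg fun x => by positivity)

lemma nr_toLp {F : ℂ → ℂ} (hF : MemLp F 2) : ‖hF.toLp F‖ = nr F := by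
  rw [← abs_of_nonneg (norm_nonneg _), ← abs_of_nonneg (nr_nonneg F), ← sq_eq_sq_iff_abs_eq_abs,
    nr_sq, ← real_inner_self_eq_norm_sq, ip_toLp]
  simp only [real_inner_self_eq_norm_sq]

lemma ip_le {F H : ℂ → ℂ} (hF : MemLp F 2) (hH : MemLp H 2) :
    |∫ x, inner ℝ (F x) (H x)| ≤ nr F * nr H := by
  rw [← ip_toLp hF hH, ← nr_toLp hF, ← nr_toLp hH]
  exact abs_real_inner_le_norm _ _

lemma nr_add_le {F H : ℂ → ℂ} (hF : MemLp F 2) (hH : MemLp H 2) :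
    nr (fun x => F x + H x) ≤ nr F + nr H := by
  have := nr_toLp (hF.add hH)
  change _ = nr (fun x => F x + H x) at this
  rw [← this, ← nr_toLp hF, ← nr_toLp hH, MemLp.toLp_add]
  exact norm_add_le _ _

lemma nr_sub_le {F H : ℂ → ℂ} (hF : MemLp F 2) (hH : MemLp H 2) :
    nr (fun x => F x - H x) ≤ nr F + nr H := by
  have := nr_toLp (hF.sub hH)
  change _ = nr (fun x => F x - H x) at this
  rw [← this, ← nr_toLp hF, ← nr_toLp hH, MemLp.toLp_sub]
  exact norm_sub_le _ _

/-- Poincaré inequality. -/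
lemma poincare {φ : ℂ → ℝ} (h : ContDiff ℝ 1 φ) {R : ℝ} (hR : 0 ≤ R) (hs : ∀ x, R < ‖x‖ → φ x = 0) :
    ∫ x, φ x ^ 2 ≤ R ^ 2 * nr (∇ φ) ^ 2 := by
  have hc := compactSupp_of hs
  have h1 := div_id (φ := fun x => φ x ^ 2) (h.pow 2) (compactSupp_of (R := R) fun x hx => by simp [hs x hx])
  have h2 : ∀ x, ∇ (fun x => φ x ^ 2) x = (2 * φ x) • ∇ φ x := by
    intro x
    have := (hasGrad_mul (hasGrad h x) (hasGrad h x)).gradient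
    simp only [← sq] at this
    rw [this, ← add_smul, two_mul]
  simp only [h2] at h1
  have m1 : MemLp (fun x => φ x • x) 2 :=
    memLp_of_cont (h.continuous.smul continuous_id) (R := R) (fun x hx => by simp [hs x hx])
  have m2 : MemLp (∇ φ) 2 := memLp_of_cont (continuous_grad h) (R := R) (grad_zero_out hs)
  have h3 := ip_le m1 m2
  have h4 : ∫ x, inner ℝ x ((2 * φ x) • ∇ φ x) = 2 * ∫ x, inner ℝ (φ x • x) (∇ φ x) := by
    rw [← integral_const_mul]
    congr 1; ext x
    rw [real_inner_smul_left, real_inner_smul_right]; ring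
  rw [h4] at h1
  have i2 : Integrable (fun x => φ x ^ 2) :=
    (h.continuous.pow 2).integrable_of_hasCompactSupport (compactSupp_of (R := R) fun x hx => by simp [hs x hx])
  have h5 : nr (fun x => φ x • x) ^ 2 ≤ R ^ 2 * ∫ x, φ x ^ 2 := by
    rw [nr_sq, ← integral_const_mul]
    refine integral_mono ?_ (i2.const_mul _) ?_
    · have := (m1.integrable_norm_pow (by norm_num))
      simpa using this
    · intro x
      simp only [norm_smul, mul_pow, Real.norm_eq_abs, sq_abs]
      by_cases hx : R < ‖x‖
      · simp [hs x hx]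
      · rw [mul_comm]
        have : ‖x‖ ≤ R := not_lt.mp hx
        gcongr
  set I := ∫ x, φ x ^ 2
  have hI : 0 ≤ I := integral_nonneg fun x => sq_nonneg _
  have h6 : I ≤ nr (fun x => φ x • x) * nr (∇ φ) := by
    have := (abs_le.mp h3).1
    linarith
  have h7 : I ^ 2 ≤ (R ^ 2 * I) * nr (∇ φ) ^ 2 := by
    calc I ^ 2 ≤ (nr (fun x => φ x • x) * nr (∇ φ)) ^ 2 := by gcongr
      _ = nr (fun x => φ x • x) ^ 2 * nr (∇ φ) ^ 2 := by ring
      _ ≤ _ := by gcongr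
  rcases hI.eq_or_lt with h0 | h0
  · rw [← h0]; positivity
  · have : I * I ≤ I * (R ^ 2 * nr (∇ φ) ^ 2) := by nlinarith
    exact le_of_mul_le_mul_left this h0

end RP

namespace RP
open scoped Topology Gradient

structure TC (W : Set (ℂ → ℝ)) (A : Set ℂ) (R : ℝ) : Prop where
  hR : 0 < R
  mA : MeasurableSet A
  sub : A ⊆ closedBall 0 R
  zero : (fun _ => 0) ∈ W
  add : ∀ φ ∈ W, ∀ χ ∈ W, (fun x => φ x + χ x) ∈ W
  smul : ∀ (c : ℝ), ∀ φ ∈ W, (fun x => c * φ x) ∈ W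
  comp : ∀ T : ℝ → ℝ, ContDiff ℝ 1 T → T 0 = 0 → ∀ φ ∈ W, (fun x => T (φ x)) ∈ W
  c1 : ∀ φ ∈ W, ContDiff ℝ 1 φ
  supp : ∀ φ ∈ W, ∀ x, R < ‖x‖ → φ x = 0
  grad : ∀ φ ∈ W, ∀ x ∉ A, ∇ φ x = 0

variable {W : Set (ℂ → ℝ)} {A : Set ℂ} {R : ℝ}

def XA (A : Set ℂ) (x : ℂ) : ℂ := A.indicator (fun x => x) x

lemma TC.memX (h : TC W A R) : MemLp (XA A) 2 := by
  have hfin : volume A ≠ ⊤ := ((measure_mono h.sub).trans_lt measure_closedBall_lt_top).ne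
  have h1 : MemLp (A.indicator (fun _ => (R : ℝ))) 2 :=
    memLp_indicator_const 2 h.mA _ (Or.inr hfin)
  refine h1.mono ((measurable_id.indicator h.mA).aestronglyMeasurable) ?_
  filter_upwards with x
  by_cases hx : x ∈ A
  · have := h.sub hx
    rw [mem_closedBall_zero_iff] at this
    simp only [XA, indicator_of_mem hx]
    rw [Real.norm_of_nonneg h.hR.le]; exact this
  · simp [XA, indicator_of_notMem hx]

lemma TC.memG (h : TC W A R) {φ : ℂ → ℝ} (hφ : φ ∈ W) : MemLp (∇ φ) 2 :=
  memLp_of_cont (continuous_grad (h.c1 φ hφ)) (R := R) (grad_zero_out (h.supp φ hφ))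

lemma TC.int (h : TC W A R) {φ : ℂ → ℝ} (hφ : φ ∈ W) : Integrable φ :=
  (h.c1 φ hφ).continuous.integrable_of_hasCompactSupport (compactSupp_of (h.supp φ hφ))

lemma TC.cpt (h : TC W A R) {φ : ℂ → ℝ} (hφ : φ ∈ W) : HasCompactSupport φ :=
  compactSupp_of (h.supp φ hφ)

lemma TC.gradsub (h : TC W A R) {φ χ : ℂ → ℝ} (hφ : φ ∈ W) (hχ : χ ∈ W) :
    (fun x => φ x - χ x) ∈ W ∧ ∇ (fun x => φ x - χ x) = fun x => ∇ φ x - ∇ χ x := by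
  have h1 := h.add φ hφ _ (h.smul (-1) χ hχ)
  have e : (fun x => φ x + -1 * χ x) = fun x => φ x - χ x := by ext x; ring
  have h2 : ∀ x, ∇ (fun x => φ x - χ x) x = ∇ φ x - ∇ χ x := by
    intro x
    have := grad_add (h.c1 φ hφ) (h.c1 _ (h.smul (-1) χ hχ)) x
    rw [e, grad_smul (h.c1 χ hχ)] at this
    rw [this, neg_one_smul, sub_eq_add_neg]
  rw [e] at h1
  exact ⟨h1, funext h2⟩

lemma TC.ipX (h : TC W A R) {φ : ℂ → ℝ} (hφ : φ ∈ W) :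
    ∫ x, inner ℝ (XA A x) (∇ φ x) = - 2 * ∫ x, φ x := by
  rw [← div_id (h.c1 φ hφ) (h.cpt hφ)]
  congr 1; ext x
  by_cases hx : x ∈ A
  · simp [XA, indicator_of_mem hx]
  · simp [XA, indicator_of_notMem hx, h.grad φ hφ x hx]

/-- L¹ bound -/
lemma TC.l1 (h : TC W A R) {φ : ℂ → ℝ} (hφ : φ ∈ W) :
    ∫ x, |φ x| ≤ (Real.sqrt (Real.pi) * R ^ 2) * nr (∇ φ) := by
  have hR := h.hR
  have hpi := Real.pi_pos
  have hc := (h.c1 φ hφ).continuous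
  have h1 := poincare (h.c1 φ hφ) hR.le (h.supp φ hφ)
  have i1 : Integrable (fun x => |φ x| ^ 2) :=
    (hc.abs.pow 2).integrable_of_hasCompactSupport (compactSupp_of (R := R) fun x hx => by simp [h.supp φ hφ x hx])
  have i0 : Integrable ((closedBall (0:ℂ) R).indicator (1 : ℂ → ℝ)) :=
    ind_integrable measurableSet_closedBall measure_closedBall_lt_top.ne
  have e1 : ∀ x, (closedBall (0:ℂ) R).indicator (1 : ℂ → ℝ) x ^ 2 = (closedBall (0:ℂ) R).indicator (1 : ℂ → ℝ) x := by
    intro x; by_cases hx : x ∈ closedBall (0:ℂ) R <;> simp [indicator, hx]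
  have e2 : ∀ x, |φ x| * (closedBall (0:ℂ) R).indicator (1 : ℂ → ℝ) x = |φ x| := by
    intro x; by_cases hx : x ∈ closedBall (0:ℂ) R
    · simp [indicator, hx]
    · rw [mem_closedBall_zero_iff, not_le] at hx
      simp [h.supp φ hφ x hx]
  have := cs (f := fun x => |φ x|) (g := (closedBall (0:ℂ) R).indicator (1 : ℂ → ℝ)) i1 (by simpa only [e1] using i0)
    (by simpa only [e2] using (h.int hφ).abs)
  simp only [e1, e2, sq_abs] at this
  rw [ind_integral measurableSet_closedBall] at this
  have hv : volume.real (closedBall (0:ℂ) R) = Real.pi * R ^ 2 := by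
    simp [Measure.real, Complex.volume_closedBall, ENNReal.toReal_ofReal hR.le]; ring
  rw [hv] at this
  refine abs_le_of_sq_le_sq' ?_ (by have := nr_nonneg (∇ φ); positivity) |>.2
  calc _ ≤ _ := this
    _ ≤ (R ^ 2 * nr (∇ φ) ^ 2) * (Real.pi * R ^ 2) := by gcongr
    _ = (Real.sqrt Real.pi * R ^ 2 * nr (∇ φ)) ^ 2 := by
      rw [mul_pow, mul_pow, Real.sq_sqrt hpi.le]; ring

def TC.sub' (h : TC W A R) : Submodule ℝ (Lp ℂ 2 (volume : Measure ℂ)) where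
  carrier := {s | ∃ φ, ∃ hφ : φ ∈ W, s = (h.memG hφ).toLp _}
  add_mem' := by
    rintro _ _ ⟨φ, hφ, rfl⟩ ⟨χ, hχ, rfl⟩
    refine ⟨_, h.add φ hφ χ hχ, ?_⟩
    rw [← MemLp.toLp_add]
    congr 1
    ext x
    exact (grad_add (h.c1 φ hφ) (h.c1 χ hχ) x).symm
  zero_mem' := by
    refine ⟨_, h.zero, ?_⟩
    symm
    rw [← norm_eq_zero, nr_toLp]
    simp [nr]
  smul_mem' := by
    rintro c _ ⟨φ, hφ, rfl⟩
    refine ⟨_, h.smul c φ hφ, ?_⟩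
    have e1 := (MemLp.toLp_const_smul c (h.memG hφ))
    refine e1.symm.trans (MemLp.toLp_congr _ _ ?_)
    filter_upwards with x
    exact (grad_smul (h.c1 φ hφ) c x).symm

/-- approximately-minimizing sequence -/
theorem TC.minseq (h : TC W A R) : ∃ (φ : ℕ → ℂ → ℝ) (ε : ℕ → ℝ), (∀ n, φ n ∈ W) ∧
    Tendsto ε atTop (𝓝 0) ∧ (∀ n, 0 ≤ ε n) ∧
    (∀ n, ∀ χ ∈ W, |∫ x, inner ℝ (XA A x + ∇ (φ n) x) (∇ χ x)| ≤ ε n * nr (∇ χ)) ∧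
    (∀ n m, nr (fun x => ∇ (φ n) x - ∇ (φ m) x) ≤ ε n + ε m) ∧
    (∀ n, ∀ χ ∈ W, nr (fun x => XA A x + ∇ (φ n) x) ≤ nr (fun x => XA A x + ∇ χ x) + ε n) := by
  set S := h.sub' with hS
  set X := h.memX.toLp _ with hX
  set K := S.topologicalClosure with hK
  haveI : CompleteSpace K := S.isClosed_topologicalClosure.completeSpace_coe
  set w := K.starProjection (-X) with hw
  have hwK : w ∈ K := Submodule.starProjection_apply_mem _ _
  have hwc : w ∈ closure (S : Set (Lp ℂ 2 (volume : Measure ℂ))) := hwK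
  obtain ⟨s, hsS, hst⟩ := mem_closure_iff_seq_limit.mp hwc
  choose φ hφ hsφ using hsS
  have horth : ∀ v ∈ S, inner ℝ (X + w) v = 0 := by
    intro v hv
    have := Submodule.starProjection_inner_eq_zero (K := K) (-X) v (S.le_topologicalClosure hv)
    rw [← hw] at this
    have e : -X - w = -(X + w) := by abel
    rw [e, inner_neg_left, neg_eq_zero] at this
    exact this
  have hX1 : ∀ {χ} (hχ : χ ∈ W), (h.memX.add (h.memG hχ)).toLp _ = X + (h.memG hχ).toLp _ := by
    intro χ hχ; rw [MemLp.toLp_add]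
  refine ⟨φ, fun n => ‖s n - w‖, hφ, ?_, fun n => norm_nonneg _, ?_, ?_, ?_⟩
  · have := (tendsto_iff_norm_sub_tendsto_zero.mp hst)
    exact this
  · intro n χ hχ
    have e := ip_toLp (h.memX.add (h.memG (hφ n))) (h.memG hχ)
    simp only [Pi.add_apply] at e
    rw [← e, hX1 (hφ n), ← hsφ n, ← nr_toLp (h.memG hχ)]
    have h2 : X + s n = (X + w) + (s n - w) := by abel
    rw [h2, inner_add_left, horth _ ⟨χ, hχ, rfl⟩, zero_add]
    exact abs_real_inner_le_norm _ _
  · intro n m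
    have e := nr_toLp ((h.memG (hφ n)).sub (h.memG (hφ m)))
    change _ = nr (fun x => ∇ (φ n) x - ∇ (φ m) x) at e
    rw [← e, MemLp.toLp_sub (h.memG (hφ n)) (h.memG (hφ m)), ← hsφ n, ← hsφ m]
    have : s n - s m = (s n - w) - (s m - w) := by abel
    rw [this]; exact norm_sub_le _ _
  · intro n χ hχ
    have e := nr_toLp (h.memX.add (h.memG (hφ n)))
    have e' := nr_toLp (h.memX.add (h.memG hχ))
    change _ = nr (fun x => XA A x + ∇ (φ n) x) at e
    change _ = nr (fun x => XA A x + ∇ χ x) at e'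
    rw [← e, ← e', hX1 (hφ n), hX1 hχ, ← hsφ n]
    set v := (h.memG hχ).toLp _ with hv
    have hvS : v ∈ S := ⟨χ, hχ, rfl⟩
    have h3 : ‖X + w‖ ≤ ‖X + v‖ := by
      have e1 : X + v = (X + w) + (v - w) := by abel
      have hvw : v - w ∈ K := K.sub_mem (S.le_topologicalClosure hvS) hwK
      have o : inner ℝ (X + w) (v - w) = 0 := by
        have := Submodule.starProjection_inner_eq_zero (K := K) (-X) _ hvw
        rw [← hw] at this
        have e : -X - w = -(X + w) := by abel
        rw [e, inner_neg_left, neg_eq_zero] at this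
        exact this
      have := norm_add_sq_real (X + w) (v - w)
      rw [o] at this
      rw [e1]
      refine le_of_sq_le_sq ?_ (norm_nonneg _)
      nlinarith [sq_nonneg ‖v - w‖]
    have h2 : X + s n = (X + w) + (s n - w) := by abel
    rw [h2]
    exact (norm_add_le _ _).trans (by gcongr)

end RP

namespace RP
open scoped Topology Gradient

lemma norm_toL1_real {f : ℂ → ℝ} (hf : Integrable f) : ‖hf.toL1 f‖ = ∫ x, |f x| := by
  rw [L1.norm_of_fun_eq_integral_norm]; rfl

lemma l1_ae_subseq {f : ℕ → ℂ → ℝ} {p : ℂ → ℝ} (hf : ∀ n, Integrable (f n)) (hp : Integrable p)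
    (h : Tendsto (fun n => ∫ x, |f n x - p x|) atTop (𝓝 0)) :
    ∃ ns : ℕ → ℕ, StrictMono ns ∧ ∀ᵐ x, Tendsto (fun n => f (ns n) x) atTop (𝓝 (p x)) := by
  have h1 : TendstoInMeasure volume f atTop p := by
    refine tendstoInMeasure_of_tendsto_eLpNorm (p := 1) one_ne_zero (fun n => (hf n).aestronglyMeasurable)
      hp.aestronglyMeasurable ?_
    have h2 : ∀ n, eLpNorm (f n - p) 1 volume = ENNReal.ofReal (∫ x, |f n x - p x|) := by
      intro n
      rw [eLpNorm_one_eq_lintegral_enorm, ← ofReal_integral_norm_eq_lintegral_enorm ((hf n).sub hp)]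
      rfl
    simp only [h2]
    have := (ENNReal.continuous_ofReal.tendsto 0).comp h
    rw [ENNReal.ofReal_zero] at this
    exact this
  exact h1.exists_seq_tendsto_ae

lemma l1_complete {f : ℕ → ℂ → ℝ} (hf : ∀ n, Integrable (f n)) (ε : ℕ → ℝ) (hε : Tendsto ε atTop (𝓝 0))
    (h : ∀ n m, ∫ x, |f n x - f m x| ≤ ε n + ε m) :
    ∃ p : ℂ → ℝ, Integrable p ∧ Tendsto (fun n => ∫ x, |f n x - p x|) atTop (𝓝 0) := by
  set s : ℕ → Lp ℝ 1 (volume : Measure ℂ) := fun n => (hf n).toL1 (f n)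
  have hd : ∀ n m, dist (s n) (s m) ≤ ε n + ε m := by
    intro n m
    rw [dist_eq_norm]
    have : s n - s m = ((hf n).sub (hf m)).toL1 _ := by rw [Integrable.toL1_sub]
    rw [this, norm_toL1_real]
    exact h n m
  have hc : CauchySeq s := by
    rw [Metric.cauchySeq_iff]
    intro η hη
    have := hε.eventually_lt_const (half_pos hη)
    obtain ⟨N, hN⟩ := eventually_atTop.mp this
    refine ⟨N, fun m hm n hn => (hd m n).trans_lt ?_⟩
    linarith [hN m hm, hN n hn]
  obtain ⟨q, hq⟩ := cauchySeq_tendsto_of_complete hc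
  refine ⟨q, L1.integrable_coeFn q, ?_⟩
  have := tendsto_iff_norm_sub_tendsto_zero.mp hq
  refine this.congr fun n => ?_
  have e : q = (L1.integrable_coeFn q).toL1 _ := (Integrable.toL1_coeFn q _).symm
  have e2 : s n - q = ((hf n).sub (L1.integrable_coeFn q)).toL1 _ := by
    rw [Integrable.toL1_sub _ _ (hf n) (L1.integrable_coeFn q), ← e]
  rw [e2, norm_toL1_real]
  rfl

structure Sol (W : Set (ℂ → ℝ)) (A : Set ℂ) (R : ℝ) (φ : ℕ → ℂ → ℝ) (ε : ℕ → ℝ) (p : ℂ → ℝ) (V C : ℝ) : Prop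
    extends TC W A R where
  mem : ∀ n, φ n ∈ W
  ε0 : Tendsto ε atTop (𝓝 0)
  εnn : ∀ n, 0 ≤ ε n
  test : ∀ n, ∀ χ ∈ W, |∫ x, inner ℝ (XA A x + ∇ (φ n) x) (∇ χ x)| ≤ ε n * nr (∇ χ)
  test' : ∀ n, ∀ χ ∈ W, |(∫ x, inner ℝ (∇ (φ n) x) (∇ χ x)) - 2 * ∫ x, χ x| ≤ ε n * nr (∇ χ)
  bdd : ∀ n, nr (∇ (φ n)) ≤ C
  pint : Integrable p
  pmeas : Measurable p
  psupp : ∀ x, R < ‖x‖ → p x = 0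
  l1conv : Tendsto (fun n => ∫ x, |φ n x - p x|) atTop (𝓝 0)
  aeconv : ∀ᵐ x, Tendsto (fun n => φ n x) atTop (𝓝 (p x))
  Veq : V = (∫ x in A, ‖x‖ ^ 2) - 2 * ∫ x, p x
  Vlim : Tendsto (fun n => ∫ x, inner ℝ (XA A x + ∇ (φ n) x) (XA A x)) atTop (𝓝 V)
  Vnn : 0 ≤ V
  Vmin : ∀ χ ∈ W, V ≤ nr (fun x => XA A x + ∇ χ x) ^ 2

lemma Sol.intconv {W A R φ ε p V C} (h : Sol W A R φ ε p V C) :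
    Tendsto (fun n => ∫ x, φ n x) atTop (𝓝 (∫ x, p x)) := by
  rw [tendsto_iff_dist_tendsto_zero]
  refine squeeze_zero (fun _ => dist_nonneg) (fun n => ?_) h.l1conv
  rw [Real.dist_eq, ← integral_sub (h.int (h.mem n)) h.pint]
  exact abs_integral_le_integral_abs

theorem TC.exists_sol {W A R} (h : TC W A R) : ∃ φ ε p V C, Sol W A R φ ε p V C := by
  obtain ⟨φ0, ε0, hmem, hε, hεn, htest, hcauchy, hmin⟩ := h.minseq
  have hR := h.hR
  set κ := Real.sqrt Real.pi * R ^ 2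
  have hκ : 0 ≤ κ := by positivity
  have hl1 : ∀ n m, ∫ x, |φ0 n x - φ0 m x| ≤ κ * ε0 n + κ * ε0 m := by
    intro n m
    obtain ⟨h1, h2⟩ := h.gradsub (hmem n) (hmem m)
    have := h.l1 h1
    rw [h2] at this
    refine this.trans ?_
    rw [← mul_add]
    gcongr
    exact hcauchy n m
  obtain ⟨p0, hp0, hconv⟩ := l1_complete (fun n => h.int (hmem n)) (fun n => κ * ε0 n)
    (by simpa using hε.const_mul κ) hl1
  obtain ⟨ns, hns, hae⟩ := l1_ae_subseq (fun n => h.int (hmem n)) hp0 hconv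
  -- good representative
  set p1 := hp0.aestronglyMeasurable.mk p0 with hp1
  have hp1m : StronglyMeasurable p1 := hp0.aestronglyMeasurable.stronglyMeasurable_mk
  have hp1e : p0 =ᵐ[volume] p1 := hp0.aestronglyMeasurable.ae_eq_mk
  set p := (closedBall (0:ℂ) R).indicator p1 with hp
  have hpm : Measurable p := hp1m.measurable.indicator measurableSet_closedBall
  have hpe : p0 =ᵐ[volume] p := by
    filter_upwards [hp1e, hae] with x h1 h2
    by_cases hx : x ∈ closedBall (0:ℂ) R
    · rw [hp, indicator_of_mem hx, h1]
    · rw [hp, indicator_of_notMem hx]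
      rw [mem_closedBall_zero_iff, not_le] at hx
      have : (fun n => φ0 (ns n) x) = fun n => 0 := by ext n; exact h.supp _ (hmem _) x hx
      rw [this] at h2
      exact tendsto_nhds_unique h2 tendsto_const_nhds
  have hpi : Integrable p := hp0.congr hpe
  have hl1' : Tendsto (fun n => ∫ x, |φ0 (ns n) x - p x|) atTop (𝓝 0) := by
    refine (hconv.comp hns.tendsto_atTop).congr fun n => integral_congr_ae ?_
    filter_upwards [hpe] with x hx
    rw [hx]
  set φ := fun n => φ0 (ns n) with hφ
  set ε := fun n => ε0 (ns n) with hεd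
  have hε' : Tendsto ε atTop (𝓝 0) := hε.comp hns.tendsto_atTop
  have hic : Tendsto (fun n => ∫ x, φ n x) atTop (𝓝 (∫ x, p x)) := by
    rw [tendsto_iff_dist_tendsto_zero]
    refine squeeze_zero (fun _ => dist_nonneg) (fun n => ?_) hl1'
    rw [Real.dist_eq, ← integral_sub (h.int (hmem _)) hpi]
    exact abs_integral_le_integral_abs
  obtain ⟨E, hE⟩ : ∃ E, ∀ n, ε0 n ≤ E := by
    obtain ⟨E, hE⟩ := hε.bddAbove_range
    exact ⟨E, fun n => hE ⟨n, rfl⟩⟩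
  have hgX := h.memX
  have hbdd : ∀ n, nr (∇ (φ n)) ≤ 2 * nr (XA A) + E := by
    intro n
    have h1 := hmin (ns n) _ h.zero
    have h2 : (fun x => XA A x + ∇ (fun _ : ℂ => (0:ℝ)) x) = XA A := by ext x; simp
    rw [h2] at h1
    have h3 := nr_sub_le (hgX.add (h.memG (hmem (ns n)))) hgX
    have h4 : (fun x => (XA A + ∇ (φ0 (ns n))) x - XA A x) = ∇ (φ0 (ns n)) := by ext x; simp
    rw [h4] at h3
    have h5 : nr (XA A + ∇ (φ0 (ns n))) ≤ nr (XA A) + E := h1.trans (by gcongr; exact hE _)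
    linarith
  have hsplit : ∀ n, ∀ χ ∈ W, ∫ x, inner ℝ (XA A x + ∇ (φ n) x) (∇ χ x) =
      (∫ x, inner ℝ (∇ (φ n) x) (∇ χ x)) - 2 * ∫ x, χ x := by
    intro n χ hχ
    simp only [inner_add_left]
    rw [integral_add (ip_int hgX (h.memG hχ)) (ip_int (h.memG (hmem _)) (h.memG hχ)), h.ipX hχ]
    ring
  have htest' : ∀ n, ∀ χ ∈ W, |∫ x, inner ℝ (XA A x + ∇ (φ n) x) (∇ χ x)| ≤ ε n * nr (∇ χ) :=
    fun n χ hχ => htest (ns n) χ hχ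
  have hXX : ∫ x, inner ℝ (XA A x) (XA A x) = ∫ x in A, ‖x‖ ^ 2 := by
    rw [← integral_indicator h.mA]
    congr 1; ext x
    by_cases hx : x ∈ A
    · simp only [XA, indicator_of_mem hx, real_inner_self_eq_norm_sq]
    · simp [XA, indicator_of_notMem hx]
  have hV1 : Tendsto (fun n => ∫ x, inner ℝ (XA A x + ∇ (φ n) x) (XA A x)) atTop
      (𝓝 ((∫ x in A, ‖x‖ ^ 2) - 2 * ∫ x, p x)) := by
    have : ∀ n, ∫ x, inner ℝ (XA A x + ∇ (φ n) x) (XA A x) = (∫ x in A, ‖x‖ ^ 2) - 2 * ∫ x, φ n x := by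
      intro n
      simp only [inner_add_left]
      rw [integral_add (ip_int hgX hgX) (ip_int (h.memG (hmem _)) hgX), hXX]
      have := h.ipX (hmem (ns n))
      simp only [real_inner_comm] at this ⊢
      rw [this]; ring
    simp only [this]
    exact tendsto_const_nhds.sub (hic.const_mul 2)
  have hV2 : Tendsto (fun n => nr (fun x => XA A x + ∇ (φ n) x) ^ 2) atTop
      (𝓝 ((∫ x in A, ‖x‖ ^ 2) - 2 * ∫ x, p x)) := by
    have e : ∀ n, nr (fun x => XA A x + ∇ (φ n) x) ^ 2 = (∫ x, inner ℝ (XA A x + ∇ (φ n) x) (XA A x)) +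
        ∫ x, inner ℝ (XA A x + ∇ (φ n) x) (∇ (φ n) x) := by
      intro n
      have hm : MemLp (fun x => XA A x + ∇ (φ n) x) 2 := hgX.add (h.memG (hmem _))
      rw [← integral_add (ip_int hm hgX) (ip_int hm (h.memG (hmem _))), nr_sq]
      congr 1; ext x
      rw [← inner_add_right, real_inner_self_eq_norm_sq]
    simp only [e]
    have h0 : Tendsto (fun n => ∫ x, inner ℝ (XA A x + ∇ (φ n) x) (∇ (φ n) x)) atTop (𝓝 0) := by
      rw [tendsto_zero_iff_abs_tendsto_zero]
      refine squeeze_zero (fun _ => abs_nonneg _) (fun n => (htest' n _ (hmem _)).trans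
        (mul_le_mul_of_nonneg_left (hbdd n) (hεn _))) ?_
      simpa using hε'.mul_const (2 * nr (XA A) + E)
    simpa using hV1.add h0
  refine ⟨φ, ε, p, _, 2 * nr (XA A) + E, ⟨h, fun n => hmem _, hε', fun n => hεn _, htest', ?_, hbdd, hpi, hpm,
    ?_, hl1', ?_, rfl, hV1, ?_, ?_⟩⟩
  · intro n χ hχ
    rw [← hsplit n χ hχ]; exact htest' n χ hχ
  · intro x hx
    rw [hp, indicator_of_notMem]
    rw [mem_closedBall_zero_iff]; linarith
  · filter_upwards [hae, hpe] with x h1 h2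
    rw [← h2]; exact h1
  · exact ge_of_tendsto' hV2 fun n => sq_nonneg _
  · intro χ hχ
    have h1 : Tendsto (fun n => (nr (fun x => XA A x + ∇ χ x) + ε n) ^ 2) atTop
        (𝓝 ((nr (fun x => XA A x + ∇ χ x) + 0) ^ 2)) := (tendsto_const_nhds.add hε').pow 2
    rw [add_zero] at h1
    refine le_of_tendsto_of_tendsto' hV2 h1 fun n => ?_
    have := hmin (ns n) χ hχ
    have := nr_nonneg (fun x => XA A x + ∇ (φ n) x)
    gcongr

end RP

namespace RP
open scoped Topology Gradient

structure Ramp (T : ℝ → ℝ) (t h h' : ℝ) : Prop where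
  c1 : ContDiff ℝ 1 T
  lo : ∀ s ≤ t, T s = 0
  hi : ∀ s, t + h ≤ s → T s = 1
  nn : ∀ s, 0 ≤ T s
  le1 : ∀ s, T s ≤ 1
  dnn : ∀ s, 0 ≤ deriv T s
  dle : ∀ s, deriv T s ≤ 1 / h'
  dz : ∀ s, s ∉ Ioo t (t + h) → deriv T s = 0

lemma exists_ramp (t h h' : ℝ) (h0 : 0 < h') (h1 : h' < h) : ∃ T, Ramp T t h h' := by
  set δ := (h - h') / 2 with hδ
  have hδ0 : 0 < δ := by rw [hδ]; linarith
  set k : ℝ → ℝ := fun u => max 0 (min 1 (min (u - t) (t + h - u) / δ)) with hk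
  have kc : Continuous k := by
    rw [hk]; fun_prop
  have k0 : ∀ u, 0 ≤ k u := fun u => le_max_left _ _
  have k1 : ∀ u, k u ≤ 1 := fun u => max_le zero_le_one (min_le_left _ _)
  have kz : ∀ u, u ∉ Ioo t (t + h) → k u = 0 := by
    intro u hu
    simp only [hk]
    refine max_eq_left ((min_le_right _ _).trans (div_nonpos_of_nonpos_of_nonneg ?_ hδ0.le))
    by_contra hc
    push Not at hc
    rw [lt_min_iff] at hc
    exact hu ⟨by linarith, by linarith⟩
  have kI : ∀ a b, IntervalIntegrable k volume a b := fun a b => kc.intervalIntegrable a b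
  set I := ∫ u in t..(t + h), k u with hI
  have hIh : h' ≤ I := by
    have e1 : ∫ u in (t + δ)..(t + h - δ), k u = h' := by
      have : ∀ u ∈ uIcc (t + δ) (t + h - δ), k u = 1 := by
        intro u hu
        rw [uIcc_of_le (by rw [hδ]; linarith)] at hu
        simp only [hk]
        rw [min_eq_left, max_eq_right zero_le_one]
        rw [le_div_iff₀ hδ0, one_mul]
        exact le_min (by linarith [hu.1]) (by linarith [hu.2])
      rw [intervalIntegral.integral_congr this]
      simp; rw [hδ]; ring
    rw [← e1, hI]
    refine intervalIntegral.integral_mono_interval (by linarith) (by rw [hδ]; linarith) (by linarith)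
      (ae_of_all _ k0) (kI _ _)
  have hI0 : 0 < I := h0.trans_le hIh
  set T : ℝ → ℝ := fun s => (∫ u in t..s, k u) / I with hT
  have hd : ∀ s, HasDerivAt T (k s / I) s := fun s =>
    (intervalIntegral.integral_hasDerivAt_right (kI _ _) (kc.stronglyMeasurableAtFilter _ _) kc.continuousAt).div_const I
  have hdd : deriv T = fun s => k s / I := funext fun s => (hd s).deriv
  have mono : Monotone T := monotone_of_deriv_nonneg (fun s => (hd s).differentiableAt) (fun s => by
    rw [hdd]; have := k0 s; positivity)
  have lo : ∀ s ≤ t, T s = 0 := by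
    intro s hs
    simp only [hT]
    have : ∫ u in t..s, k u = ∫ u in t..s, (0:ℝ) := by
      refine intervalIntegral.integral_congr fun u hu => kz u ?_
      rw [uIcc_of_ge hs] at hu
      exact fun h => absurd h.1 (not_lt.mpr hu.2)
    rw [this]; simp
  have hi : ∀ s, t + h ≤ s → T s = 1 := by
    intro s hs
    simp only [hT]
    have e : ∫ u in (t+h)..s, k u = ∫ u in (t+h)..s, (0:ℝ) := by
      refine intervalIntegral.integral_congr fun u hu => kz u ?_
      rw [uIcc_of_le hs] at hu
      exact fun h => absurd h.2 (not_lt.mpr hu.1)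
    rw [← intervalIntegral.integral_add_adjacent_intervals (kI t (t+h)) (kI (t+h) s), e, ← hI]
    simp [hI0.ne']
  refine ⟨T, ⟨?_, lo, hi, ?_, ?_, ?_, ?_, ?_⟩⟩
  · rw [contDiff_one_iff_deriv]
    exact ⟨fun s => (hd s).differentiableAt, by rw [hdd]; exact kc.div_const _⟩
  · intro s
    rw [← lo (min s t) (min_le_right _ _)]; exact mono (min_le_left _ _)
  · intro s
    rw [← hi (max s (t + h)) (le_max_right _ _)]; exact mono (le_max_left _ _)
  · intro s; rw [hdd]; have := k0 s; positivity
  · intro s; rw [hdd]; exact div_le_div₀ zero_le_one (k1 s) h0 hIh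
  · intro s hs; rw [hdd]; simp [kz s hs]

variable {W : Set (ℂ → ℝ)} {A : Set ℂ} {R : ℝ} {φ : ℕ → ℂ → ℝ} {ε : ℕ → ℝ} {p : ℂ → ℝ} {V C : ℝ}

def mA (A : Set ℂ) (p : ℂ → ℝ) (t : ℝ) : ℝ := volume.real (A ∩ {x | t < p x})
def mu (p : ℂ → ℝ) (t : ℝ) : ℝ := volume.real {x | t < p x}

lemma Sol.meas (h : Sol W A R φ ε p V C) (t : ℝ) : MeasurableSet {x | t < p x} :=
  measurableSet_lt measurable_const h.pmeas

lemma Sol.subb (h : Sol W A R φ ε p V C) {t : ℝ} (ht : 0 ≤ t) : {x | t < p x} ⊆ closedBall 0 R := by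
  intro x hx
  rw [mem_closedBall_zero_iff]
  by_contra hc
  rw [mem_setOf_eq, h.psupp x (not_le.mp hc)] at hx
  linarith

lemma Sol.fin (h : Sol W A R φ ε p V C) {t : ℝ} (ht : 0 ≤ t) : volume {x | t < p x} ≠ ⊤ :=
  ((measure_mono (h.subb ht)).trans_lt measure_closedBall_lt_top).ne

lemma Sol.finA (h : Sol W A R φ ε p V C) : volume A ≠ ⊤ :=
  ((measure_mono h.sub).trans_lt measure_closedBall_lt_top).ne

lemma Sol.ramp_int (h : Sol W A R φ ε p V C) {T : ℝ → ℝ} {t k k' : ℝ} (hT : Ramp T t k k') (ht : 0 ≤ t) :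
    Integrable (fun x => T (p x)) := by
  have i0 : Integrable ((closedBall (0:ℂ) R).indicator (1 : ℂ → ℝ)) :=
    ind_integrable measurableSet_closedBall measure_closedBall_lt_top.ne
  refine i0.mono (hT.c1.continuous.measurable.comp h.pmeas).aestronglyMeasurable ?_
  filter_upwards with x
  by_cases hx : x ∈ closedBall (0:ℂ) R
  · rw [indicator_of_mem hx]
    simp [abs_of_nonneg (hT.nn _), hT.le1]
  · rw [mem_closedBall_zero_iff, not_le] at hx
    rw [h.psupp x hx, hT.lo 0 ht]; simp

lemma Sol.ramp_int_le (h : Sol W A R φ ε p V C) {T : ℝ → ℝ} {t k k' : ℝ} (hT : Ramp T t k k') (ht : 0 ≤ t) :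
    ∫ x, T (p x) ≤ mu p t := by
  rw [mu, ← ind_integral (h.meas t)]
  refine integral_mono (h.ramp_int hT ht) (ind_integrable (h.meas t) (h.fin ht)) fun x => ?_
  by_cases hx : x ∈ {x | t < p x}
  · simp only [indicator_of_mem hx]; exact hT.le1 _
  · simp only [indicator_of_notMem hx]; rw [hT.lo]; exact not_lt.mp hx

lemma Sol.ramp_sq_ge (h : Sol W A R φ ε p V C) {T : ℝ → ℝ} {t k k' : ℝ} (hT : Ramp T t k k') (ht : 0 ≤ t)
    (hk : 0 ≤ k) :
    mu p (t + k) ≤ ∫ x, T (p x) * T (p x) := by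
  rw [mu, ← ind_integral (h.meas (t + k))]
  have hi := h.ramp_int hT ht
  have i2 : Integrable fun x => T (p x) * T (p x) := by
    refine hi.mono (hi.aestronglyMeasurable.mul hi.aestronglyMeasurable) ?_
    filter_upwards with x
    rw [norm_mul]
    have : ‖T (p x)‖ ≤ 1 := by rw [Real.norm_of_nonneg (hT.nn _)]; exact hT.le1 _
    exact mul_le_of_le_one_left (norm_nonneg _) this
  refine integral_mono (ind_integrable (h.meas _) (h.fin (by linarith))) i2 fun x => ?_
  by_cases hx : x ∈ {x | t + k < p x}
  · simp only [indicator_of_mem hx, hT.hi _ (le_of_lt hx)]; simp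
  · simp only [indicator_of_notMem hx]; exact mul_nonneg (hT.nn _) (hT.nn _)

/-- Dominated convergence for continuous bounded functions of `φ n`. -/
lemma Sol.dct (h : Sol W A R φ ε p V C) {S : ℝ → ℝ} (hS : Continuous S) (hS0 : S 0 = 0) {B : ℝ} (hB : ∀ s, |S s| ≤ B)
    {g : ℂ → ℝ} (hg : Measurable g) (hg1 : ∀ x, |g x| ≤ 1) :
    Tendsto (fun n => ∫ x, S (φ n x) * g x) atTop (𝓝 (∫ x, S (p x) * g x)) := by
  have i0 : Integrable ((closedBall (0:ℂ) R).indicator (1 : ℂ → ℝ)) :=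
    ind_integrable measurableSet_closedBall measure_closedBall_lt_top.ne
  refine tendsto_integral_of_dominated_convergence (fun x => B * (closedBall (0:ℂ) R).indicator (1 : ℂ → ℝ) x)
    (fun n => ?_) (i0.const_mul B) (fun n => ae_of_all _ fun x => ?_) ?_
  · exact ((hS.comp (h.c1 _ (h.mem n)).continuous).measurable.mul hg).aestronglyMeasurable
  · by_cases hx : x ∈ closedBall (0:ℂ) R
    · rw [indicator_of_mem hx, norm_mul]
      simp only [Real.norm_eq_abs, Pi.one_apply]
      exact mul_le_mul (hB _) (hg1 _) (abs_nonneg _) ((abs_nonneg _).trans (hB 0))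
    · rw [indicator_of_notMem hx]
      rw [mem_closedBall_zero_iff, not_le] at hx
      simp [h.supp _ (h.mem n) x hx, hS0]
  · filter_upwards [h.aeconv] with x hx
    exact ((hS.tendsto _).comp hx).mul_const _

theorem Sol.main (h : Sol W A R φ ε p V C) {T : ℝ → ℝ} {t k k' : ℝ} (hT : Ramp T t k k') (ht : 0 ≤ t)
    (hk : 0 < k) (hk' : 0 < k') {s : ℝ} (hs : ∀ y, ‖G (fun x => T (p x)) y‖ ≤ s) :
    (2 * Real.pi * ∫ x, T (p x) * T (p x)) ^ 2 ≤
      s ^ 2 * (((mA A p t - mA A p (t + k)) / k') * (2 * ∫ x, T (p x))) := by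
  have hpi := Real.pi_pos
  have hs0 : 0 ≤ s := (norm_nonneg _).trans (hs 0)
  have hC : 0 ≤ C := (nr_nonneg _).trans (h.bdd 0)
  have T0 : T 0 = 0 := hT.lo 0 ht
  have D0 : deriv T 0 = 0 := hT.dz 0 (fun hh => absurd hh.1 (not_lt.mpr ht))
  have Dc : Continuous (deriv T) := hT.c1.continuous_deriv le_rfl
  have hτ := h.ramp_int hT ht
  have hτb : ∀ x, |T (p x)| ≤ 1 := fun x => by rw [abs_of_nonneg (hT.nn _)]; exact hT.le1 _
  have hτm : Measurable fun x => T (p x) := hT.c1.continuous.measurable.comp h.pmeas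
  have hAm : Measurable (A.indicator (1 : ℂ → ℝ)) := measurable_one.indicator h.mA
  -- the inequality for each n
  have key : ∀ n, (2 * Real.pi * ∫ x, T (φ n x) * T (p x)) ^ 2 ≤
      s ^ 2 * ((∫ x, deriv T (φ n x) * A.indicator 1 x) * (2 * (∫ x, T (φ n x) * 1) + ε n * (1 / k' * C))) := by
    intro n
    have hφ := h.c1 _ (h.mem n)
    have hφc := hφ.continuous
    have hm := h.comp T hT.c1 T0 _ (h.mem n)
    have hg : ∀ x, ∇ (fun x => T (φ n x)) x = deriv T (φ n x) • ∇ (φ n) x := grad_comp hφ hT.c1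
    have hgc := continuous_grad hφ
    have hg0 := grad_zero_out (h.supp _ (h.mem n))
    have h1 := weak_poisson (h.c1 _ hm) (h.cpt hm) hτ hτb
    have cI : ∀ {F : ℂ → ℝ}, Continuous F → (∀ x, R < ‖x‖ → F x = 0) → Integrable F := fun hF hF0 =>
      hF.integrable_of_hasCompactSupport (compactSupp_of hF0)
    -- step 1
    have h2 : 2 * Real.pi * ∫ x, T (φ n x) * T (p x) ≤ s * ∫ x, deriv T (φ n x) * ‖∇ (φ n) x‖ := by
      rw [← h1, ← integral_const_mul]
      refine (le_abs_self _).trans (abs_integral_le_integral_abs.trans ?_)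
      refine integral_mono_of_nonneg (ae_of_all _ fun x => abs_nonneg _) ?_ (ae_of_all _ fun x => ?_)
      · refine (cI ((Dc.comp hφc).mul hgc.norm) fun x hx => ?_).const_mul s
        simp [hg0 x hx]
      · refine (abs_real_inner_le_norm _ _).trans ?_
        rw [hg, norm_smul, Real.norm_of_nonneg (hT.dnn _), mul_comm]
        exact mul_le_mul_of_nonneg_right (hs x) (mul_nonneg (hT.dnn _) (norm_nonneg _))
    -- step 2 : Cauchy-Schwarz
    have h3 : (∫ x, deriv T (φ n x) * ‖∇ (φ n) x‖) ^ 2 ≤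
        (∫ x, deriv T (φ n x) * A.indicator 1 x) * ∫ x, deriv T (φ n x) * ‖∇ (φ n) x‖ ^ 2 := by
      have e1 : ∀ x, (Real.sqrt (deriv T (φ n x)) * A.indicator 1 x) ^ 2 = deriv T (φ n x) * A.indicator 1 x := by
        intro x
        rw [mul_pow, Real.sq_sqrt (hT.dnn _)]
        by_cases hx : x ∈ A <;> simp [indicator, hx]
      have e2 : ∀ x, (Real.sqrt (deriv T (φ n x)) * ‖∇ (φ n) x‖) ^ 2 = deriv T (φ n x) * ‖∇ (φ n) x‖ ^ 2 := by
        intro x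
        rw [mul_pow, Real.sq_sqrt (hT.dnn _)]
      have e3 : ∀ x, (Real.sqrt (deriv T (φ n x)) * A.indicator 1 x) * (Real.sqrt (deriv T (φ n x)) * ‖∇ (φ n) x‖)
          = deriv T (φ n x) * ‖∇ (φ n) x‖ := by
        intro x
        by_cases hx : x ∈ A
        · simp only [indicator_of_mem hx, Pi.one_apply, mul_one]
          rw [← mul_assoc, Real.mul_self_sqrt (hT.dnn _)]
        · simp [h.grad _ (h.mem n) x hx]
      have := cs (f := fun x => Real.sqrt (deriv T (φ n x)) * A.indicator 1 x)
        (g := fun x => Real.sqrt (deriv T (φ n x)) * ‖∇ (φ n) x‖) ?_ ?_ ?_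
      · simpa only [e1, e2, e3] using this
      · simp only [e1]
        refine (cI (F := fun x => deriv T (φ n x)) (Dc.comp hφc) fun x hx => ?_).mono
          (((Dc.comp hφc).measurable.mul hAm).aestronglyMeasurable) (ae_of_all _ fun x => ?_)
        · simp [h.supp _ (h.mem n) x hx, D0]
        · rw [norm_mul]
          refine mul_le_of_le_one_right (norm_nonneg _) ?_
          exact ind_abs_le A x
      · simp only [e2]
        refine cI ((Dc.comp hφc).mul (hgc.norm.pow 2)) fun x hx => by simp [hg0 x hx]
      · simp only [e3]
        refine cI ((Dc.comp hφc).mul hgc.norm) fun x hx => by simp [hg0 x hx]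
    have h4 : ∫ x, deriv T (φ n x) * ‖∇ (φ n) x‖ ^ 2 ≤ 2 * (∫ x, T (φ n x) * 1) + ε n * (1 / k' * C) := by
      have := (abs_le.mp (h.test' n _ hm)).2
      have e : ∀ x, inner ℝ (∇ (φ n) x) (∇ (fun x => T (φ n x)) x) = deriv T (φ n x) * ‖∇ (φ n) x‖ ^ 2 := by
        intro x; rw [hg, real_inner_smul_right, real_inner_self_eq_norm_sq]
      simp only [e] at this
      have hnr : nr (∇ (fun x => T (φ n x))) ≤ 1 / k' * C := by
        refine le_trans ?_ (mul_le_mul_of_nonneg_left (h.bdd n) (by positivity))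
        refine abs_le_of_sq_le_sq' ?_ (by have := nr_nonneg (∇ (φ n)); positivity) |>.2
        rw [mul_pow, nr_sq, nr_sq, ← integral_const_mul]
        refine integral_mono ?_ ?_ fun x => ?_
        · refine cI ((continuous_grad (h.c1 _ hm)).norm.pow 2) fun x hx => ?_
          simp [hg, hg0 x hx]
        · refine (cI (hgc.norm.pow 2) fun x hx => by simp [hg0 x hx]).const_mul _
        · simp only [hg, norm_smul, mul_pow]
          gcongr
          rw [Real.norm_of_nonneg (hT.dnn _)]; exact hT.dle _
      have := mul_le_mul_of_nonneg_left hnr (h.εnn n)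
      simp only [mul_one]
      linarith
    have hTT : 0 ≤ ∫ x, T (φ n x) * T (p x) := integral_nonneg fun x => mul_nonneg (hT.nn _) (hT.nn _)
    have hDA : 0 ≤ ∫ x, deriv T (φ n x) * A.indicator 1 x :=
      integral_nonneg fun x => mul_nonneg (hT.dnn _) (ind_nonneg A x)
    calc _ ≤ (s * ∫ x, deriv T (φ n x) * ‖∇ (φ n) x‖) ^ 2 := by gcongr
      _ = s ^ 2 * (∫ x, deriv T (φ n x) * ‖∇ (φ n) x‖) ^ 2 := by ring
      _ ≤ s ^ 2 * ((∫ x, deriv T (φ n x) * A.indicator 1 x) * ∫ x, deriv T (φ n x) * ‖∇ (φ n) x‖ ^ 2) := by gcongr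
      _ ≤ _ := by gcongr
  have l1 := h.dct hT.c1.continuous T0 (B := 1) (fun s => by rw [abs_of_nonneg (hT.nn _)]; exact hT.le1 _) hτm hτb
  have l2 := h.dct hT.c1.continuous T0 (B := 1) (fun s => by rw [abs_of_nonneg (hT.nn _)]; exact hT.le1 _)
    (g := fun _ => 1) measurable_const (by simp)
  have l3 := h.dct Dc D0 (B := 1 / k') (fun s => by rw [abs_of_nonneg (hT.dnn _)]; exact hT.dle _) hAm (ind_abs_le A)
  have lim := le_of_tendsto_of_tendsto' ((l1.const_mul (2 * Real.pi)).pow 2)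
    (((l3.mul ((l2.const_mul 2).add (h.ε0.mul_const (1 / k' * C)))).const_mul (s ^ 2))) key
  simp only [zero_mul, add_zero, mul_one] at lim
  refine lim.trans ?_
  have hle : ∫ x, deriv T (p x) * A.indicator 1 x ≤ (mA A p t - mA A p (t + k)) / k' := by
    have hm1 : MeasurableSet (A ∩ {x | t < p x}) := h.mA.inter (h.meas t)
    have hm2 : MeasurableSet (A ∩ {x | t + k < p x}) := h.mA.inter (h.meas (t + k))
    have f1 : volume (A ∩ {x | t < p x}) ≠ ⊤ := measure_ne_top_of_subset inter_subset_left h.finA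
    have f2 : volume (A ∩ {x | t + k < p x}) ≠ ⊤ := measure_ne_top_of_subset inter_subset_left h.finA
    have j1 := ind_integrable hm1 f1
    have j2 := ind_integrable hm2 f2
    have : (mA A p t - mA A p (t + k)) / k' = ∫ x, ((A ∩ {x | t < p x}).indicator (1 : ℂ → ℝ) x -
        (A ∩ {x | t + k < p x}).indicator (1 : ℂ → ℝ) x) / k' := by
      rw [integral_div, integral_sub j1 j2, ind_integral hm1, ind_integral hm2]; rfl
    rw [this]
    have j3 : Integrable fun x => ((A ∩ {x | t < p x}).indicator (1 : ℂ → ℝ) x -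
        (A ∩ {x | t + k < p x}).indicator (1 : ℂ → ℝ) x) / k' := (j1.sub j2).div_const k'
    refine integral_mono_of_nonneg (ae_of_all _ fun x => mul_nonneg (hT.dnn _) (ind_nonneg A x)) j3
      (ae_of_all _ fun x => ?_)
    by_cases hx : x ∈ A
    · by_cases ha : t < p x
      · by_cases hb : t + k < p x
        · simp only [indicator, hx, ha, hb, mem_inter_iff, mem_setOf_eq, and_self, if_true]
          rw [hT.dz _ (fun hh => absurd hh.2 (not_lt.mpr hb.le))]; simp
        · simp only [indicator, hx, ha, hb, mem_inter_iff, mem_setOf_eq, and_self, if_true, and_false, if_false]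
          have := hT.dle (p x)
          simpa using this
      · have hb : ¬ t + k < p x := fun hb => ha (by linarith)
        simp only [indicator, hx, ha, hb, mem_inter_iff, mem_setOf_eq, and_false, if_false]
        rw [hT.dz _ (fun hh => ha hh.1)]; simp
    · simp [indicator, hx]
  have hTT : 0 ≤ ∫ x, T (p x) := integral_nonneg fun x => hT.nn _
  gcongr

end RP

namespace RP
open scoped Topology Gradient

variable {W : Set (ℂ → ℝ)} {A : Set ℂ} {R : ℝ} {φ : ℕ → ℂ → ℝ} {ε : ℕ → ℝ} {p : ℂ → ℝ} {V C : ℝ}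

lemma mA_nonneg (t : ℝ) : 0 ≤ mA A p t := measureReal_nonneg
lemma mu_nonneg (t : ℝ) : 0 ≤ mu p t := measureReal_nonneg

lemma Sol.mA_anti (h : Sol W A R φ ε p V C) : Antitone (mA A p) := fun t t' htt' =>
  measureReal_mono (inter_subset_inter_right _ fun x (hx : t' < p x) => lt_of_le_of_lt htt' hx)
    (measure_ne_top_of_subset inter_subset_left h.finA)

lemma Sol.mA_le (h : Sol W A R φ ε p V C) (t : ℝ) : mA A p t ≤ volume.real A :=
  measureReal_mono inter_subset_left h.finA

lemma Sol.mu_anti (h : Sol W A R φ ε p V C) {t t' : ℝ} (ht : 0 ≤ t) (htt' : t ≤ t') : mu p t' ≤ mu p t :=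
  measureReal_mono (fun x (hx : t' < p x) => lt_of_le_of_lt htt' hx) (h.fin ht)

lemma Sol.mA_le_mu (h : Sol W A R φ ε p V C) {t : ℝ} (ht : 0 ≤ t) : mA A p t ≤ mu p t :=
  measureReal_mono inter_subset_right (h.fin ht)

lemma Sol.step (h : Sol W A R φ ε p V C) {t k : ℝ} (ht : 0 ≤ t) (hk : 0 < k) :
    2 * Real.pi * k * mu p (t + k) ^ 2 ≤ mu p t ^ 2 * (mA A p t - mA A p (t + k)) := by
  have hpi := Real.pi_pos
  have key : ∀ k', 0 < k' → k' < k →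
      2 * Real.pi * k' * mu p (t + k) ^ 2 ≤ mu p t ^ 2 * (mA A p t - mA A p (t + k)) := by
    intro k' h0 h1
    obtain ⟨T, hT⟩ := exists_ramp t k k' h0 h1
    have hi := h.ramp_int hT ht
    have hI : 0 ≤ ∫ x, T (p x) := integral_nonneg fun x => hT.nn _
    have m := h.main hT ht hk h0 (s := Real.sqrt (Real.pi * ∫ x, T (p x)))
      (fun y => bathtub hi (fun x => hT.nn _) (fun x => hT.le1 _) y)
    rw [Real.sq_sqrt (by positivity)] at m
    have a1 := h.ramp_sq_ge hT ht hk.le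
    have a2 := h.ramp_int_le hT ht
    have a3 := mu_nonneg (p := p) (t + k)
    have a4 : 0 ≤ mA A p t - mA A p (t + k) := sub_nonneg.mpr (h.mA_anti (by linarith))
    set I := ∫ x, T (p x)
    set J := ∫ x, T (p x) * T (p x)
    set Δ := mA A p t - mA A p (t + k)
    have e : Real.pi * I * (Δ / k' * (2 * I)) = 2 * Real.pi * (I ^ 2 * Δ) / k' := by field_simp
    rw [e, le_div_iff₀ h0] at m
    have m2 : 2 * Real.pi * k' * J ^ 2 ≤ I ^ 2 * Δ := by
      have : 2 * Real.pi * (2 * Real.pi * k' * J ^ 2) ≤ 2 * Real.pi * (I ^ 2 * Δ) := by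
        calc _ = (2 * Real.pi * J) ^ 2 * k' := by ring
          _ ≤ _ := m
      exact le_of_mul_le_mul_left this (by positivity)
    calc _ ≤ 2 * Real.pi * k' * J ^ 2 := by gcongr
      _ ≤ I ^ 2 * Δ := m2
      _ ≤ _ := by gcongr
  have l : Tendsto (fun k' => 2 * Real.pi * k' * mu p (t + k) ^ 2) (𝓝[<] k)
      (𝓝 (2 * Real.pi * k * mu p (t + k) ^ 2)) :=
    (Continuous.tendsto (by fun_prop) k).mono_left nhdsWithin_le_nhds
  refine le_of_tendsto l ?_
  filter_upwards [Ioo_mem_nhdsLT hk] with k' hk'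
  exact key k' hk'.1 hk'.2

lemma Sol.decr (h : Sol W A R φ ε p V C) {t t' : ℝ} (ht : 0 ≤ t) (htt' : t ≤ t') (hmu : 0 < mu p t') :
    2 * Real.pi * (t' - t) ≤ mA A p t - mA A p t' := by
  have hpi := Real.pi_pos
  rcases htt'.eq_or_lt with rfl | hlt
  · simp
  have ind : ∀ (k : ℝ), 0 < k → ∀ j : ℕ, t + j * k ≤ t' →
      2 * Real.pi * (j * k) + 4 * Real.pi * k * Real.log (mu p (t + j * k) / mu p t) ≤
        mA A p t - mA A p (t + j * k) := by
    intro k hk j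
    induction j with
    | zero =>
      intro _
      have : mu p t ≠ 0 := (hmu.trans_le (h.mu_anti ht htt')).ne'
      simp [this]
    | succ j ih =>
      intro hj
      push_cast at hj ⊢
      have hj' : t + j * k ≤ t' := by nlinarith
      have ih := ih hj'
      have hjk : 0 ≤ t + j * k := by positivity
      have st := h.step hjk hk
      have e : t + (j + 1) * k = t + j * k + k := by ring
      rw [e] at hj ⊢
      have p1 : 0 < mu p (t + j * k + k) := hmu.trans_le (h.mu_anti (by linarith) hj)
      have p2 : 0 < mu p (t + j * k) := hmu.trans_le (h.mu_anti hjk hj')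
      have p3 : 0 < mu p t := hmu.trans_le (h.mu_anti ht htt')
      set a := mu p (t + j * k + k)
      set b := mu p (t + j * k)
      have s1 : 2 * Real.pi * k * (a / b) ^ 2 ≤ mA A p (t + j * k) - mA A p (t + j * k + k) := by
        rw [div_pow, ← mul_div_assoc, div_le_iff₀ (by positivity)]
        linarith
      have s2 : 1 + 2 * Real.log (a / b) ≤ (a / b) ^ 2 := by
        have := Real.log_le_sub_one_of_pos (x := (a / b) ^ 2) (by positivity)
        rw [Real.log_pow] at this
        push_cast at this
        linarith
      have s3 : Real.log (a / mu p t) = Real.log (a / b) + Real.log (b / mu p t) := by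
        rw [← Real.log_mul (by positivity) (by positivity)]
        congr 1
        field_simp
      rw [s3]
      have s4 : 2 * Real.pi * k * (1 + 2 * Real.log (a / b)) ≤ 2 * Real.pi * k * (a / b) ^ 2 := by gcongr
      nlinarith
  have key : ∀ n : ℕ, 2 * Real.pi * (t' - t) + 4 * Real.pi * ((t' - t) * en n) * Real.log (mu p t' / mu p t) ≤
        mA A p t - mA A p t' := by
    intro n
    have := ind ((t' - t) * en n) (mul_pos (by linarith) (en_pos n)) (n + 1)
    have e : ((n + 1 : ℕ) : ℝ) * ((t' - t) * en n) = t' - t := by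
      rw [en]; push_cast; field_simp
    rw [e] at this
    have e2 : t + (t' - t) = t' := by ring
    rw [e2] at this
    exact this le_rfl
  have l : Tendsto (fun n => 2 * Real.pi * (t' - t) + 4 * Real.pi * ((t' - t) * en n) *
      Real.log (mu p t' / mu p t)) atTop (𝓝 (2 * Real.pi * (t' - t) + 4 * Real.pi * ((t' - t) * 0) *
      Real.log (mu p t' / mu p t))) :=
    (((en_tendsto.const_mul _).const_mul _).mul_const _).const_add _
  simp only [mul_zero, zero_mul, add_zero] at l
  exact le_of_tendsto' l key

def NA (A : Set ℂ) (p : ℂ → ℝ) (t : ℝ) : ℝ := volume.real A - 2 * Real.pi * t - mA A p t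

lemma Sol.NA_mono (h : Sol W A R φ ε p V C) {t t' : ℝ} (ht : 0 ≤ t) (htt' : t ≤ t') (hmu : 0 < mu p t') :
    NA A p t ≤ NA A p t' := by
  have := h.decr ht htt' hmu
  unfold NA; linarith

lemma Sol.NA_nonneg (h : Sol W A R φ ε p V C) {t : ℝ} (ht : 0 ≤ t) (hmu : 0 < mu p t) : 0 ≤ NA A p t := by
  have h1 := h.NA_mono le_rfl ht hmu
  have h2 := h.mA_le 0
  have : 0 ≤ NA A p 0 := by unfold NA; linarith
  linarith

lemma Sol.t_le (h : Sol W A R φ ε p V C) {t : ℝ} (ht : 0 ≤ t) (hmu : 0 < mu p t) :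
    t ≤ volume.real A / (2 * Real.pi) := by
  have := h.NA_nonneg ht hmu
  have h2 := mA_nonneg (A := A) (p := p) t
  rw [le_div_iff₀ (by positivity)]
  unfold NA at this; linarith

lemma Sol.NA_nonneg' (h : Sol W A R φ ε p V C) {t : ℝ} (ht : 0 ≤ t) (ht' : t ≤ volume.real A / (2 * Real.pi)) :
    0 ≤ NA A p t := by
  rcases (mu_nonneg (p := p) t).eq_or_lt with h0 | h0
  · have := h.mA_le_mu ht
    rw [le_div_iff₀ (by positivity)] at ht'
    unfold NA; linarith
  · exact h.NA_nonneg ht h0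

/-- the deficit -/
def dA (A : Set ℂ) (p : ℂ → ℝ) : ℝ := volume.real A ^ 2 / (4 * Real.pi) - ∫ x in A, p x

lemma Sol.NA_ii (h : Sol W A R φ ε p V C) (a b : ℝ) : IntervalIntegrable (NA A p) volume a b := by
  have := h.mA_anti.intervalIntegrable (μ := volume) (a := a) (b := b)
  unfold NA
  exact (Continuous.intervalIntegrable (by fun_prop) a b).sub this

lemma Sol.int_le (h : Sol W A R φ ε p V C) :
    ∫ t in (0:ℝ)..(volume.real A / (2 * Real.pi)), NA A p t ≤ dA A p := by
  have hpi := Real.pi_pos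
  set ts := volume.real A / (2 * Real.pi) with hts
  have hts0 : 0 ≤ ts := by have : 0 ≤ volume.real A := measureReal_nonneg; positivity
  have i1 : IntervalIntegrable (mA A p) volume 0 ts := h.mA_anti.intervalIntegrable
  have pi : IntegrableOn p A := h.pint.integrableOn
  have e1 : ∫ x in A, p x ≤ ∫ t in (0:ℝ)..ts, mA A p t := by
    have f1 : ∫ x in A, p x ≤ ∫ x in A, max (p x) 0 :=
      integral_mono pi pi.pos_part fun x => le_max_left _ _
    refine f1.trans (le_of_eq ?_)
    rw [Integrable.integral_eq_integral_meas_lt pi.pos_part (ae_of_all _ fun x => le_max_right _ _)]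
    rw [intervalIntegral.integral_of_le hts0]
    have e : ∀ t ∈ Ioi (0:ℝ), (volume.restrict A).real {a | t < max (p a) 0} = mA A p t := by
      intro t ht
      have : {a | t < max (p a) 0} = {a | t < p a} := by
        ext a; simp only [mem_setOf_eq, lt_max_iff]
        exact ⟨fun hh => hh.resolve_right (not_lt.mpr (le_of_lt ht)), Or.inl⟩
      rw [this, measureReal_restrict_apply (h.meas t), inter_comm]; rfl
    rw [setIntegral_congr_fun measurableSet_Ioi e]
    rw [setIntegral_eq_of_subset_of_forall_sdiff_eq_zero measurableSet_Ioi (s := Ioc 0 ts) Ioc_subset_Ioi_self]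
    intro t ht
    have ht0 : 0 < t := ht.1
    have ht1 : ts < t := by
      by_contra hc; exact ht.2 ⟨ht0, not_lt.mp hc⟩
    have : mu p t = 0 := by
      by_contra hc
      have := h.t_le ht0.le (lt_of_le_of_ne (mu_nonneg t) (Ne.symm hc))
      linarith
    have h2 := h.mA_le_mu ht0.le
    have h3 := mA_nonneg (A := A) (p := p) t
    linarith
  have e2 : ∫ t in (0:ℝ)..ts, NA A p t = volume.real A ^ 2 / (4 * Real.pi) - ∫ t in (0:ℝ)..ts, mA A p t := by
    unfold NA
    rw [intervalIntegral.integral_sub (Continuous.intervalIntegrable (by fun_prop) _ _) i1]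
    rw [intervalIntegral.integral_sub (by simp) (Continuous.intervalIntegrable (by fun_prop) _ _)]
    have e3 : ∫ t in (0:ℝ)..ts, 2 * Real.pi * t = Real.pi * ts ^ 2 := by
      rw [intervalIntegral.integral_const_mul, integral_id]; ring
    rw [e3, intervalIntegral.integral_const, smul_eq_mul]
    congr 1
    rw [hts]; field_simp; ring
  rw [e2]; unfold dA; linarith

lemma Sol.d_ge (h : Sol W A R φ ε p V C) {a b c : ℝ} (ha : 0 ≤ a) (hab : a ≤ b)
    (hb : b ≤ volume.real A / (2 * Real.pi)) (hc : ∀ t, a ≤ t → t ≤ b → c ≤ NA A p t) :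
    c * (b - a) ≤ dA A p := by
  refine le_trans ?_ h.int_le
  set ts := volume.real A / (2 * Real.pi)
  have e1 : ∫ t in a..b, (c : ℝ) ≤ ∫ t in a..b, NA A p t :=
    intervalIntegral.integral_mono_on hab (by simp) (h.NA_ii a b) fun t ht => hc t ht.1 ht.2
  have e2 : ∫ t in a..b, NA A p t ≤ ∫ t in (0:ℝ)..ts, NA A p t := by
    refine intervalIntegral.integral_mono_interval ha hab hb ?_ (h.NA_ii _ _)
    rw [Filter.EventuallyLE, ae_restrict_iff' measurableSet_Ioc]
    exact ae_of_all _ fun t ht => h.NA_nonneg' ht.1.le ht.2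
  simp at e1
  linarith

lemma Sol.d_nonneg (h : Sol W A R φ ε p V C) : 0 ≤ dA A p := by
  have : 0 ≤ volume.real A := measureReal_nonneg
  have := h.d_ge (a := 0) (b := 0) (c := 0) le_rfl le_rfl (by positivity) (fun t h1 h2 => by
    rw [le_antisymm h2 h1]; exact h.NA_nonneg' le_rfl (by positivity))
  simpa using this

lemma Sol.NA_le (h : Sol W A R φ ε p V C) {t k : ℝ} (ht : 0 ≤ t) (hk : 0 < k) (hmu : 0 < mu p (t + k)) :
    NA A p t ≤ dA A p / k := by
  rw [le_div_iff₀ hk]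
  have := h.d_ge (a := t) (b := t + k) (c := NA A p t) ht (by linarith) (h.t_le (by linarith) hmu)
    (fun s h1 h2 => h.NA_mono ht h1 (hmu.trans_le (h.mu_anti (by linarith) h2)))
  simpa using this

lemma Sol.top (h : Sol W A R φ ε p V C) {S : ℝ} (hS : 0 ≤ S) (hmu : mu p S = 0)
    (hS' : S ≤ volume.real A / (2 * Real.pi)) :
    (volume.real A - 2 * Real.pi * S) ^ 2 ≤ 8 * Real.pi * dA A p := by
  have hpi := Real.pi_pos
  set ts := volume.real A / (2 * Real.pi) with hts
  have e : volume.real A = 2 * Real.pi * ts := by rw [hts]; field_simp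
  have := h.d_ge (a := S) (b := (S + ts) / 2) (c := (volume.real A - 2 * Real.pi * S) / 2) hS (by linarith)
    (by linarith) (fun s h1 h2 => by
      have h3 := h.mu_anti hS h1
      have h4 := h.mA_le_mu (hS.trans h1)
      unfold NA
      rw [e]
      nlinarith)
  rw [e] at this ⊢
  nlinarith

end RP

namespace RP
open scoped Topology Gradient

theorem near_disc {W : ℕ → Set (ℂ → ℝ)} {A : ℕ → Set ℂ} {R : ℕ → ℝ} {φ : ℕ → ℕ → ℂ → ℝ} {ε : ℕ → ℕ → ℝ}
    {p : ℕ → ℂ → ℝ} {V C : ℕ → ℝ}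
    (h : ∀ n, Sol (W n) (A n) (R n) (φ n) (ε n) (p n) (V n) (C n)) (t k δ : ℕ → ℝ)
    (ht : ∀ n, 0 ≤ t n) (hk : ∀ n, 0 < k n) (hδ : Tendsto δ atTop (𝓝 0))
    (hm : ∀ n, mA (A n) (p n) (t n) - mA (A n) (p n) (t n + k n) ≤ (2 * Real.pi + δ n) * k n)
    {a : ℝ} (ha : 0 < a) (h1 : Tendsto (fun n => mu (p n) (t n)) atTop (𝓝 (Real.pi * a ^ 2)))
    (h2 : Tendsto (fun n => mu (p n) (t n + k n)) atTop (𝓝 (Real.pi * a ^ 2))) :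
    ∃ c : ℕ → ℂ, Tendsto (fun n => ∫ x, |(ball (c n) a).indicator 1 x -
      {x | t n < p n x}.indicator (1 : ℂ → ℝ) x|) atTop (𝓝 0) := by
  have hpi := Real.pi_pos
  set k' : ℕ → ℝ := fun n => k n * (1 - en n / 2) with hk'
  have hen : ∀ n, 0 < 1 - en n / 2 := fun n => by have := en_le n; linarith
  have k0 : ∀ n, 0 < k' n := fun n => mul_pos (hk n) (hen n)
  have kl : ∀ n, k' n < k n := fun n => by
    have := en_pos n; have := hk n
    simp only [hk']; nlinarith
  choose T hT using fun n => exists_ramp (t n) (k n) (k' n) (k0 n) (kl n)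
  have hi : ∀ n, Integrable (fun x => T n (p n x)) := fun n => (h n).ramp_int (hT n) (ht n)
  have nn : ∀ n x, 0 ≤ T n (p n x) := fun n x => (hT n).nn _
  have l1 : ∀ n x, T n (p n x) ≤ 1 := fun n x => (hT n).le1 _
  have i2 : ∀ n, Integrable fun x => T n (p n x) * T n (p n x) := by
    intro n
    refine (hi n).mono ((hi n).aestronglyMeasurable.mul (hi n).aestronglyMeasurable) ?_
    filter_upwards with x
    rw [norm_mul]
    have : ‖T n (p n x)‖ ≤ 1 := by rw [Real.norm_of_nonneg (nn n x)]; exact l1 n x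
    exact mul_le_of_le_one_left (norm_nonneg _) this
  have J1 : ∀ n, mu (p n) (t n + k n) ≤ ∫ x, T n (p n x) * T n (p n x) := fun n =>
    (h n).ramp_sq_ge (hT n) (ht n) (hk n).le
  have J2 : ∀ n, ∫ x, T n (p n x) * T n (p n x) ≤ ∫ x, T n (p n x) := fun n =>
    integral_mono (i2 n) (hi n) fun x => mul_le_of_le_one_left (nn n x) (l1 n x)
  have J3 : ∀ n, ∫ x, T n (p n x) ≤ mu (p n) (t n) := fun n => (h n).ramp_int_le (hT n) (ht n)
  have lI : Tendsto (fun n => ∫ x, T n (p n x)) atTop (𝓝 (Real.pi * a ^ 2)) :=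
    tendsto_of_tendsto_of_tendsto_of_le_of_le h2 h1 (fun n => (J1 n).trans (J2 n)) J3
  have bdd : ∀ n, BddAbove (range fun y => ‖G (fun x => T n (p n x)) y‖) := by
    intro n
    refine ⟨Real.sqrt (Real.pi * ∫ x, T n (p n x)), ?_⟩
    rintro _ ⟨y, rfl⟩
    exact bathtub (hi n) (nn n) (l1 n) y
  set S : ℕ → ℝ := fun n => ⨆ y, ‖G (fun x => T n (p n x)) y‖ with hS
  have hSn : ∀ n, 0 ≤ S n := fun n => Real.iSup_nonneg fun y => norm_nonneg _
  have hy : ∀ n, ∃ y, S n - en n < ‖G (fun x => T n (p n x)) y‖ := fun n =>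
    exists_lt_of_lt_ciSup (by have := en_pos n; simp only [hS]; linarith)
  choose y hy using hy
  set q : ℕ → ℝ := fun n => (2 * Real.pi * mu (p n) (t n + k n)) ^ 2 with hq
  set r : ℕ → ℝ := fun n => (2 * Real.pi + δ n) / (1 - en n / 2) * (2 * mu (p n) (t n)) with hr
  have hqr : ∀ n, q n ≤ S n ^ 2 * r n := by
    intro n
    have m := (h n).main (hT n) (ht n) (hk n) (k0 n) (s := S n) (fun y => le_ciSup (bdd n) y)
    have e1 : (mA (A n) (p n) (t n) - mA (A n) (p n) (t n + k n)) / k' n ≤ (2 * Real.pi + δ n) / (1 - en n / 2) := by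
      rw [div_le_div_iff₀ (k0 n) (hen n)]
      simp only [hk']
      nlinarith [hm n, hen n]
    have e0 : 0 ≤ (mA (A n) (p n) (t n) - mA (A n) (p n) (t n + k n)) / k' n :=
      div_nonneg (sub_nonneg.mpr ((h n).mA_anti (by have := hk n; linarith))) (k0 n).le
    have e2 : 0 ≤ ∫ x, T n (p n x) := integral_nonneg fun x => nn n x
    have e3 := mu_nonneg (p := p n) (t n + k n)
    calc q n ≤ (2 * Real.pi * ∫ x, T n (p n x) * T n (p n x)) ^ 2 := by
          simp only [hq]; have := J1 n; gcongr
      _ ≤ _ := m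
      _ ≤ S n ^ 2 * r n := by
          refine mul_le_mul_of_nonneg_left ?_ (sq_nonneg _)
          exact mul_le_mul e1 (by have := J3 n; linarith) (by positivity) (e0.trans e1)
  have lq : Tendsto q atTop (𝓝 ((2 * Real.pi * (Real.pi * a ^ 2)) ^ 2)) := (h2.const_mul _).pow 2
  have lr : Tendsto r atTop (𝓝 ((2 * Real.pi + 0) / (1 - 0 / 2) * (2 * (Real.pi * a ^ 2)))) :=
    ((hδ.const_add _).div ((en_tendsto.div_const 2).const_sub 1) (by norm_num)).mul (h1.const_mul 2)
  have lr0 : 0 < (2 * Real.pi + 0) / (1 - 0 / 2) * (2 * (Real.pi * a ^ 2)) := by norm_num; positivity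
  have lqr := (lq.div lr lr0.ne').sqrt
  have elim : Real.sqrt ((2 * Real.pi * (Real.pi * a ^ 2)) ^ 2 / ((2 * Real.pi + 0) / (1 - 0 / 2) * (2 * (Real.pi * a ^ 2))))
      = Real.pi * a := by
    rw [show (2 * Real.pi * (Real.pi * a ^ 2)) ^ 2 / ((2 * Real.pi + 0) / (1 - 0 / 2) * (2 * (Real.pi * a ^ 2)))
      = (Real.pi * a) ^ 2 by field_simp; ring]
    exact Real.sqrt_sq (by positivity)
  rw [elim] at lqr
  obtain ⟨c, hc⟩ := disc_seq hi nn l1 a ha lI y (by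
    intro d hd
    have f1 := (lqr.eventually (lt_mem_nhds (show Real.pi * a - d / 2 < Real.pi * a by linarith)))
    have f2 := en_tendsto.eventually (gt_mem_nhds (show 0 < d / 2 by linarith))
    filter_upwards [f1, f2, lr.eventually (lt_mem_nhds lr0)] with n g1 g2 g3
    have g4 : Real.sqrt (q n / r n) ≤ S n := by
      rw [Real.sqrt_le_left (hSn n), div_le_iff₀ g3]; exact hqr n
    have := hy n
    simp only [Pi.div_apply] at g1
    linarith)
  refine ⟨c, ?_⟩
  have hz : Tendsto (fun n => (∫ x, |(ball (c n) a).indicator 1 x - T n (p n x)|) +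
      (mu (p n) (t n) - ∫ x, T n (p n x))) atTop (𝓝 (0 + (Real.pi * a ^ 2 - Real.pi * a ^ 2))) := hc.add (h1.sub lI)
  simp only [sub_self, add_zero] at hz
  refine squeeze_zero (fun n => integral_nonneg fun x => abs_nonneg _) (fun n => ?_) hz
  have j0 := ind_integrable ((h n).meas (t n)) ((h n).fin (ht n))
  have j1 : Integrable ((ball (c n) a).indicator (1 : ℂ → ℝ)) := ind_ball_integrable _ _
  have j2 : Integrable fun x => |(ball (c n) a).indicator 1 x - T n (p n x)| := (j1.sub (hi n)).abs
  have j3 : Integrable fun x => {x | t n < p n x}.indicator (1 : ℂ → ℝ) x - T n (p n x) := j0.sub (hi n)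
  have e : mu (p n) (t n) - ∫ x, T n (p n x) = ∫ x, ({x | t n < p n x}.indicator (1 : ℂ → ℝ) x - T n (p n x)) := by
    rw [integral_sub j0 (hi n), ind_integral ((h n).meas _)]; rfl
  rw [e, ← integral_add j2 j3]
  refine integral_mono (j1.sub j0).abs (j2.add j3) fun x => ?_
  have hle : T n (p n x) ≤ {x | t n < p n x}.indicator (1 : ℂ → ℝ) x := by
    by_cases hx : x ∈ {x | t n < p n x}
    · rw [indicator_of_mem hx]; exact l1 n x
    · rw [indicator_of_notMem hx, (hT n).lo _ (not_lt.mp hx)]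
  have := abs_sub_le ((ball (c n) a).indicator (1 : ℂ → ℝ) x) (T n (p n x)) ({x | t n < p n x}.indicator (1 : ℂ → ℝ) x)
  have e2 : |T n (p n x) - {x | t n < p n x}.indicator (1 : ℂ → ℝ) x| =
    {x | t n < p n x}.indicator (1 : ℂ → ℝ) x - T n (p n x) := by
    rw [abs_sub_comm, abs_of_nonneg (by linarith)]
  simp only [Pi.add_apply, Pi.sub_apply]
  linarith

end RP

namespace RP
open scoped Topology Gradient

lemma ind_ball_conv {c : ℕ → ℂ} {r : ℕ → ℝ} {a : ℂ} {s : ℝ} (hc : Tendsto c atTop (𝓝 a))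
    (hr : Tendsto r atTop (𝓝 s)) :
    Tendsto (fun n => ∫ x, |(ball (c n) (r n)).indicator (1 : ℂ → ℝ) x - (ball a s).indicator 1 x|) atTop (𝓝 0) := by
  obtain ⟨M, hM⟩ := (hc.norm.add hr.abs).bddAbove_range
  have hM' : ∀ n, ‖c n‖ + |r n| ≤ M := fun n => hM ⟨n, rfl⟩
  have hM2 : ‖a‖ + |s| ≤ M := le_of_tendsto' (hc.norm.add hr.abs) hM'
  have sub : ∀ (b : ℂ) (q : ℝ), ‖b‖ + |q| ≤ M → ∀ x, x ∉ closedBall (0:ℂ) M → x ∉ ball b q := by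
    intro b q hb x hx hx'
    apply hx
    rw [mem_closedBall_zero_iff]
    rw [mem_ball, dist_eq_norm] at hx'
    calc ‖x‖ = ‖b + (x - b)‖ := by congr 1; ring
      _ ≤ ‖b‖ + ‖x - b‖ := norm_add_le _ _
      _ ≤ ‖b‖ + |q| := by linarith [le_abs_self q]
      _ ≤ M := hb
  have i0 : Integrable ((closedBall (0:ℂ) M).indicator (1 : ℂ → ℝ)) :=
    ind_integrable measurableSet_closedBall measure_closedBall_lt_top.ne
  have := tendsto_integral_of_dominated_convergence (F := fun n x =>
      |(ball (c n) (r n)).indicator (1 : ℂ → ℝ) x - (ball a s).indicator 1 x|) (f := fun _ => (0:ℝ))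
    (fun x => (closedBall (0:ℂ) M).indicator (1 : ℂ → ℝ) x) (μ := volume)
    (fun n => ((ind_ball_integrable _ _).sub (ind_ball_integrable _ _)).abs.aestronglyMeasurable)
    i0 (fun n => ae_of_all _ fun x => ?_) ?_
  · simpa using this
  · by_cases hx : x ∈ closedBall (0:ℂ) M
    · rw [indicator_of_mem hx, Real.norm_of_nonneg (abs_nonneg _), Pi.one_apply, abs_le]
      have := ind_nonneg (ball (c n) (r n)) x
      have := ind_le_one (ball (c n) (r n)) x
      have := ind_nonneg (ball a s) x
      have := ind_le_one (ball a s) x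
      constructor <;> linarith
    · rw [indicator_of_notMem hx, indicator_of_notMem (sub _ _ (hM' n) x hx),
        indicator_of_notMem (sub _ _ hM2 x hx)]
      simp
  · have : ∀ᵐ x, x ∉ sphere a s := by
      rw [ae_iff]; simp only [not_not, setOf_mem_eq]; exact Measure.addHaar_sphere _ _ _
    filter_upwards [this] with x hx
    have hd : Tendsto (fun n => r n - dist x (c n)) atTop (𝓝 (s - dist x a)) :=
      hr.sub (tendsto_const_nhds.dist hc)
    refine tendsto_const_nhds.congr' ?_
    rcases lt_trichotomy (dist x a) s with h | h | h
    · filter_upwards [hd.eventually (lt_mem_nhds (show 0 < s - dist x a by linarith))] with n hn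
      rw [indicator_of_mem (mem_ball.mpr (by linarith)), indicator_of_mem (mem_ball.mpr h)]; simp
    · exact absurd (mem_sphere.mpr h) hx
    · filter_upwards [hd.eventually (gt_mem_nhds (show s - dist x a < 0 by linarith))] with n hn
      rw [indicator_of_notMem (fun h' => by rw [mem_ball] at h'; linarith), indicator_of_notMem (fun h' => by rw [mem_ball] at h'; linarith)]; simp

lemma two_disc_core {c₁ c₂ : ℕ → ℂ} {r₁ r₂ : ℕ → ℝ} {g : ℂ → ℝ} (hg : Integrable g) {M : ℝ}
    (hb : ∃ᶠ n in atTop, (‖c₁ n‖ ≤ M ∧ |r₁ n| ≤ M) ∧ ‖c₂ n‖ ≤ M ∧ |r₂ n| ≤ M)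
    (hl : Tendsto (fun n => ∫ x, |(ball (c₁ n) (r₁ n)).indicator (1 : ℂ → ℝ) x -
      (ball (c₂ n) (r₂ n)).indicator 1 x - g x|) atTop (𝓝 0)) :
    ∃ (a₁ : ℂ) (s₁ : ℝ) (a₂ : ℂ) (s₂ : ℝ) (ns : ℕ → ℕ), StrictMono ns ∧
      Tendsto (r₁ ∘ ns) atTop (𝓝 s₁) ∧ Tendsto (r₂ ∘ ns) atTop (𝓝 s₂) ∧
      g =ᵐ[volume] fun x => (ball a₁ s₁).indicator (1 : ℂ → ℝ) x - (ball a₂ s₂).indicator 1 x := by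
  obtain ⟨⟨⟨a₁, s₁⟩, a₂, s₂⟩, -, ns, hns, hlim⟩ := tendsto_subseq_of_frequently_bounded
    (s := closedBall (0 : (ℂ × ℝ) × ℂ × ℝ) M) (x := fun n => ((c₁ n, r₁ n), (c₂ n, r₂ n)))
    isBounded_closedBall (hb.mono fun n hn => by
      rw [mem_closedBall_zero_iff, Prod.norm_def, Prod.norm_def, Prod.norm_def]
      exact max_le (max_le hn.1.1 hn.1.2) (max_le hn.2.1 hn.2.2))
  rw [Prod.tendsto_iff, Prod.tendsto_iff, Prod.tendsto_iff] at hlim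
  obtain ⟨⟨l1, l2⟩, l3, l4⟩ := hlim
  refine ⟨a₁, s₁, a₂, s₂, ns, hns, l2, l4, ?_⟩
  have k1 := ind_ball_conv l1 l2
  have k2 := ind_ball_conv l3 l4
  have k3 := hl.comp hns.tendsto_atTop
  have i1 : ∀ a s, Integrable ((ball a s).indicator (1 : ℂ → ℝ)) := fun a s => ind_ball_integrable _ _
  have hz : ∫ x, |g x - ((ball a₁ s₁).indicator (1 : ℂ → ℝ) x - (ball a₂ s₂).indicator 1 x)| = 0 := by
    refine le_antisymm ?_ (integral_nonneg fun x => abs_nonneg _)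
    have := (k1.add k2).add k3
    simp only [add_zero] at this
    refine ge_of_tendsto' this fun n => ?_
    simp only [Function.comp]
    set m := ns n
    have j1 : Integrable fun x => |(ball (c₁ m) (r₁ m)).indicator (1 : ℂ → ℝ) x - (ball a₁ s₁).indicator 1 x| :=
      ((i1 _ _).sub (i1 _ _)).abs
    have j2 : Integrable fun x => |(ball (c₂ m) (r₂ m)).indicator (1 : ℂ → ℝ) x - (ball a₂ s₂).indicator 1 x| :=
      ((i1 _ _).sub (i1 _ _)).abs
    have j3 : Integrable fun x => |(ball (c₁ m) (r₁ m)).indicator (1 : ℂ → ℝ) x -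
      (ball (c₂ m) (r₂ m)).indicator 1 x - g x| := (((i1 _ _).sub (i1 _ _)).sub hg).abs
    have j4 : Integrable fun x => |(ball (c₁ m) (r₁ m)).indicator (1 : ℂ → ℝ) x - (ball a₁ s₁).indicator 1 x| +
      |(ball (c₂ m) (r₂ m)).indicator (1 : ℂ → ℝ) x - (ball a₂ s₂).indicator 1 x| := j1.add j2
    rw [← integral_add j1 j2, ← integral_add j4 j3]
    refine integral_mono (hg.sub ((i1 _ _).sub (i1 _ _))).abs (j4.add j3) fun x => ?_
    simp only [Pi.sub_apply, Pi.add_apply]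
    generalize (ball (c₁ m) (r₁ m)).indicator (1 : ℂ → ℝ) x = u1
    generalize (ball (c₂ m) (r₂ m)).indicator (1 : ℂ → ℝ) x = u2
    generalize (ball a₁ s₁).indicator (1 : ℂ → ℝ) x = u3
    generalize (ball a₂ s₂).indicator (1 : ℂ → ℝ) x = u4
    rw [abs_le]
    have := abs_le.mp (le_refl |u1 - u3|)
    have := abs_le.mp (le_refl |u2 - u4|)
    have := abs_le.mp (le_refl |u1 - u2 - g x|)
    constructor <;> linarith
  have hz' := (integral_eq_zero_iff_of_nonneg (fun x => abs_nonneg _)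
    (hg.sub ((i1 a₁ s₁).sub (i1 a₂ s₂))).abs).mp hz
  filter_upwards [hz'] with x hx
  have hx : |g x - ((ball a₁ s₁).indicator (1 : ℂ → ℝ) x - (ball a₂ s₂).indicator 1 x)| = 0 := hx
  rw [abs_eq_zero, sub_eq_zero] at hx
  exact hx

/-- If `D` is disjoint from `B` then ... -/
lemma disj_bound {D B B' : Set ℂ} (hD : MeasurableSet D) (hDf : volume D ≠ ⊤) (hB : Integrable (B.indicator (1 : ℂ → ℝ)))
    (hB' : Integrable (B'.indicator (1 : ℂ → ℝ))) (h : Disjoint D B) :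
    volume.real D ≤ ∫ x, |B.indicator (1 : ℂ → ℝ) x - B'.indicator 1 x - D.indicator 1 x| := by
  rw [← ind_integral hD]
  refine integral_mono (ind_integrable hD hDf) ((hB.sub hB').sub (ind_integrable hD hDf)).abs fun x => ?_
  simp only [Pi.sub_apply]
  by_cases hx : x ∈ D
  · rw [indicator_of_mem hx, indicator_of_notMem (disjoint_left.mp h hx)]
    have := ind_nonneg B' x
    rw [abs_of_nonpos (by simp; linarith)]
    simp; linarith
  · rw [indicator_of_notMem hx]; exact abs_nonneg _

lemma one_disc {E : Set ℂ} (hE : MeasurableSet E) {R0 : ℝ} (hR : E ⊆ closedBall 0 R0) (hpos : 0 < volume.real E)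
    {c : ℕ → ℂ} {r : ℕ → ℝ} {M : ℝ} (hr0 : ∀ n, 0 ≤ r n) (hr : ∀ n, r n ≤ M)
    (hl : Tendsto (fun n => ∫ x, |(ball (c n) (r n)).indicator (1 : ℂ → ℝ) x - E.indicator 1 x|) atTop (𝓝 0)) :
    ∃ (a : ℂ) (s : ℝ), 0 ≤ s ∧ E.indicator (1 : ℂ → ℝ) =ᵐ[volume] (ball a s).indicator 1 := by
  have hEf : volume E ≠ ⊤ := ((measure_mono hR).trans_lt measure_closedBall_lt_top).ne
  have z : (fun x => (ball (0:ℂ) (0:ℝ)).indicator (1 : ℂ → ℝ) x) = fun _ => 0 := by ext x; simp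
  have z' : ∀ x, (ball (0:ℂ) (0:ℝ)).indicator (1 : ℂ → ℝ) x = 0 := fun x => by simp
  have hl' : Tendsto (fun n => ∫ x, |(ball (c n) (r n)).indicator (1 : ℂ → ℝ) x -
      (ball (0:ℂ) (0:ℝ)).indicator 1 x - E.indicator 1 x|) atTop (𝓝 0) := by
    simpa only [z', sub_zero] using hl
  have hM0 : 0 ≤ M := (hr0 0).trans (hr 0)
  have ev : ∀ᶠ n in atTop, ‖c n‖ ≤ |R0| + M := by
    filter_upwards [hl'.eventually (gt_mem_nhds hpos)] with n hn
    by_contra hc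
    refine absurd hn (not_lt.mpr (disj_bound hE hEf (ind_ball_integrable _ _) (ind_ball_integrable _ _) ?_))
    rw [disjoint_left]
    intro x hx hx'
    have h1 := mem_closedBall_zero_iff.mp (hR hx)
    rw [mem_ball, dist_eq_norm] at hx'
    apply hc
    calc ‖c n‖ = ‖x - (x - c n)‖ := by congr 1; ring
      _ ≤ ‖x‖ + ‖x - c n‖ := norm_sub_le _ _
      _ ≤ _ := by linarith [hr n, le_abs_self R0]
  obtain ⟨a₁, s₁, a₂, s₂, ns, hns, t1, t2, hae⟩ := two_disc_core (c₂ := fun _ => 0) (r₂ := fun _ => 0)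
    (M := |R0| + M) (ind_integrable hE hEf) (ev.mono fun n hn => ⟨⟨hn, by
      rw [abs_of_nonneg (hr0 n)]; linarith [hr n, abs_nonneg R0]⟩, by simp; positivity, by simp; positivity⟩).frequently hl'
  have hs2 : s₂ = 0 := tendsto_nhds_unique t2 (by simp [Function.comp_def])
  refine ⟨a₁, s₁, ge_of_tendsto' t1 fun n => hr0 _, ?_⟩
  subst hs2
  simpa using hae

lemma final_compact {D : Set ℂ} (hD : MeasurableSet D) {R0 : ℝ} (hR : D ⊆ closedBall 0 R0) (hpos : 0 < volume.real D)
    {c₁ c₂ : ℕ → ℂ} {r₁ r₂ : ℕ → ℝ} {M : ℝ} (hr0 : ∀ n, 0 ≤ r₁ n) (hr : ∀ n, r₁ n ≤ M)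
    (hr0' : ∀ n, 0 ≤ r₂ n) (hr' : ∀ n, r₂ n ≤ M)
    (hl : Tendsto (fun n => ∫ x, |(ball (c₁ n) (r₁ n)).indicator (1 : ℂ → ℝ) x -
      (ball (c₂ n) (r₂ n)).indicator 1 x - D.indicator 1 x|) atTop (𝓝 0)) :
    ∃ (a₁ : ℂ) (s₁ : ℝ) (a₂ : ℂ) (s₂ : ℝ), 0 ≤ s₁ ∧ 0 ≤ s₂ ∧ D.indicator (1 : ℂ → ℝ) =ᵐ[volume]
      fun x => (ball a₁ s₁).indicator (1 : ℂ → ℝ) x - (ball a₂ s₂).indicator 1 x := by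
  classical
  have hDf : volume D ≠ ⊤ := ((measure_mono hR).trans_lt measure_closedBall_lt_top).ne
  have hM0 : 0 ≤ M := (hr0 0).trans (hr 0)
  have iD := ind_integrable hD hDf
  have i1 : ∀ a s, Integrable ((ball a s).indicator (1 : ℂ → ℝ)) := fun a s => ind_ball_integrable _ _
  have ev : ∀ᶠ n in atTop, ‖c₁ n‖ ≤ |R0| + M := by
    filter_upwards [hl.eventually (gt_mem_nhds hpos)] with n hn
    by_contra hc
    refine absurd hn (not_lt.mpr (disj_bound hD hDf (i1 _ _) (i1 _ _) ?_))
    rw [disjoint_left]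
    intro x hx hx'
    have h1 := mem_closedBall_zero_iff.mp (hR hx)
    rw [mem_ball, dist_eq_norm] at hx'
    apply hc
    calc ‖c₁ n‖ = ‖x - (x - c₁ n)‖ := by congr 1; ring
      _ ≤ ‖x‖ + ‖x - c₁ n‖ := norm_sub_le _ _
      _ ≤ _ := by linarith [hr n, le_abs_self R0]
  set P : ℕ → Prop := fun n => Disjoint (ball (c₂ n) (r₂ n)) (ball (c₁ n) (r₁ n)) with hP
  set c₂' : ℕ → ℂ := fun n => if P n then 0 else c₂ n with hc2
  set r₂' : ℕ → ℝ := fun n => if P n then 0 else r₂ n with hr2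
  have ev2 : ∀ᶠ n in atTop, ‖c₂' n‖ ≤ |R0| + M + 2 * M := by
    filter_upwards [ev] with n hn
    by_cases hp : P n
    · simp only [hc2, if_pos hp, norm_zero]; positivity
    · simp only [hc2, if_neg hp]
      obtain ⟨x, hx1, hx2⟩ := not_disjoint_iff.mp hp
      rw [mem_ball, dist_eq_norm] at hx1 hx2
      calc ‖c₂ n‖ = ‖c₁ n + (x - c₁ n) - (x - c₂ n)‖ := by congr 1; ring
        _ ≤ ‖c₁ n‖ + ‖x - c₁ n‖ + ‖x - c₂ n‖ := (norm_sub_le _ _).trans (by gcongr; exact norm_add_le _ _)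
        _ ≤ _ := by linarith [hr n, hr' n]
  have b2 : ∀ n, 0 ≤ r₂' n ∧ r₂' n ≤ M := by
    intro n
    by_cases hp : P n
    · simp [hr2, if_pos hp, hM0]
    · simp [hr2, if_neg hp, hr0' n, hr' n]
  have hl' : Tendsto (fun n => ∫ x, |(ball (c₁ n) (r₁ n)).indicator (1 : ℂ → ℝ) x -
      (ball (c₂' n) (r₂' n)).indicator 1 x - D.indicator 1 x|) atTop (𝓝 0) := by
    refine squeeze_zero (fun n => integral_nonneg fun x => abs_nonneg _) (fun n => ?_) hl
    refine integral_mono (((i1 _ _).sub (i1 _ _)).sub iD).abs (((i1 _ _).sub (i1 _ _)).sub iD).abs fun x => ?_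
    simp only [Pi.sub_apply]
    by_cases hp : P n
    · simp only [hr2, hc2, if_pos hp]
      simp only [ball_zero, indicator_empty]
      by_cases hx : x ∈ ball (c₂ n) (r₂ n)
      · rw [indicator_of_notMem (disjoint_left.mp hp hx), indicator_of_mem hx]
        have := ind_nonneg D x
        rw [abs_of_nonpos (by simpa using this), abs_of_nonpos (by simp; linarith)]
        simp
      · rw [indicator_of_notMem hx]
    · simp only [hr2, hc2, if_neg hp]; exact le_rfl
  have hA := abs_nonneg R0
  obtain ⟨a₁, s₁, a₂, s₂, ns, hns, t1, t2, hae⟩ := two_disc_core 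
    (M := |R0| + M + 2 * M) iD ((ev.and ev2).mono fun n hn => ⟨⟨by linarith [hn.1], by
      rw [abs_of_nonneg (hr0 n)]; linarith [hr n]⟩, hn.2, by
      rw [abs_of_nonneg (b2 n).1]; linarith [(b2 n).2]⟩).frequently hl'
  exact ⟨a₁, s₁, a₂, s₂, ge_of_tendsto' t1 fun n => hr0 _, ge_of_tendsto' t2 fun n => (b2 _).1, hae⟩

end RP

namespace RP
open scoped Topology Gradient

lemma grad_zero_level {f : ℂ → ℝ} (hf : ContDiff ℝ 1 f) (c : ℝ) :
    ∀ᵐ x, f x = c → ∇ f x = 0 := by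
  have hm : MeasurableSet {x | f x = c} := (isClosed_eq hf.continuous continuous_const).measurableSet
  have hd : ∀ x, HasFDerivAt (fun x => (f x : ℂ)) (Complex.ofRealCLM.comp (fderiv ℝ f x)) x := fun x =>
    Complex.ofRealCLM.hasFDerivAt.comp x (hf.differentiable (by norm_num) x).hasFDerivAt
  have ap : ApproximatesLinearOn (fun x => (f x : ℂ)) (0 : ℂ →L[ℝ] ℂ) {x | f x = c} 0 := by
    intro x hx y hy
    have hx : f x = c := hx
    have hy : f y = c := hy
    simp [hx, hy]
  have := ap.norm_fderiv_sub_le volume hm (fun x => Complex.ofRealCLM.comp (fderiv ℝ f x))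
    (fun x hx => (hd x).hasFDerivWithinAt)
  rw [ae_restrict_iff' hm] at this
  filter_upwards [this] with x hx hxc
  have h1 := hx hxc
  simp only [sub_zero, nonpos_iff_eq_zero, nnnorm_eq_zero] at h1
  have h2 : fderiv ℝ f x = 0 := by
    ext v
    have := congrArg (fun L : ℂ →L[ℝ] ℂ => L v) h1
    simpa using this
  simp [gradient, h2]

lemma virial {f : ℂ → ℝ} (hf : Integrable f) (hb : ∀ x, |f x| ≤ 1) {R : ℝ} (hs : ∀ x, R < ‖x‖ → f x = 0) :
    ∫ y, f y * inner ℝ y (G f y) = - (∫ y, f y) ^ 2 / 2 := by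
  have h1 : ∀ y, f y * inner ℝ y (G f y) = ∫ x, f y * (f x * inner ℝ y (K (x - y))) := by
    intro y
    rw [inner_G hf hb, integral_const_mul]
  simp_rw [h1]
  have hfR : Integrable fun y => f y * ‖y‖ := integrable_mul_cont hf hs (continuous_norm)
  have hmeas : AEStronglyMeasurable (Function.uncurry fun (y x : ℂ) =>
      f y * (f x * inner ℝ y (K (x - y)))) (volume.prod volume) := by
    refine (hf.aestronglyMeasurable.comp_fst).mul ((hf.aestronglyMeasurable.comp_snd).mul ?_)
    refine AEStronglyMeasurable.inner ?_ ?_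
    · exact continuous_fst.aestronglyMeasurable
    · exact (measurable_K.comp (measurable_snd.sub measurable_fst)).aestronglyMeasurable
  have hbd : ∀ y x : ℂ, ‖f y * (f x * inner ℝ y (K (x - y)))‖ ≤ ‖f y * ‖y‖‖ * (|f x| * ‖x - y‖⁻¹) := by
    intro y x
    rw [norm_mul, norm_mul, norm_mul, norm_norm]
    have := norm_inner_le_norm (𝕜 := ℝ) y (K (x - y))
    rw [norm_K] at this
    calc _ ≤ ‖f y‖ * (‖f x‖ * (‖y‖ * ‖x - y‖⁻¹)) := by gcongr
      _ = _ := by rw [Real.norm_eq_abs (f x)]; ring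
  have hpi : ∀ y : ℂ, Integrable (fun x => f y * (f x * inner ℝ y (K (x - y)))) := by
    intro y
    have := (integrable_G hf hb y).const_inner (𝕜 := ℝ) y
    simp only [real_inner_smul_right] at this
    exact this.const_mul _
  have hintg : Integrable (Function.uncurry fun (y x : ℂ) =>
      f y * (f x * inner ℝ y (K (x - y)))) (volume.prod volume) := by
    rw [integrable_prod_iff hmeas]
    refine ⟨Eventually.of_forall hpi, ?_⟩
    refine (hfR.norm.mul_const
      (2 * Real.pi * 1 + (∫ x, |f x|) / 1)).mono' hmeas.norm.integral_prod_right' ?_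
    filter_upwards with y
    rw [Real.norm_of_nonneg (integral_nonneg fun _ => norm_nonneg _)]
    calc _ ≤ ∫ x, ‖f y * ‖y‖‖ * (|f x| * ‖x - y‖⁻¹) :=
          integral_mono (hpi y).norm ((integrable_mul_inv_norm hf hb y).const_mul _) (hbd y)
      _ = ‖f y * ‖y‖‖ * ∫ x, (|f x| * ‖x - y‖⁻¹) := integral_const_mul _ _
      _ ≤ _ := by gcongr; exact integral_mul_inv_norm_le hf hb y 1 one_pos
  have hintg' : Integrable (Function.uncurry fun (y x : ℂ) =>
      f x * (f y * inner ℝ x (K (y - x)))) (volume.prod volume) := hintg.swap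
  have hsw := integral_integral_swap hintg
  set S := ∫ y, ∫ x, f y * (f x * inner ℝ y (K (x - y))) with hS
  have key : S + S = - (∫ y, f y) ^ 2 := by
    conv_lhs => rhs; rw [hsw]
    rw [hS]
    refine (integral_add hintg.integral_prod_left hintg'.integral_prod_left).symm.trans ?_
    have : ∀ y, (∫ x, Function.uncurry (fun (y x : ℂ) => f y * (f x * inner ℝ y (K (x - y)))) (y, x)) +
        (∫ x, Function.uncurry (fun (y x : ℂ) => f x * (f y * inner ℝ x (K (y - x)))) (y, x)) =
        - (f y * ∫ x, f x) := by
      intro y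
      have hp2 : Integrable fun x => f x * (f y * inner ℝ x (K (y - x))) := by
        have e : (fun x => f x * (f y * inner ℝ x (K (y - x)))) = fun x => f y * (f x * inner ℝ (x - y) (K (y - x))) +
            (f y * (-1)) * (f x * inner ℝ y (K (x - y))) := by
          ext x
          rw [inner_sub_left, ← neg_sub x y, K_neg, inner_neg_right, inner_neg_right]; ring
        rw [e]
        refine Integrable.add ?_ ?_
        · have : (fun x => f y * (f x * inner ℝ (x - y) (K (y - x)))) =ᵐ[volume] fun x => f y * (- f x) := by
            have : ∀ᵐ x : ℂ, x ≠ y := by simp [ae_iff]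
            filter_upwards [this] with x hx
            rw [← neg_sub x y, K_neg, inner_neg_right, inner_K_self _ (sub_ne_zero.mpr hx)]; ring
          exact (hf.neg.const_mul (f y)).congr this.symm
        · have := (integrable_G hf hb y).const_inner (𝕜 := ℝ) y
          simp only [real_inner_smul_right] at this
          exact this.const_mul _
      simp only [Function.uncurry]
      rw [← integral_add (hpi y) hp2, ← integral_const_mul, ← integral_neg]
      refine integral_congr_ae ?_
      have : ∀ᵐ x : ℂ, x ≠ y := by simp [ae_iff]
      filter_upwards [this] with x hx
      have e2 := inner_K_self _ (sub_ne_zero.mpr hx)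
      rw [inner_sub_left] at e2
      rw [← neg_sub x y, K_neg, inner_neg_right]
      linear_combination (-(f x * f y)) * e2
    have h3 := integral_congr_ae (μ := volume) (ae_of_all _ this)
    refine h3.trans ?_
    rw [integral_neg, integral_mul_const]; ring
  linarith

end RP

namespace RP
open scoped Topology Gradient

structure Bd (D : Set ℂ) (k : ℕ) (Γ : Fin k → Set ℂ) (x : Fin k → ℂ) (R0 : ℝ) : Prop where
  op : IsOpen D
  conn : IsConnected D
  R0pos : 0 < R0
  sub : D ⊆ ball 0 R0
  cl : ∀ i, IsClosed (Γ i)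
  pre : ∀ i, IsPreconnected (Γ i)
  mem : ∀ i, x i ∈ Γ i
  disj : Pairwise fun i j => Disjoint (Γ i) (Γ j)
  fr : frontier D = ⋃ i, Γ i

/-- locally constant on the complement of `D` -/
def LC (D : Set ℂ) {α : Type*} (f : ℂ → α) : Prop := ∀ x ∈ Dᶜ, ∀ᶠ y in 𝓝[Dᶜ] x, f y = f x

variable {D : Set ℂ} {k : ℕ} {Γ : Fin k → Set ℂ} {x : Fin k → ℂ} {R0 : ℝ}

lemma Bd.fr_sub (h : Bd D k Γ x R0) : frontier D ⊆ Dᶜ := by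
  intro y hy; rw [h.op.frontier_eq] at hy; exact hy.2

lemma Bd.Γ_fr (h : Bd D k Γ x R0) (i : Fin k) : Γ i ⊆ frontier D := by
  rw [h.fr]; exact subset_iUnion _ i

lemma Bd.clopen (h : Bd D k Γ x R0) {S : Set ℂ} (hS : LC D (fun y => y ∈ S)) (hf : ∀ y ∈ frontier D, y ∉ S) :
    ∀ y ∈ Dᶜ, y ∉ S := by
  set S' := S ∩ Dᶜ with hS'
  have hop : IsOpen S' := by
    rw [isOpen_iff_mem_nhds]
    rintro y ⟨hy, hyD⟩
    have hyc : y ∉ closure D := fun hc => hf y (by rw [h.op.frontier_eq]; exact ⟨hc, hyD⟩) hy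
    have hn : Dᶜ ∈ 𝓝 y := mem_of_superset (isClosed_closure.isOpen_compl.mem_nhds hyc)
      (compl_subset_compl.mpr subset_closure)
    have := hS y hyD
    rw [nhdsWithin_eq_nhds.mpr hn] at this
    filter_upwards [this, hn] with z hz hz'
    exact ⟨by simpa [hy] using hz, hz'⟩
  have hcl : IsClosed S' := by
    rw [← isOpen_compl_iff, isOpen_iff_mem_nhds]
    intro y hy
    by_cases hyD : y ∈ D
    · filter_upwards [h.op.mem_nhds hyD] with z hz hz'
      exact hz'.2 hz
    · have hyS : y ∉ S := fun hc => hy ⟨hc, hyD⟩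
      have := hS y hyD
      rw [eventually_nhdsWithin_iff] at this
      filter_upwards [this] with z hz hz'
      have := hz hz'.2
      simp only [hyS, eq_iff_iff, iff_false] at this
      exact this hz'.1
  rcases isClopen_iff.mp ⟨hcl, hop⟩ with h1 | h1
  · intro y hy hyS
    have : y ∈ S' := ⟨hyS, hy⟩
    rw [h1] at this; exact this
  · obtain ⟨z, hz⟩ := h.conn.nonempty
    have : z ∈ S' := by rw [h1]; trivial
    exact absurd hz this.2

lemma LC.comp {α β : Type*} {f : ℂ → α} (hf : LC D f) (g : α → β) : LC D (fun y => g (f y)) := by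
  intro y hy
  filter_upwards [hf y hy] with z hz
  simp only [hz]

lemma LC.comp₂ {α β γ : Type*} {f : ℂ → α} {f' : ℂ → β} (hf : LC D f) (hf' : LC D f') (g : α → β → γ) :
    LC D (fun y => g (f y) (f' y)) := by
  intro y hy
  filter_upwards [hf y hy, hf' y hy] with z hz hz'
  simp only [hz, hz']

lemma LC.const_on {α : Type*} {f : ℂ → α} (hf : LC D f) {s : Set ℂ} (hs : IsPreconnected s) (hsD : s ⊆ Dᶜ)
    {y z : ℂ} (hy : y ∈ s) (hz : z ∈ s) : f y = f z := by
  have : PreconnectedSpace s := Subtype.preconnectedSpace hs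
  have hlc : IsLocallyConstant (fun w : s => f w) := by
    rw [IsLocallyConstant.iff_eventually_eq]
    rintro ⟨w, hw⟩
    have := (hf w (hsD hw)).filter_mono (nhdsWithin_mono w hsD)
    rw [nhdsWithin_eq_map_subtype_coe hw] at this
    exact this
  exact hlc.apply_eq_of_preconnectedSpace ⟨y, hy⟩ ⟨z, hz⟩

lemma int_const {g : ℂ → ℝ} {S : Set ℂ} (hS : IsPreconnected S) (hg : ContinuousOn g S)
    (hi : ∀ y ∈ S, ∃ m : ℤ, g y = m) : ∀ y ∈ S, ∀ z ∈ S, g y = g z := by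
  have key : ∀ y ∈ S, ∀ z ∈ S, ¬ g y < g z := by
    intro y hy z hz hlt
    obtain ⟨m, hm⟩ := hi y hy
    obtain ⟨m', hm'⟩ := hi z hz
    have hmm : m < m' := by rw [hm, hm'] at hlt; exact_mod_cast hlt
    have hmm' : (m : ℝ) + 1 ≤ m' := by exact_mod_cast hmm
    obtain ⟨w, hw, hwe⟩ := hS.intermediate_value hy hz hg (show (m : ℝ) + 1 / 2 ∈ Icc (g y) (g z) from
      ⟨by rw [hm]; linarith, by rw [hm']; linarith⟩)
    obtain ⟨l, hl⟩ := hi w hw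
    rw [hl] at hwe
    have h1 : m < l := by have : (m : ℝ) < l := by linarith
                          exact_mod_cast this
    have h2 : l < m + 1 := by have : (l : ℝ) < m + 1 := by linarith
                              exact_mod_cast this
    omega
  intro y hy z hz
  exact le_antisymm (not_lt.mp (key z hz y hy)) (not_lt.mp (key y hy z hz))

lemma int_lc {g : ℂ → ℝ} (hg : ContinuousOn g Dᶜ) (hi : ∀ y ∈ Dᶜ, ∃ m : ℤ, g y = m) : LC D g := by
  intro y hy
  obtain ⟨m, hm⟩ := hi y hy
  have := (hg y hy).eventually (Ioo_mem_nhds (show g y - 1 < g y by linarith) (show g y < g y + 1 by linarith))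
  filter_upwards [this, self_mem_nhdsWithin] with z hz hzD
  obtain ⟨l, hl⟩ := hi z hzD
  have hz1 := hz.1
  have hz2 := hz.2
  rw [hm, hl] at hz1 hz2
  have h1 : (m : ℝ) < l + 1 := by linarith
  have h2 : (l : ℝ) < m + 1 := by linarith
  have h1' : m < l + 1 := by exact_mod_cast h1
  have h2' : l < m + 1 := by exact_mod_cast h2
  have : l = m := by omega
  rw [hm, hl, this]

theorem Bd.exists_kappa (h : Bd D k Γ x R0) (j : Fin k) :
    ∃ κ : ℂ → ℝ, LC D κ ∧ (∀ y ∈ Γ j, κ y = 1) ∧ ∀ i ≠ j, ∀ y ∈ Γ i, κ y = 0 := by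
  classical
  have hpi := Real.pi_pos
  have hQ : IsClosed (⋃ i ∈ {i | i ≠ j}, Γ i) := (Set.toFinite _).isClosed_biUnion fun i _ => h.cl i
  obtain ⟨l, l0, l1, -⟩ := exists_continuous_zero_one_of_isClosed (h.cl j) hQ (by
    rw [disjoint_iUnion₂_right]
    intro i hi
    exact h.disj (Ne.symm hi))
  have l0' : ∀ y ∈ Γ j, l y = 0 := fun y hy => l0 hy
  have l1' : ∀ i ≠ j, ∀ y ∈ Γ i, l y = 1 := fun i hi y hy => l1 (mem_biUnion hi hy)
  have lfr : ∀ y ∈ frontier D, l y = 0 ∨ l y = 1 := by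
    intro y hy
    rw [h.fr, mem_iUnion] at hy
    obtain ⟨i, hi⟩ := hy
    by_cases hij : i = j
    · subst hij; exact Or.inl (l0' y hi)
    · exact Or.inr (l1' i hij y hi)
  have efr : ∀ y ∈ frontier D, Circle.exp (-(Real.pi * l y)) = Circle.exp (Real.pi * l y) := by
    intro y hy
    rw [Circle.exp_eq_exp]
    rcases lfr y hy with h0 | h0
    · exact ⟨0, by simp [h0]⟩
    · exact ⟨-1, by simp [h0]; ring⟩
  set f : C(ℂ, Circle) := ⟨fun y => if y ∈ D then Circle.exp (-(Real.pi * l y)) else Circle.exp (Real.pi * l y), by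
    refine Continuous.if (fun y hy => efr y hy) ?_ ?_ <;> fun_prop⟩ with hf
  have f1 : ∀ y ∈ closure D, f y = Circle.exp (-(Real.pi * l y)) := by
    intro y hy
    by_cases hyD : y ∈ D
    · simp [hf, hyD]
    · have : y ∈ frontier D := by rw [h.op.frontier_eq]; exact ⟨hy, hyD⟩
      simp [hf, hyD]
      rw [← Circle.exp_neg, efr y this]
  have f2 : ∀ y ∈ Dᶜ, f y = Circle.exp (Real.pi * l y) := by
    intro y hy
    have : y ∉ D := hy
    simp [hf, this]
  obtain ⟨e0, he0⟩ := Circle.exp_surjective (f 0)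
  obtain ⟨θ, ⟨-, hθ⟩, -⟩ := Circle.isCoveringMap_exp.existsUnique_continuousMap_lifts f 0 e0 he0
  have hθ' : ∀ y, Circle.exp (θ y) = f y := fun y => congrFun hθ y
  set g1 : ℂ → ℝ := fun y => (θ y + Real.pi * l y) / (2 * Real.pi) with hg1
  set g2 : ℂ → ℝ := fun y => (θ y - Real.pi * l y) / (2 * Real.pi) with hg2
  have c1 : Continuous g1 := by rw [hg1]; fun_prop
  have c2 : Continuous g2 := by rw [hg2]; fun_prop
  have i1 : ∀ y ∈ closure D, ∃ m : ℤ, g1 y = m := by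
    intro y hy
    have := (hθ' y).trans (f1 y hy)
    rw [Circle.exp_eq_exp] at this
    obtain ⟨m, hm⟩ := this
    refine ⟨m, ?_⟩
    simp only [hg1]; rw [hm]; field_simp; ring
  have i2 : ∀ y ∈ Dᶜ, ∃ m : ℤ, g2 y = m := by
    intro y hy
    have := (hθ' y).trans (f2 y hy)
    rw [Circle.exp_eq_exp] at this
    obtain ⟨m, hm⟩ := this
    refine ⟨m, ?_⟩
    simp only [hg2]; rw [hm]; field_simp; ring
  have k1 := int_const h.conn.isPreconnected.closure c1.continuousOn i1
  have k2 := int_lc c2.continuousOn i2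
  have fc : ∀ i, ∀ y ∈ Γ i, y ∈ closure D := fun i y hy => frontier_subset_closure (h.Γ_fr i hy)
  refine ⟨fun y => g2 y - g1 (x j) + 1, k2.comp (fun s => s - g1 (x j) + 1), ?_, ?_⟩
  · intro y hy
    have e1 := k1 y (fc j y hy) (x j) (fc j _ (h.mem j))
    simp only
    rw [← e1, hg1, hg2]
    simp only
    rw [l0' y hy]; ring
  · intro i hi y hy
    have e1 := k1 y (fc i y hy) (x j) (fc j _ (h.mem j))
    simp only
    rw [← e1, hg1, hg2]
    simp only
    rw [l1' i hi y hy]; field_simp; ring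

/-- finite partition of the complement on which locally constant functions are constant -/
theorem Bd.exists_part (h : Bd D k Γ x R0) :
    ∃ Q : Fin k → Set ℂ, (∀ i, Γ i ⊆ Q i) ∧ (∀ y ∈ Dᶜ, ∃ i, y ∈ Q i) ∧ (∀ i, Q i ⊆ Dᶜ) ∧
      (∀ i j, i ≠ j → Disjoint (Q i) (Q j)) ∧
      (∀ i, LC D (fun y => y ∈ Q i)) ∧ ∀ f : ℂ → ℝ, LC D f → ∀ i, ∀ y ∈ Q i, f y = f (x i) := by
  choose κ hκ h1 h0 using h.exists_kappa
  have lc : ∀ i, LC D (fun y => κ i y = 1) := fun i => (hκ i).comp (fun s => s = 1)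
  have frc : ∀ y ∈ frontier D, ∃ i, y ∈ Γ i := fun y hy => by rwa [h.fr, mem_iUnion] at hy
  have self : LC D (fun y => y ∈ Dᶜ) := fun y hy => by
    filter_upwards [self_mem_nhdsWithin] with z hz
    simp only [hz, hy]
  refine ⟨fun i => {y | κ i y = 1} ∩ Dᶜ, fun i y hy => ⟨h1 i y hy, h.fr_sub (h.Γ_fr i hy)⟩, ?_, fun i y hy => hy.2, ?_, ?_, ?_⟩
  · intro y hy
    by_contra hc
    push Not at hc
    have hcl : LC D (fun y => y ∈ {y | ∀ i, κ i y ≠ 1}) := by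
      intro y hy
      have : ∀ᶠ z in 𝓝[Dᶜ] y, ∀ i, κ i z = κ i y := by
        rw [eventually_all]; exact fun i => hκ i y hy
      filter_upwards [this] with z hz
      simp only [mem_setOf_eq, hz]
    refine h.clopen hcl ?_ y hy (fun i hi => hc i ⟨hi, hy⟩)
    intro z hz hz'
    obtain ⟨i, hi⟩ := frc z hz
    exact hz' i (h1 i z hi)
  · intro i j hij
    rw [disjoint_left]
    rintro y ⟨hy1, hyD⟩ ⟨hy2, -⟩
    have hcl : LC D (fun y => y ∈ {y | κ i y = 1 ∧ κ j y = 1}) := (lc i).comp₂ (lc j) And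
    refine h.clopen hcl ?_ y hyD ⟨hy1, hy2⟩
    rintro z hz ⟨hz1, hz2⟩
    obtain ⟨l, hl⟩ := frc z hz
    by_cases hli : l = i
    · subst hli
      rw [h0 j l hij z hl] at hz2; norm_num at hz2
    · rw [h0 i l hli z hl] at hz1; norm_num at hz1
  · intro i
    exact (lc i).comp₂ self And
  · intro f hf i y hy
    by_contra hc
    have hcl : LC D (fun y => y ∈ {y | κ i y = 1 ∧ f y ≠ f (x i)}) :=
      (lc i).comp₂ (hf.comp (fun s => s ≠ f (x i))) And
    refine h.clopen hcl ?_ y hy.2 ⟨hy.1, hc⟩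
    rintro z hz ⟨hz1, hz2⟩
    obtain ⟨l, hl⟩ := frc z hz
    by_cases hli : l = i
    · subst hli
      exact hz2 (hf.const_on (h.pre l) ((h.Γ_fr l).trans h.fr_sub) hl (h.mem l))
    · rw [h0 i l hli z hl] at hz1; norm_num at hz1

end RP

namespace RP
open scoped Topology Gradient

lemma exists_trunc (F : Finset ℝ) (hF : F.Nonempty) : ∃ T : ℕ → ℝ → ℝ, (∀ n, ContDiff ℝ 1 (T n)) ∧
    (∀ n s, 0 ≤ deriv (T n) s ∧ deriv (T n) s ≤ 1) ∧
    (∀ n, ∀ a ∈ F, ∀ᶠ s in 𝓝 a, T n s = T n a) ∧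
    (∀ s ∉ F, Tendsto (fun n => deriv (T n) s) atTop (𝓝 1)) := by
  have hF' : (F : Set ℝ).Nonempty := hF
  set θ : ℕ → ℝ → ℝ := fun n s => max 0 (min 1 (infDist s (F : Set ℝ) / en n - 1)) with hθ
  have hc : ∀ n, Continuous (θ n) := fun n => by
    have := continuous_infDist_pt (F : Set ℝ)
    simp only [hθ]; fun_prop
  have hd : ∀ n s, HasDerivAt (fun s => ∫ r in (0:ℝ)..s, θ n r) (θ n s) s := fun n s =>
    (hc n).integral_hasStrictDerivAt 0 s |>.hasDerivAt
  have hde : ∀ n, deriv (fun s => ∫ r in (0:ℝ)..s, θ n r) = θ n := fun n => funext fun s => (hd n s).deriv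
  refine ⟨fun n s => ∫ r in (0:ℝ)..s, θ n r, ?_, ?_, ?_, ?_⟩
  · intro n
    rw [contDiff_one_iff_deriv]
    exact ⟨fun s => (hd n s).differentiableAt, by rw [hde]; exact hc n⟩
  · intro n s
    rw [hde]
    exact ⟨le_max_left _ _, max_le zero_le_one (min_le_left _ _)⟩
  · intro n a ha
    have hen := en_pos n
    filter_upwards [ball_mem_nhds a hen] with s hs
    have h0 : ∀ r ∈ uIcc a s, θ n r = 0 := by
      intro r hr
      have h1 : |r - a| ≤ |s - a| := abs_sub_left_of_mem_uIcc hr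
      rw [mem_ball, Real.dist_eq] at hs
      have h2 : infDist r (F : Set ℝ) ≤ |r - a| := by
        rw [← Real.dist_eq]; exact infDist_le_dist_of_mem (by exact_mod_cast ha)
      have h3 : infDist r (F : Set ℝ) / en n ≤ 1 := by rw [div_le_one hen]; linarith
      simp only [hθ]
      exact max_eq_left ((min_le_right _ _).trans (by linarith))
    have h2 : ∫ r in a..s, θ n r = 0 := by
      rw [intervalIntegral.integral_congr (g := fun _ => (0:ℝ)) h0]; simp
    have h1 := intervalIntegral.integral_add_adjacent_intervals (μ := volume)
      ((hc n).intervalIntegrable 0 a) ((hc n).intervalIntegrable a s)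
    rw [← h1, h2, add_zero]
  · intro s hs
    simp only [hde]
    have hpos : 0 < infDist s (F : Set ℝ) := by
      rw [← (F.finite_toSet.isClosed).notMem_iff_infDist_pos hF']; exact_mod_cast hs
    refine tendsto_const_nhds.congr' ?_
    have : ∀ᶠ n in atTop, en n < infDist s (F : Set ℝ) / 2 := en_tendsto.eventually (gt_mem_nhds (by positivity))
    filter_upwards [this] with n hn
    have hen := en_pos n
    have : 2 ≤ infDist s (F : Set ℝ) / en n := by rw [le_div_iff₀ hen]; linarith
    simp only [hθ]
    rw [min_eq_left (by linarith), max_eq_right zero_le_one]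

lemma glue_C1 {φ w : ℂ → ℝ} {S : Set ℂ} {T : ℝ → ℝ} (hT : ContDiff ℝ 1 T) (hw : ContDiff ℝ 1 w)
    (h1 : ∀ x ∈ S, ∃ c : ℝ, φ =ᶠ[𝓝 x] fun z => T (w z) + c) (h2 : ∀ x ∉ S, ∃ c : ℝ, φ =ᶠ[𝓝 x] fun _ => c) :
    ContDiff ℝ 1 φ ∧ ∇ φ = S.indicator (fun x => deriv T (w x) • ∇ w x) := by
  constructor
  · rw [contDiff_iff_contDiffAt]
    intro x
    by_cases hx : x ∈ S
    · obtain ⟨c, hc⟩ := h1 x hx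
      exact (((hT.comp hw).add contDiff_const).contDiffAt).congr_of_eventuallyEq hc
    · obtain ⟨c, hc⟩ := h2 x hx
      exact contDiffAt_const.congr_of_eventuallyEq hc
  · ext1 x
    by_cases hx : x ∈ S
    · obtain ⟨c, hc⟩ := h1 x hx
      rw [hc.gradient.eq_of_nhds, indicator_of_mem hx, grad_add (φ := fun z => T (w z)) (hT.comp hw) contDiff_const, grad_comp hw hT]
      simp [gradient_fun_const]
    · obtain ⟨c, hc⟩ := h2 x hx
      rw [hc.gradient.eq_of_nhds, indicator_of_notMem hx]
      simp [gradient_fun_const]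

lemma approx_grad {w : ℂ → ℝ} {S : Set ℂ} {R : ℝ} (hw : ContDiff ℝ 1 w) (hS : MeasurableSet S)
    (hR : S ⊆ closedBall 0 R) {F : Finset ℝ} {T : ℕ → ℝ → ℝ} 
    (hT : ∀ n, ContDiff ℝ 1 (T n)) (hT1 : ∀ n s, 0 ≤ deriv (T n) s ∧ deriv (T n) s ≤ 1)
    (hT2 : ∀ s ∉ F, Tendsto (fun n => deriv (T n) s) atTop (𝓝 1)) :
    Tendsto (fun n => nr (fun x => S.indicator (∇ w) x - S.indicator (fun x => deriv (T n) (w x) • ∇ w x) x)) atTop (𝓝 0) := by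
  have hgc := continuous_grad hw
  obtain ⟨M, hM⟩ := (isCompact_closedBall (0:ℂ) R).exists_bound_of_continuousOn hgc.continuousOn
  have key : Tendsto (fun n => ∫ x, ‖S.indicator (∇ w) x - S.indicator (fun x => deriv (T n) (w x) • ∇ w x) x‖ ^ 2) atTop (𝓝 (∫ x : ℂ, (0:ℝ))) := by
    refine tendsto_integral_of_dominated_convergence (S.indicator fun _ => M ^ 2) ?_ ?_ ?_ ?_
    · intro n
      have h1 : Measurable (fun x => deriv (T n) (w x) • ∇ w x) := by
        have h2 : Continuous (deriv (T n)) := (hT n).continuous_deriv le_rfl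
        exact ((h2.comp hw.continuous).smul hgc).measurable
      exact (((hgc.measurable.indicator hS).sub (h1.indicator hS)).norm.pow_const 2).aestronglyMeasurable
    · exact (integrable_indicator_iff hS).mpr (integrableOn_const ((measure_mono hR).trans_lt measure_closedBall_lt_top).ne)
    · intro n
      filter_upwards with x
      by_cases hx : x ∈ S
      · simp only [indicator_of_mem hx]
        have e : ∇ w x - deriv (T n) (w x) • ∇ w x = (1 - deriv (T n) (w x)) • ∇ w x := by rw [sub_smul, one_smul]
        rw [e, norm_smul, Real.norm_of_nonneg (by positivity)]
        obtain ⟨a, b⟩ := hT1 n (w x)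
        have h3 := hM x (hR hx)
        have : ‖1 - deriv (T n) (w x)‖ ≤ 1 := by rw [Real.norm_eq_abs, abs_le]; constructor <;> linarith
        have h4 : ‖1 - deriv (T n) (w x)‖ * ‖∇ w x‖ ≤ 1 * M := by gcongr
        rw [one_mul] at h4
        gcongr
      · simp [indicator_of_notMem hx]
    · have hz : ∀ᵐ x, ∀ c ∈ F, w x = c → ∇ w x = 0 :=
        (ae_ball_iff F.countable_toSet).mpr fun c _ => grad_zero_level hw c
      filter_upwards [hz] with x hx
      by_cases hxS : x ∈ S
      · simp only [indicator_of_mem hxS]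
        by_cases hF : w x ∈ F
        · simp [hx _ hF rfl]
        · have h1 := (((hT2 _ hF).smul_const (∇ w x)).const_sub (∇ w x)).norm.pow 2
          simpa using h1
      · simp [indicator_of_notMem hxS]
  rw [integral_zero] at key
  have := key.sqrt
  rw [Real.sqrt_zero] at this
  exact this

lemma Sol.closure_zero {W A R φ ε p V C} (h : Sol W A R φ ε p V C) {H : ℂ → ℂ} (hH : MemLp H 2)
    {χ : ℕ → ℂ → ℝ} (hχ : ∀ m, χ m ∈ W) (hl : Tendsto (fun m => nr (fun x => H x - ∇ (χ m) x)) atTop (𝓝 0)) :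
    Tendsto (fun n => ∫ x, inner ℝ (XA A x + ∇ (φ n) x) (H x)) atTop (𝓝 0) := by
  set C' := nr (XA A) + C with hC'
  have hmem : ∀ n, MemLp (fun x => XA A x + ∇ (φ n) x) 2 := fun n => h.memX.add (h.memG (h.mem n))
  have hb : ∀ n, nr (fun x => XA A x + ∇ (φ n) x) ≤ C' := fun n =>
    (nr_add_le h.memX (h.memG (h.mem n))).trans (by rw [hC']; linarith [h.bdd n])
  have est : ∀ n m, |∫ x, inner ℝ (XA A x + ∇ (φ n) x) (H x)| ≤ C' * nr (fun x => H x - ∇ (χ m) x) + ε n * nr (∇ (χ m)) := by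
    intro n m
    have hm := h.memG (hχ m)
    have hd : MemLp (fun x => H x - ∇ (χ m) x) 2 := hH.sub hm
    have e : ∫ x, inner ℝ (XA A x + ∇ (φ n) x) (H x) = (∫ x, inner ℝ (XA A x + ∇ (φ n) x) (H x - ∇ (χ m) x))
        + ∫ x, inner ℝ (XA A x + ∇ (φ n) x) (∇ (χ m) x) := by
      rw [← integral_add (ip_int (hmem n) hd) (ip_int (hmem n) hm)]
      congr 1; ext x
      rw [← inner_add_right]; congr 1; ring
    rw [e]
    refine (abs_add_le _ _).trans (add_le_add ?_ (h.test n _ (hχ m)))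
    refine (ip_le (hmem n) hd).trans ?_
    have := nr_nonneg (fun x => H x - ∇ (χ m) x)
    exact mul_le_mul_of_nonneg_right (hb n) this
  rw [Metric.tendsto_atTop]
  intro η hη
  have h1 : Tendsto (fun m => C' * nr (fun x => H x - ∇ (χ m) x)) atTop (𝓝 0) := by simpa using hl.const_mul C'
  obtain ⟨m, hm⟩ := (h1.eventually (gt_mem_nhds (half_pos hη))).exists
  have h2 : Tendsto (fun n => ε n * nr (∇ (χ m))) atTop (𝓝 0) := by simpa using h.ε0.mul_const (nr (∇ (χ m)))
  obtain ⟨N, hN⟩ := eventually_atTop.mp (h2.eventually (gt_mem_nhds (half_pos hη)))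
  refine ⟨N, fun n hn => ?_⟩
  rw [Real.dist_eq, sub_zero]
  linarith [est n m, hN n hn]

variable {D : Set ℂ} {k : ℕ} {Γ : Fin k → Set ℂ} {x : Fin k → ℂ} {R0 : ℝ}

lemma Bd.exists_c (h : Bd D k Γ x R0) {u : ℂ → ℝ} (hu : ∀ i, ∀ y ∈ Γ i, u y = u (x i)) :
    ∃ c : ℂ → ℝ, LC D c ∧ (∀ y ∈ frontier D, c y = u y) ∧ ∀ y ∈ Dᶜ, c y ∈ Finset.univ.image (fun i => u (x i)) := by
  classical
  obtain ⟨Q, h1, h2, h3, h4, h5, h6⟩ := h.exists_part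
  have hc : ∀ i, ∀ y ∈ Q i, ∑ j, (Q j).indicator (fun _ => u (x j)) y = u (x i) := by
    intro i y hy
    rw [Finset.sum_eq_single i]
    · exact indicator_of_mem hy _
    · intro j _ hj
      exact indicator_of_notMem (fun hc => (disjoint_left.mp (h4 j i hj)) hc hy) _
    · simp
  refine ⟨fun y => ∑ i, (Q i).indicator (fun _ => u (x i)) y, ?_, ?_, ?_⟩
  · intro y hy
    have : ∀ᶠ z in 𝓝[Dᶜ] y, ∀ i, (z ∈ Q i) = (y ∈ Q i) := by
      rw [eventually_all]; exact fun i => h5 i y hy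
    filter_upwards [this] with z hz
    refine Finset.sum_congr rfl fun i _ => ?_
    simp only [indicator_apply, hz i]
  · intro y hy
    rw [h.fr, mem_iUnion] at hy
    obtain ⟨i, hi⟩ := hy
    rw [hu i y hi]
    exact hc i y (h1 i hi)
  · intro y hy
    obtain ⟨i, hi⟩ := h2 y hy
    simp only [hc i y hi]
    exact Finset.mem_image_of_mem (fun i => u (x i)) (Finset.mem_univ i)

lemma preconn_out {R : ℝ} (hR : 0 ≤ R) : IsPreconnected {z : ℂ | R ≤ ‖z‖} := by
  have : {z : ℂ | R ≤ ‖z‖} = (fun q : ℝ × ℝ => (q.1 : ℂ) * Complex.exp (q.2 * Complex.I)) '' (Ici R ×ˢ univ) := by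
    ext z
    simp only [mem_setOf_eq, mem_image, mem_prod, mem_Ici, mem_univ, and_true, Prod.exists]
    constructor
    · intro hz
      exact ⟨‖z‖, z.arg, hz, Complex.norm_mul_exp_arg_mul_I z⟩
    · rintro ⟨a, b, ha, rfl⟩
      rw [norm_mul, Complex.norm_exp_ofReal_mul_I, mul_one, Complex.norm_real]
      exact ha.trans (le_abs_self a)
  rw [this]
  exact ((convex_Ici R).prod convex_univ).isPreconnected.image _ (by fun_prop)

lemma Bd.const_out (h : Bd D k Γ x R0) {α : Type*} {c : ℂ → α} (hc : LC D c) {y z : ℂ} (hy : R0 ≤ ‖y‖) (hz : R0 ≤ ‖z‖) :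
    c y = c z :=
  hc.const_on (preconn_out h.R0pos.le) (fun w hw hwD => by
    have := h.sub hwD
    rw [mem_ball_zero_iff] at this
    have hw' : R0 ≤ ‖w‖ := hw
    linarith) hy hz

end RP

namespace RP
open scoped Topology Gradient

variable {D : Set ℂ} {k : ℕ} {Γ : Fin k → Set ℂ} {x : Fin k → ℂ} {R0 : ℝ}

lemma memLp_ind {A : Set ℂ} (hA : MeasurableSet A) {R : ℝ} (hR : A ⊆ closedBall 0 R) {F : ℂ → ℂ} (hF : Continuous F) :
    MemLp (A.indicator F) 2 := by
  have hfin : volume A ≠ ⊤ := ((measure_mono hR).trans_lt measure_closedBall_lt_top).ne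
  obtain ⟨M, hM⟩ := (isCompact_closedBall (0:ℂ) R).exists_bound_of_continuousOn hF.continuousOn
  have h1 : MemLp (A.indicator (fun _ => (M : ℝ))) 2 :=
    memLp_indicator_const 2 hA _ (Or.inr hfin)
  refine h1.mono ((hF.measurable.indicator hA).aestronglyMeasurable) ?_
  filter_upwards with x
  by_cases hx : x ∈ A
  · simp only [indicator_of_mem hx]
    exact (hM x (hR hx)).trans (le_abs_self _)
  · simp [indicator_of_notMem hx]

section
variable {W : Set (ℂ → ℝ)} {A : Set ℂ} {R : ℝ} {φ : ℕ → ℂ → ℝ} {ε : ℕ → ℝ} {p : ℂ → ℝ} {V C : ℝ}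

lemma TC.ind_supp (h : TC W A R) (y : ℂ) (hy : R < ‖y‖) : A.indicator (1 : ℂ → ℝ) y = 0 := by
  rw [indicator_of_notMem]
  intro hc
  have := h.sub hc
  rw [mem_closedBall_zero_iff] at this
  linarith

lemma Sol.int_A (h : Sol W A R φ ε p V C) :
    Tendsto (fun n => ∫ y, φ n y * A.indicator (1 : ℂ → ℝ) y) atTop (𝓝 (∫ y in A, p y)) := by
  have e : ∀ f : ℂ → ℝ, ∫ y, f y * A.indicator (1 : ℂ → ℝ) y = ∫ y in A, f y := by
    intro f
    rw [← integral_indicator h.mA]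
    congr 1; ext y
    by_cases hy : y ∈ A <;> simp [hy]
  simp only [e]
  rw [tendsto_iff_dist_tendsto_zero]
  refine squeeze_zero (fun _ => dist_nonneg) (fun n => ?_) h.l1conv
  rw [Real.dist_eq, ← integral_sub (h.int (h.mem n)).integrableOn h.pint.integrableOn]
  refine abs_integral_le_integral_abs.trans ?_
  exact setIntegral_le_integral ((h.int (h.mem n)).sub h.pint).abs (Eventually.of_forall fun x => abs_nonneg _)

lemma Sol.lim_pot (h : Sol W A R φ ε p V C) :
    Tendsto (fun n => ∫ y, inner ℝ (XA A y + ∇ (φ n) y)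
      (A.indicator (fun y => (1 / (2 * Real.pi)) • G (A.indicator 1) y) y)) atTop (𝓝 (- dA A p)) := by
  have hpi := Real.pi_pos
  have hfi := ind_integrable h.mA h.finA
  have hGc := continuous_G hfi (ind_abs_le A)
  have hGc' : Continuous (fun y => (1 / (2 * Real.pi)) • G (A.indicator 1) y) := by fun_prop
  have hmG := memLp_ind h.mA h.sub hGc'
  have e : ∀ n, ∫ y, inner ℝ (XA A y + ∇ (φ n) y)
      (A.indicator (fun y => (1 / (2 * Real.pi)) • G (A.indicator 1) y) y) =
      - (volume.real A ^ 2 / (4 * Real.pi)) + ∫ y, φ n y * A.indicator (1 : ℂ → ℝ) y := by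
    intro n
    have h1 : ∫ y, inner ℝ (XA A y) (A.indicator (fun y => (1 / (2 * Real.pi)) • G (A.indicator 1) y) y) =
        - (volume.real A ^ 2 / (4 * Real.pi)) := by
      have e1 : ∀ y, inner ℝ (XA A y) (A.indicator (fun y => (1 / (2 * Real.pi)) • G (A.indicator 1) y) y) =
          (1 / (2 * Real.pi)) * (A.indicator (1 : ℂ → ℝ) y * inner ℝ y (G (A.indicator 1) y)) := by
        intro y
        by_cases hy : y ∈ A
        · simp only [XA, indicator_of_mem hy, inner_smul_right, Pi.one_apply, one_mul]
        · simp [XA, indicator_of_notMem hy]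
      simp only [e1]
      rw [integral_const_mul, virial hfi (ind_abs_le A) h.ind_supp, ind_integral h.mA]
      field_simp; ring
    have h2 : ∫ y, inner ℝ (∇ (φ n) y) (A.indicator (fun y => (1 / (2 * Real.pi)) • G (A.indicator 1) y) y) =
        ∫ y, φ n y * A.indicator (1 : ℂ → ℝ) y := by
      have e1 : ∀ y, inner ℝ (∇ (φ n) y) (A.indicator (fun y => (1 / (2 * Real.pi)) • G (A.indicator 1) y) y) =
          (1 / (2 * Real.pi)) * inner ℝ (∇ (φ n) y) (G (A.indicator 1) y) := by
        intro y
        by_cases hy : y ∈ A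
        · simp only [indicator_of_mem hy, inner_smul_right]
        · simp [indicator_of_notMem hy, h.grad _ (h.mem n) y hy]
      simp only [e1]
      rw [integral_const_mul, weak_poisson (h.c1 _ (h.mem n)) (h.cpt (h.mem n)) hfi (ind_abs_le A)]
      field_simp
    rw [← h1, ← h2, ← integral_add (ip_int h.memX hmG) (ip_int (h.memG (h.mem n)) hmG)]
    simp only [inner_add_left]
  simp only [e]
  have := h.int_A.const_add (- (volume.real A ^ 2 / (4 * Real.pi)))
  refine this.trans (le_of_eq ?_)
  congr 1; unfold dA; ring

/-- test against `1_A (s ∇ψ_A + κ x)` -/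
lemma Sol.lim_both (h : Sol W A R φ ε p V C) (s κ : ℝ) {H : ℂ → ℂ}
    (hH : ∀ y ∈ A, H y = s • ((1 / (2 * Real.pi)) • G (A.indicator 1) y) + κ • y) :
    Tendsto (fun n => ∫ y, inner ℝ (XA A y + ∇ (φ n) y) (A.indicator H y)) atTop (𝓝 (- s * dA A p + κ * V)) := by
  have hfi := ind_integrable h.mA h.finA
  have hGc := continuous_G hfi (ind_abs_le A)
  have hGc' : Continuous (fun y => (1 / (2 * Real.pi)) • G (A.indicator 1) y) := by fun_prop
  have hmG := memLp_ind h.mA h.sub hGc'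
  have h1 := (h.lim_pot.const_mul s).add (h.Vlim.const_mul κ)
  refine (h1.congr ?_).trans (le_of_eq (by congr 1; ring))
  intro n
  have hm : MemLp (fun y => XA A y + ∇ (φ n) y) 2 := h.memX.add (h.memG (h.mem n))
  rw [← integral_const_mul, ← integral_const_mul]
  rw [← integral_add ((ip_int hm hmG).const_mul s) ((ip_int hm h.memX).const_mul κ)]
  congr 1; ext y
  by_cases hy : y ∈ A
  · simp only [XA, indicator_of_mem hy, hH y hy, inner_add_right, inner_smul_right]
  · simp [XA, indicator_of_notMem hy]
end

/-- interior test class -/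
def Wi (D : Set ℂ) (R : ℝ) : Set (ℂ → ℝ) :=
  {φ | ContDiff ℝ 1 φ ∧ (∀ y, R < ‖y‖ → φ y = 0) ∧ ∀ y ∈ Dᶜ, ∃ c : ℝ, φ =ᶠ[𝓝 y] fun _ => c}

lemma Bd.tc (h : Bd D k Γ x R0) : TC (Wi D R0) D R0 where
  hR := h.R0pos
  mA := h.op.measurableSet
  sub := h.sub.trans ball_subset_closedBall
  zero := ⟨contDiff_const, fun _ _ => rfl, fun _ _ => ⟨0, EventuallyEq.rfl⟩⟩
  add := by
    rintro φ ⟨h1, h2, h3⟩ χ ⟨g1, g2, g3⟩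
    refine ⟨h1.add g1, fun y hy => by simp [h2 y hy, g2 y hy], fun y hy => ?_⟩
    obtain ⟨c, hc⟩ := h3 y hy
    obtain ⟨d, hd⟩ := g3 y hy
    exact ⟨c + d, hc.add hd⟩
  smul := by
    rintro a φ ⟨h1, h2, h3⟩
    refine ⟨contDiff_const.mul h1, fun y hy => by simp [h2 y hy], fun y hy => ?_⟩
    obtain ⟨c, hc⟩ := h3 y hy
    refine ⟨a * c, ?_⟩
    filter_upwards [hc] with z hz
    rw [hz]
  comp := by
    rintro T hT hT0 φ ⟨h1, h2, h3⟩
    refine ⟨hT.comp h1, fun y hy => by simp [h2 y hy, hT0], fun y hy => ?_⟩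
    obtain ⟨c, hc⟩ := h3 y hy
    refine ⟨T c, ?_⟩
    filter_upwards [hc] with z hz
    rw [hz]
  c1 := fun φ h => h.1
  supp := fun φ h => h.2.1
  grad := by
    rintro φ ⟨h1, h2, h3⟩ y hy
    obtain ⟨c, hc⟩ := h3 y hy
    rw [hc.gradient.eq_of_nhds]; simp [gradient_fun_const]

/-- gluing for the interior class -/
lemma Bd.glue_int (h : Bd D k Γ x R0) {u : ℂ → ℝ} (hu1 : ContDiff ℝ 1 u) (hu : ∀ i, ∀ y ∈ Γ i, u y = u (x i)) :
    ∃ χ : ℕ → ℂ → ℝ, (∀ n, χ n ∈ Wi D R0) ∧ 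
      Tendsto (fun n => nr (fun y => D.indicator (∇ u) y - ∇ (χ n) y)) atTop (𝓝 0) := by
  classical
  obtain ⟨c, hc, hcu, hcF⟩ := h.exists_c hu
  have hout : ∀ y : ℂ, R0 ≤ ‖y‖ → y ∈ Dᶜ := fun y hy hyD => by
    have := h.sub hyD
    rw [mem_ball_zero_iff] at this
    linarith
  have hRn : R0 ≤ ‖(R0 : ℂ)‖ := by rw [Complex.norm_real]; exact le_abs_self _
  set F := Finset.univ.image (fun i => u (x i)) with hF
  have hFn : F.Nonempty := ⟨_, hcF _ (hout (R0 : ℂ) hRn)⟩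
  obtain ⟨T, T1, T2, T3, T4⟩ := exists_trunc F hFn
  set χ : ℕ → ℂ → ℝ := fun n y => (if y ∈ D then T n (u y) else T n (c y)) - T n (c R0) with hχ
  have loc1 : ∀ n, ∀ y ∈ D, ∃ d : ℝ, χ n =ᶠ[𝓝 y] fun z => T n (u z) + d := by
    intro n y hy
    refine ⟨- T n (c R0), ?_⟩
    filter_upwards [h.op.mem_nhds hy] with z hz
    simp only [hχ, hz, if_true]; ring
  have loc2 : ∀ n, ∀ y ∉ D, ∃ d : ℝ, χ n =ᶠ[𝓝 y] fun _ => d := by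
    intro n y hy
    refine ⟨T n (c y) - T n (c R0), ?_⟩
    have hcy := hc y hy
    rw [eventually_nhdsWithin_iff] at hcy
    by_cases hcl : y ∈ closure D
    · have hfr : y ∈ frontier D := by rw [h.op.frontier_eq]; exact ⟨hcl, hy⟩
      have h3 : ∀ᶠ z in 𝓝 y, T n (u z) = T n (u y) :=
        hu1.continuous.continuousAt.eventually (T3 n (u y) (by rw [← hcu y hfr]; exact hcF y hy))
      filter_upwards [hcy, h3] with z hz hz3
      by_cases hzD : z ∈ D
      · simp only [hχ, hzD, if_true, hz3, hcu y hfr]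
      · simp only [hχ, hzD, if_false]; rw [hz hzD]
    · filter_upwards [hcy, isClosed_closure.isOpen_compl.mem_nhds hcl] with z hz hz'
      have hzD : z ∉ D := fun hc => hz' (subset_closure hc)
      simp only [hχ, hzD, if_false]; rw [hz hzD]
  have gl := fun n => glue_C1 (T1 n) hu1 (loc1 n) (loc2 n)
  refine ⟨χ, fun n => ⟨(gl n).1, fun y hy => ?_, fun y hy => loc2 n y hy⟩, ?_⟩
  · have hyD := hout y hy.le
    have : y ∉ D := hyD
    simp only [hχ, this, if_false]
    rw [h.const_out hc hy.le hRn, sub_self]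
  · simp only [(gl _).2]
    exact approx_grad hu1 h.op.measurableSet (h.sub.trans ball_subset_closedBall) T1 T2 T4

lemma hasGrad_normsq (κ : ℝ) (y : ℂ) : HasGradientAt (fun y : ℂ => κ / 2 * ‖y‖ ^ 2) (κ • y) y := by
  have h1 := hasGrad_mul_const (φ := fun y : ℂ => ‖y‖ ^ 2) (g := (2:ℝ) • y) (x := y) (by
    rw [hasGradientAt_iff_hasFDerivAt]
    refine (hasStrictFDerivAt_norm_sq y).hasFDerivAt.congr_fderiv (ContinuousLinearMap.ext fun w => ?_)
    simp [InnerProductSpace.toDual_apply_apply, inner_smul_left]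
    ring) (κ / 2)
  convert h1 using 1
  rw [smul_smul]; congr 1; ring

def uu (D : Set ℂ) (Ω : ℝ) (y : ℂ) : ℝ := pot (D.indicator 1) y + Ω / 2 * ‖y‖ ^ 2

lemma Bd.fin (h : Bd D k Γ x R0) : volume D ≠ ⊤ := ((measure_mono h.sub).trans_lt measure_ball_lt_top).ne

lemma Bd.hasGrad_uu (h : Bd D k Γ x R0) (Ω : ℝ) (y : ℂ) :
    HasGradientAt (uu D Ω) ((1 / (2 * Real.pi)) • G (D.indicator 1) y + Ω • y) y :=
  hasGrad_add (hasGradientAt_pot (ind_integrable h.op.measurableSet h.fin) (ind_abs_le D) h.tc.ind_supp y)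
    (hasGrad_normsq Ω y)

lemma Bd.contDiff_uu (h : Bd D k Γ x R0) (Ω : ℝ) : ContDiff ℝ 1 (uu D Ω) := by
  refine contDiff_of_grad (h.hasGrad_uu Ω) ?_
  have := continuous_G (ind_integrable h.op.measurableSet h.fin) (ind_abs_le D)
  fun_prop

lemma Bd.int_sol (h : Bd D k Γ x R0) {Ω : ℝ} (hΩ : Ω ≤ 0) (hu : ∀ i, ∀ y ∈ Γ i, uu D Ω y = uu D Ω (x i)) :
    ∃ φ ε p V C, Sol (Wi D R0) D R0 φ ε p V C ∧ dA D p = 0 := by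
  obtain ⟨φ, ε, p, V, C, hs⟩ := h.tc.exists_sol
  refine ⟨φ, ε, p, V, C, hs, ?_⟩
  obtain ⟨χ, hχ, hl⟩ := h.glue_int (h.contDiff_uu Ω) hu
  have hg : ∇ (uu D Ω) = fun y => (1 / (2 * Real.pi)) • G (D.indicator 1) y + Ω • y := gradient_eq (h.hasGrad_uu Ω)
  have hm := memLp_ind hs.mA hs.sub (continuous_grad (h.contDiff_uu Ω))
  have h1 := hs.closure_zero hm hχ hl
  have h2 := hs.lim_both 1 Ω (H := ∇ (uu D Ω)) (fun y hy => by rw [hg]; simp)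
  have h3 := tendsto_nhds_unique h1 h2
  have h4 := hs.d_nonneg
  have h5 := mul_nonpos_of_nonpos_of_nonneg hΩ hs.Vnn
  linarith

end RP

namespace RP
open scoped Topology Gradient

/-- density of the open annular region between (possibly tangent) nested discs -/
lemma annulus_dense {a b : ℂ} {s r : ℝ} (hs : 0 < s) (hsr : s < r) (hab : ‖b - a‖ ≤ r - s) :
    closedBall a r \ ball b s ⊆ closure (ball a r \ closedBall b s) := by
  have step1 : ∀ y, y ∈ closedBall a r → y ∉ closedBall b s → y ∈ closure (ball a r \ closedBall b s) := by
    intro y hy hy'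
    have h1 : y ∈ closure (ball a r) := by rw [closure_ball a (by linarith)]; exact hy
    have := isClosed_closedBall.isOpen_compl.inter_closure (s := (closedBall b s)ᶜ) (t := ball a r) ⟨hy', h1⟩
    rwa [inter_comm] at this
  rintro y ⟨hy, hyb⟩
  by_cases h1 : y ∈ closedBall b s
  · by_cases h2 : y ∈ ball a r
    · have h3 : y ∈ closure (closedBall b s)ᶜ := by
        rw [closure_compl, interior_closedBall b hs.ne']; exact hyb
      exact isOpen_ball.inter_closure ⟨h2, h3⟩
    · rw [mem_closedBall, Complex.dist_eq] at hy h1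
      rw [mem_ball, Complex.dist_eq] at hyb h2
      have e1 : ‖y - a‖ = r := le_antisymm hy (not_lt.mp h2)
      have e2 : ‖y - b‖ = s := le_antisymm h1 (not_lt.mp hyb)
      have key : ∀ v : ℂ, ‖v‖ = r → ‖v - (b - a)‖ ≤ s → ‖b - a‖ • v = ‖v‖ • (b - a) := by
        intro v hv hv'
        rw [← inner_eq_norm_mul_iff_real]
        refine le_antisymm (real_inner_le_norm _ _) ?_
        have := norm_sub_sq_real v (b - a)
        have h5 : ‖v - (b - a)‖ ^ 2 ≤ s ^ 2 := by gcongr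
        have h6 : s ^ 2 ≤ (r - ‖b - a‖) ^ 2 := by
          have : s ≤ r - ‖b - a‖ := by linarith
          gcongr
        rw [hv] at this ⊢
        nlinarith
      have hne : ‖b - a‖ ≠ 0 := by
        intro h0
        rw [norm_eq_zero, sub_eq_zero] at h0
        rw [h0] at e2; linarith
      have k0 := key (y - a) e1 (by rw [sub_sub_sub_cancel_right]; exact e2.le)
      set z : ℕ → ℂ := fun n => a + (y - a) * Complex.exp ((en n : ℝ) * Complex.I) with hz
      have hzc : ∀ n, z n ∈ closure (ball a r \ closedBall b s) := by
        intro n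
        have hn : ‖z n - a‖ = r := by
          simp only [hz, add_sub_cancel_left, norm_mul, Complex.norm_exp_ofReal_mul_I, mul_one, e1]
        refine step1 _ (by rw [mem_closedBall, Complex.dist_eq, hn]) ?_
        intro hc
        rw [mem_closedBall, Complex.dist_eq] at hc
        have k1 := key (z n - a) hn (by rw [sub_sub_sub_cancel_right]; exact hc)
        rw [hn, ← e1, ← k0] at k1
        have k2 := smul_right_injective ℂ hne k1
        simp only [hz, add_sub_cancel_left] at k2
        have hya : y - a ≠ 0 := by rw [← norm_ne_zero_iff, e1]; linarith
        have k3 : Complex.exp ((en n : ℝ) * Complex.I) = 1 := by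
          have : (y - a) * Complex.exp ((en n : ℝ) * Complex.I) = (y - a) * 1 := by rw [k2, mul_one]
          exact mul_left_cancel₀ hya this
        have k4 := congrArg Complex.im k3
        rw [Complex.exp_ofReal_mul_I_im, Complex.one_im] at k4
        have := Real.sin_pos_of_pos_of_le_one (en_pos n) (en_le n)
        linarith
      have hzl : Tendsto z atTop (𝓝 y) := by
        have : Tendsto (fun n => ((en n : ℝ) : ℂ)) atTop (𝓝 ((0 : ℝ) : ℂ)) :=
          (Complex.continuous_ofReal.tendsto 0).comp en_tendsto
        have h2 : Tendsto z atTop (𝓝 (a + (y - a) * Complex.exp (((0:ℝ):ℂ) * Complex.I))) := by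
          refine Tendsto.const_add _ (Tendsto.const_mul _ ?_)
          exact (Complex.continuous_exp.tendsto _).comp (this.mul_const _)
        simpa using h2
      exact isClosed_closure.mem_of_tendsto hzl (Eventually.of_forall hzc)
  · exact step1 y hy h1

lemma null_open {U D : Set ℂ} (hU : IsOpen U) (hD : IsOpen D) (h : volume (D ∩ U) = 0) : D ∩ U = ∅ :=
  (hD.inter hU).measure_eq_zero_iff volume |>.mp h

lemma ind_ae {A B : Set ℂ} (h : A.indicator (1 : ℂ → ℝ) =ᵐ[volume] B.indicator 1) : A =ᵐ[volume] B := by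
  filter_upwards [h] with y hy
  apply propext
  change y ∈ A ↔ y ∈ B
  by_cases h1 : y ∈ A <;> by_cases h2 : y ∈ B <;> simp [h1, h2] at hy ⊢

/-- a.e. nested discs are nested -/
lemma nested_of_ae {a b : ℂ} {s r : ℝ} (hs : 0 < s) (h : volume (ball b s \ ball a r) = 0) :
    0 < r ∧ ball b s ⊆ closedBall a r ∧ ‖b - a‖ ≤ r - s := by
  have hr : 0 < r := by
    by_contra hc
    rw [ball_eq_empty.mpr (not_lt.mp hc), diff_empty] at h
    exact (measure_ball_pos volume b hs).ne' h
  have h1 : ball b s ∩ (closedBall a r)ᶜ = ∅ := by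
    refine null_open isClosed_closedBall.isOpen_compl isOpen_ball (measure_mono_null ?_ h)
    rintro y ⟨hy, hy'⟩
    exact ⟨hy, fun hc => hy' (ball_subset_closedBall hc)⟩
  have h2 : ball b s ⊆ closedBall a r := by
    intro y hy
    by_contra hc
    have : y ∈ ball b s ∩ (closedBall a r)ᶜ := ⟨hy, hc⟩
    rw [h1] at this; exact this
  refine ⟨hr, h2, ?_⟩
  have h3 : closedBall b s ⊆ closedBall a r := by
    rw [← closure_ball b hs.ne']; exact closure_minimal h2 isClosed_closedBall
  by_cases hba : b = a
  · subst hba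
    have : b + (s : ℂ) ∈ closedBall b r := h3 (by
      rw [mem_closedBall, Complex.dist_eq, add_sub_cancel_left, Complex.norm_real, Real.norm_of_nonneg hs.le])
    rw [mem_closedBall, Complex.dist_eq, add_sub_cancel_left, Complex.norm_real, Real.norm_of_nonneg hs.le] at this
    simp; linarith
  · have hn : 0 < ‖b - a‖ := norm_pos_iff.mpr (sub_ne_zero.mpr hba)
    have : b + (s / ‖b - a‖) • (b - a) ∈ closedBall a r := h3 (by
      rw [mem_closedBall, Complex.dist_eq, add_sub_cancel_left, norm_smul, Real.norm_of_nonneg (by positivity),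
        div_mul_cancel₀ _ hn.ne'])
    rw [mem_closedBall, Complex.dist_eq] at this
    have e : b + (s / ‖b - a‖) • (b - a) - a = (1 + s / ‖b - a‖) • (b - a) := by
      rw [add_smul, one_smul]; ring
    rw [e, norm_smul, Real.norm_of_nonneg (by positivity), add_mul, one_mul, div_mul_cancel₀ _ hn.ne'] at this
    linarith

/-- a connected open set cannot be separated by an empty shell -/
lemma shell_empty {D E E' : Set ℂ} (hD : IsOpen D) (hc : IsConnected D) {a b : ℂ} {s r : ℝ}
    (hE : E =ᵐ[volume] ball a r) (hE' : E' =ᵐ[volume] ball b s) (hEE : E' ⊆ E)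
    (hpos : volume (E \ E') ≠ 0) (hs : volume (D ∩ (E \ E')) = 0) (h1 : volume (D ∩ E') ≠ 0)
    (h2 : volume (D \ E) ≠ 0) : False := by
  have hs0 : 0 < s := by
    by_contra hc
    rw [ball_eq_empty.mpr (not_lt.mp hc)] at hE'
    exact h1 (measure_mono_null inter_subset_right (by simpa using measure_congr hE'))
  have hd : (ball b s \ ball a r : Set ℂ) =ᵐ[volume] (E' \ E : Set ℂ) := hE'.symm.diff hE.symm
  have hd0 : volume (ball b s \ ball a r) = 0 := by
    rw [measure_congr hd, diff_eq_empty.mpr hEE, measure_empty]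
  obtain ⟨hr, hsub, hab⟩ := nested_of_ae hs0 hd0
  have hsr : s < r := by
    by_contra hc
    have : b = a := by
      have : ‖b - a‖ ≤ 0 := by linarith
      rw [norm_le_zero_iff, sub_eq_zero] at this; exact this
    subst this
    have : volume (E \ E') = volume (ball b r \ ball b s) := measure_congr (hE.diff hE')
    rw [diff_eq_empty.mpr (ball_subset_ball (not_lt.mp hc)), measure_empty] at this
    exact hpos this
  have hU : D ∩ (ball a r \ closedBall b s) = ∅ := by
    refine null_open (isOpen_ball.sdiff isClosed_closedBall) hD ?_
    have e : (D ∩ (ball a r \ ball b s) : Set ℂ) =ᵐ[volume] (D ∩ (E \ E') : Set ℂ) :=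
      (ae_eq_refl D).inter (hE.symm.diff hE'.symm)
    have e2 : volume (D ∩ (ball a r \ ball b s)) = 0 := by rw [measure_congr e, hs]
    exact measure_mono_null (inter_subset_inter_right _ (diff_subset_diff_right ball_subset_closedBall)) e2
  have hcov : D ⊆ ball b s ∪ (closedBall a r)ᶜ := by
    intro y hy
    by_contra hcc
    rw [mem_union, not_or, mem_compl_iff, not_not] at hcc
    have := annulus_dense hs0 hsr hab ⟨hcc.2, hcc.1⟩
    rw [_root_.mem_closure_iff] at this
    have h := this D hD hy
    rw [hU] at h
    exact h.ne_empty rfl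
  have hdis : ball b s ∩ (closedBall a r)ᶜ = ∅ := by
    ext y; simp only [mem_inter_iff, mem_compl_iff, mem_empty_iff_false, iff_false, not_and, not_not]
    exact fun hy => hsub hy
  have n1 : (D ∩ ball b s).Nonempty := by
    have : volume (D ∩ ball b s) ≠ 0 := by rwa [measure_congr ((ae_eq_refl D).inter hE'.symm)]
    exact nonempty_of_measure_ne_zero this
  have n2 : (D ∩ (closedBall a r)ᶜ).Nonempty := by
    have : volume (D \ ball a r) ≠ 0 := by rwa [measure_congr ((ae_eq_refl D).diff hE.symm)]
    have h3 : volume (D ∩ (closedBall a r)ᶜ) ≠ 0 := by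
      intro h0
      refine this (measure_mono_null (t := (D ∩ (closedBall a r)ᶜ) ∪ sphere a r) ?_ ?_)
      · rintro y ⟨hy, hy'⟩
        by_cases hyc : y ∈ closedBall a r
        · right
          rw [mem_sphere]; rw [mem_ball, not_lt] at hy'
          exact le_antisymm hyc hy'
        · exact Or.inl ⟨hy, hyc⟩
      · exact measure_union_null h0 (Measure.addHaar_sphere volume a r)
    exact nonempty_of_measure_ne_zero h3
  obtain ⟨y, hy⟩ := hc.isPreconnected _ _ isOpen_ball isClosed_closedBall.isOpen_compl hcov n1 n2
  have : y ∈ ball b s ∩ (closedBall a r)ᶜ := hy.2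
  rw [hdis] at this; exact this

end RP

namespace RP
open scoped Topology Gradient

lemma meas_lim {S : ℕ → Set ℂ} {S' B : Set ℂ} (hS : ∀ n, MeasurableSet (S n)) (hB : MeasurableSet B)
    (hf : volume B ≠ ⊤) (hsub : ∀ n, S n ⊆ B) (hl : ∀ y, ∀ᶠ n in atTop, y ∈ S n ↔ y ∈ S') :
    Tendsto (fun n => volume.real (S n)) atTop (𝓝 (volume.real S')) := by
  have h1 := tendsto_measure_of_tendsto_indicator (μ := volume) atTop hS hB hf (Eventually.of_forall hsub) hl
  have hS' : S' ⊆ B := by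
    intro y hy
    obtain ⟨n, hn⟩ := (hl y).exists
    exact hsub n (hn.mpr hy)
  exact (ENNReal.tendsto_toReal (measure_ne_top_of_subset hS' hf)).comp h1

lemma ev_right (p : ℂ → ℝ) (t : ℝ) {e : ℕ → ℝ} (he : ∀ n, 0 ≤ e n) (hl : Tendsto e atTop (𝓝 0)) (y : ℂ) :
    ∀ᶠ n in atTop, t + e n < p y ↔ t < p y := by
  by_cases h : t < p y
  · filter_upwards [hl.eventually (gt_mem_nhds (show (0:ℝ) < p y - t by linarith))] with n hn
    constructor <;> intro _ <;> linarith
  · filter_upwards with n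
    have := he n
    constructor <;> intro _ <;> linarith

lemma ev_left (p : ℂ → ℝ) (t : ℝ) {e : ℕ → ℝ} (he : ∀ n, 0 < e n) (hl : Tendsto e atTop (𝓝 0)) (y : ℂ) :
    ∀ᶠ n in atTop, t - e n < p y ↔ t ≤ p y := by
  by_cases h : t ≤ p y
  · filter_upwards with n
    have := he n
    constructor <;> intro _ <;> linarith
  · filter_upwards [hl.eventually (gt_mem_nhds (show (0:ℝ) < t - p y by linarith))] with n hn
    constructor <;> intro _ <;> linarith

lemma ind_diff_int {S S' : Set ℂ} (hS : MeasurableSet S) (hS' : MeasurableSet S') (hf : volume S ≠ ⊤) (h : S' ⊆ S) :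
    ∫ y, |S.indicator (1 : ℂ → ℝ) y - S'.indicator 1 y| = volume.real S - volume.real S' := by
  rw [← ind_integral hS, ← ind_integral hS', ← integral_sub (ind_integrable hS hf)
    (ind_integrable hS' (measure_ne_top_of_subset h hf))]
  congr 1; ext y
  refine abs_of_nonneg ?_
  by_cases h1 : y ∈ S'
  · simp [h1, h h1]
  · simp only [indicator_of_notMem h1, sub_zero]; exact ind_nonneg S y

section
variable {W : Set (ℂ → ℝ)} {A : Set ℂ} {R : ℝ} {φ : ℕ → ℂ → ℝ} {ε : ℕ → ℝ} {p : ℂ → ℝ} {V C : ℝ}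

lemma Sol.zero_mu (h : Sol W A R φ ε p V C) (hd : dA A p = 0) {t : ℝ} (ht : 0 ≤ t)
    (ht' : t < volume.real A / (2 * Real.pi)) : 0 < mu p t := by
  rcases (mu_nonneg (p := p) t).eq_or_lt with h0 | h0
  · have := h.top ht h0.symm ht'.le
    rw [hd, mul_zero] at this
    rw [lt_div_iff₀ (by positivity)] at ht'
    nlinarith
  · exact h0

lemma Sol.zero_m (h : Sol W A R φ ε p V C) (hd : dA A p = 0) {t : ℝ} (ht : 0 ≤ t)
    (ht' : t < volume.real A / (2 * Real.pi)) : mA A p t = volume.real A - 2 * Real.pi * t := by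
  set ts := volume.real A / (2 * Real.pi)
  have h1 := h.NA_nonneg' ht ht'.le
  have h2 := h.d_ge (a := t) (b := (t + ts) / 2) (c := NA A p t) ht (by linarith) (by linarith) (fun s h1 h2 =>
    h.NA_mono ht h1 (h.zero_mu hd (by linarith) (by change s < ts; linarith)))
  rw [hd] at h2
  have h3 : NA A p t ≤ 0 := by
    by_contra hc
    have : 0 < NA A p t * ((t + ts) / 2 - t) := mul_pos (not_le.mp hc) (by linarith)
    linarith
  unfold NA at h1 h3
  linarith

lemma Sol.zero_disc (h : Sol W A R φ ε p V C) (hd : dA A p = 0) {t : ℝ} (ht : 0 ≤ t)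
    (ht' : t < volume.real A / (2 * Real.pi)) : ∃ (a : ℂ) (s : ℝ), 0 ≤ s ∧ {y | t < p y} =ᵐ[volume] ball a s := by
  set ts := volume.real A / (2 * Real.pi) with hts
  have hmu := h.zero_mu hd ht ht'
  set a := Real.sqrt (mu p t / Real.pi) with ha
  have ha0 : 0 < a := Real.sqrt_pos.mpr (div_pos hmu Real.pi_pos)
  have ha2 : Real.pi * a ^ 2 = mu p t := by
    rw [ha, Real.sq_sqrt (div_pos hmu Real.pi_pos).le]; field_simp
  set e : ℕ → ℝ := fun n => (ts - t) / 2 * en n with he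
  have he0 : ∀ n, 0 < e n := fun n => mul_pos (by linarith) (en_pos n)
  have hel : Tendsto e atTop (𝓝 0) := by simpa using en_tendsto.const_mul ((ts - t) / 2)
  have hets : ∀ n, t + e n < ts := fun n => by
    have : e n ≤ (ts - t) / 2 * 1 := mul_le_mul_of_nonneg_left (en_le n) (by linarith)
    linarith
  obtain ⟨c, hc⟩ := near_disc (fun _ => h) (fun _ => t) e (fun _ => 0) (fun _ => ht) he0 tendsto_const_nhds
    (fun n => by
      rw [h.zero_m hd ht ht', h.zero_m hd (by linarith [he0 n]) (hets n)]
      linarith) ha0 (by rw [ha2]; exact tendsto_const_nhds) (by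
      rw [ha2]
      exact meas_lim (B := {y | t < p y}) (fun n => h.meas _) (h.meas t) (h.fin ht)
        (fun n y (hy : t + e n < p y) => show t < p y by linarith [he0 n])
        (fun y => ev_right p t (fun n => (he0 n).le) hel y))
  obtain ⟨a', s, hs, hae⟩ := one_disc (h.meas t) (h.subb ht) hmu (fun _ => ha0.le) (fun _ => le_rfl) hc
  exact ⟨a', s, hs, ind_ae hae⟩

lemma Sol.zero_disc' (h : Sol W A R φ ε p V C) (hd : dA A p = 0) {t : ℝ} (ht : 0 < t)
    (ht' : t ≤ volume.real A / (2 * Real.pi)) :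
    volume.real (A ∩ {y | t ≤ p y}) = volume.real A - 2 * Real.pi * t ∧
    ∃ (a : ℂ) (s : ℝ), 0 ≤ s ∧ {y | t ≤ p y} =ᵐ[volume] ball a s := by
  set ts := volume.real A / (2 * Real.pi) with hts
  have hpi := Real.pi_pos
  set e : ℕ → ℝ := fun n => t * en n with he
  have he0 : ∀ n, 0 < e n := fun n => mul_pos ht (en_pos n)
  have het : ∀ n, 0 ≤ t - e n := fun n => by
    have : e n ≤ t * 1 := mul_le_mul_of_nonneg_left (en_le n) (by linarith)
    linarith
  have hel : Tendsto e atTop (𝓝 0) := by simpa using en_tendsto.const_mul t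
  have hlt : ∀ n, t - e n < ts := fun n => by linarith [he0 n]
  have hmm : MeasurableSet {y | t ≤ p y} := measurableSet_le measurable_const h.pmeas
  have hsub : {y | t ≤ p y} ⊆ {y | 0 < p y} := fun y (hy : t ≤ p y) => show 0 < p y by linarith
  constructor
  · have h1 := meas_lim (S := fun n => A ∩ {y | t - e n < p y}) (S' := A ∩ {y | t ≤ p y}) (B := A)
      (fun n => h.mA.inter (h.meas _)) h.mA h.finA (fun n => inter_subset_left) (fun y => by
        filter_upwards [ev_left p t he0 hel y] with n hn
        simp only [mem_inter_iff, mem_setOf_eq, hn])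
    have h2 : Tendsto (fun n => volume.real (A ∩ {y | t - e n < p y})) atTop (𝓝 (volume.real A - 2 * Real.pi * (t - 0))) := by
      refine (((tendsto_const_nhds (x := t)).sub hel).const_mul (2 * Real.pi) |>.const_sub (volume.real A)).congr ?_
      intro n
      exact (h.zero_m hd (het n) (hlt n)).symm
    rw [sub_zero] at h2
    exact tendsto_nhds_unique h1 h2
  · rcases (measureReal_nonneg (μ := volume) (s := {y | t ≤ p y})).eq_or_lt with h0 | h0
    · refine ⟨0, 0, le_rfl, ?_⟩
      rw [ball_zero]
      refine ae_eq_empty.mpr ?_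
      exact (measureReal_eq_zero_iff (measure_ne_top_of_subset hsub (h.fin le_rfl))).mp h0.symm
    · choose c r hr hcr using fun n => h.zero_disc hd (het n) (hlt n)
      have hvol : ∀ n, Real.pi * r n ^ 2 = mu p (t - e n) := fun n => by
        rw [← volume_real_ball (c n) (r n) (hr n)]
        exact measureReal_congr (hcr n).symm
      have hrb : ∀ n, r n ≤ Real.sqrt (mu p 0 / Real.pi) := fun n => by
        refine Real.le_sqrt_of_sq_le ?_
        rw [le_div_iff₀ hpi, mul_comm, hvol n]
        exact h.mu_anti le_rfl (het n)
      have hl : Tendsto (fun n => ∫ y, |(ball (c n) (r n)).indicator (1 : ℂ → ℝ) y - {y | t ≤ p y}.indicator 1 y|) atTop (𝓝 0) := by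
        have h1 := meas_lim (S := fun n => {y | t - e n < p y}) (S' := {y | t ≤ p y}) (B := {y | 0 < p y} ∪ closedBall 0 R)
          (fun n => h.meas _) ((h.meas 0).union measurableSet_closedBall) (measure_union_lt_top (h.fin le_rfl).lt_top measure_closedBall_lt_top).ne
          (fun n => (h.subb (het n)).trans subset_union_right) (fun y => ev_left p t he0 hel y)
        have h2 := h1.sub_const (volume.real {y | t ≤ p y})
        rw [sub_self] at h2
        refine h2.congr fun n => ?_
        rw [← ind_diff_int (h.meas _) hmm (h.fin (het n)) (fun y (hy : t ≤ p y) => show t - e n < p y by linarith [he0 n])]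
        refine integral_congr_ae ?_
        filter_upwards [indicator_ae_eq_of_ae_eq_set (f := (1 : ℂ → ℝ)) (hcr n)] with y hy
        rw [hy]
      obtain ⟨a', s, hs, hae⟩ := one_disc hmm (hsub.trans (h.subb le_rfl)) h0 hr hrb hl
      exact ⟨a', s, hs, ind_ae hae⟩
end

variable {D : Set ℂ} {k : ℕ} {Γ : Fin k → Set ℂ} {x : Fin k → ℂ} {R0 : ℝ}

lemma Bd.vol_pos (h : Bd D k Γ x R0) : 0 < volume.real D :=
  ENNReal.toReal_pos (h.op.measure_pos volume h.conn.nonempty).ne' h.fin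

lemma Bd.p_vals (h : Bd D k Γ x R0) {φ ε p V C} (hs : Sol (Wi D R0) D R0 φ ε p V C) :
    ∃ F : Finset ℝ, ∀ᵐ y, y ∈ Dᶜ → p y ∈ F := by
  classical
  obtain ⟨Q, h1, h2, h3, h4, h5, h6⟩ := h.exists_part
  refine ⟨Finset.univ.image fun i => limUnder atTop (fun n => φ n (x i)), ?_⟩
  filter_upwards [hs.aeconv] with y hy hyD
  obtain ⟨i, hi⟩ := h2 y hyD
  rw [Finset.mem_image]
  refine ⟨i, Finset.mem_univ i, ?_⟩
  refine Tendsto.limUnder_eq (hy.congr fun n => ?_)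
  refine h6 (φ n) ?_ i y hi
  intro z hz
  obtain ⟨c, hc⟩ := (hs.mem n).2.2 z hz
  have : ∀ᶠ w in 𝓝[Dᶜ] z, φ n w = c := hc.filter_mono nhdsWithin_le_nhds
  have hz2 := hc.eq_of_nhds
  filter_upwards [this] with w hw
  rw [hw, hz2]

theorem Bd.int_final (h : Bd D k Γ x R0) {Ω : ℝ} (hΩ : Ω ≤ 0) (hu : ∀ i, ∀ y ∈ Γ i, uu D Ω y = uu D Ω (x i)) :
    ∃ (a₁ : ℂ) (s₁ : ℝ) (a₂ : ℂ) (s₂ : ℝ), 0 ≤ s₁ ∧ 0 ≤ s₂ ∧ D.indicator (1 : ℂ → ℝ) =ᵐ[volume]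
      fun x => (ball a₁ s₁).indicator (1 : ℂ → ℝ) x - (ball a₂ s₂).indicator 1 x := by
  obtain ⟨φ, ε, p, V, C, hs, hd⟩ := h.int_sol hΩ hu
  have hpi := Real.pi_pos
  have hL := h.vol_pos
  set L := volume.real D with hLd
  set ts := L / (2 * Real.pi) with hts
  have hts0 : 0 < ts := by positivity
  obtain ⟨F, hF⟩ := h.p_vals hs
  have hmeq : ∀ t, MeasurableSet {y | p y = t} := fun t => hs.pmeas (measurableSet_singleton t)
  have hmle : ∀ t, MeasurableSet {y | t ≤ p y} := fun t => measurableSet_le measurable_const hs.pmeas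
  have null : ∀ t, 0 < t → t < ts → volume {y | p y = t} = 0 := by
    intro t ht ht'
    by_contra hne
    obtain ⟨m1, a, r, hr, hE⟩ := hs.zero_disc' hd ht ht'.le
    obtain ⟨b, s, hsr, hE'⟩ := hs.zero_disc hd ht.le ht'
    have m2 := hs.zero_m hd ht.le ht'
    have ediff : {y | t ≤ p y} \ {y | t < p y} = {y | p y = t} := by
      ext y; simp only [mem_diff, mem_setOf_eq, not_lt]
      exact ⟨fun hh => le_antisymm hh.2 hh.1, fun hh => ⟨hh.ge, hh.le⟩⟩
    have hlt : 2 * Real.pi * t < L := by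
      rw [hts, lt_div_iff₀ (by positivity)] at ht'; linarith
    refine shell_empty h.op h.conn hE hE' (fun y (hy : t < p y) => show t ≤ p y from hy.le) (by rw [ediff]; exact hne) ?_ ?_ ?_
    · have e1 : D ∩ ({y | t ≤ p y} \ {y | t < p y}) = (D ∩ {y | t ≤ p y}) \ (D ∩ {y | t < p y}) := by
        ext y; simp only [mem_inter_iff, mem_diff]; tauto
      have hf1 : volume (D ∩ {y | t ≤ p y}) ≠ ⊤ := measure_ne_top_of_subset inter_subset_left h.fin
      have hss : D ∩ {y | t < p y} ⊆ D ∩ {y | t ≤ p y} :=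
        inter_subset_inter_right _ fun y (hy : t < p y) => show t ≤ p y from hy.le
      rw [e1, ← measureReal_eq_zero_iff (measure_ne_top_of_subset diff_subset hf1),
        measureReal_diff hss
          (h.op.measurableSet.inter (hs.meas t)) hf1, m1]
      unfold mA at m2
      rw [m2]; ring
    · intro h0
      unfold mA at m2
      rw [measureReal_def, h0] at m2
      simp at m2; linarith
    · intro h0
      have h5 := measureReal_diff_add_inter (μ := volume) (s := D) (hmle t) h.fin
      rw [measureReal_def, h0, m1] at h5
      simp at h5
      have : 0 < 2 * Real.pi * t := by positivity
      linarith
  obtain ⟨a, r, hr, hE⟩ := hs.zero_disc hd le_rfl hts0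
  obtain ⟨m1, b, s, hsr, hE'⟩ := hs.zero_disc' hd hts0 le_rfl
  refine ⟨a, r, b, s, hr, hsr, ?_⟩
  have n1 : ∀ᵐ y, ∀ t ∈ F, 0 < t → t < ts → p y ≠ t := by
    refine (ae_ball_iff F.countable_toSet).mpr fun t _ => ?_
    by_cases ht : 0 < t ∧ t < ts
    · have := null t ht.1 ht.2
      rw [measure_eq_zero_iff_ae_notMem] at this
      filter_upwards [this] with y hy _ _
      exact hy
    · filter_upwards with y h1 h2
      exact absurd ⟨h1, h2⟩ ht
  have n2 : ∀ᵐ y, y ∈ D → 0 < p y := by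
    have m0 := hs.zero_m hd le_rfl hts0
    unfold mA at m0
    rw [mul_zero, sub_zero] at m0
    have h5 := measureReal_diff_add_inter (μ := volume) (s := D) (hs.meas 0) h.fin
    rw [m0] at h5
    have h6 : volume.real (D \ {y | 0 < p y}) = 0 := by linarith
    rw [measureReal_eq_zero_iff (measure_ne_top_of_subset diff_subset h.fin), measure_eq_zero_iff_ae_notMem] at h6
    filter_upwards [h6] with y hy hyD
    by_contra hc
    exact hy ⟨hyD, hc⟩
  have n3 : ∀ᵐ y, y ∈ D → p y < ts := by
    have e : volume.real D - 2 * Real.pi * (volume.real D / (2 * Real.pi)) = 0 := by field_simp; ring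
    have m1' := m1.trans e
    rw [measureReal_eq_zero_iff (measure_ne_top_of_subset inter_subset_left h.fin), measure_eq_zero_iff_ae_notMem] at m1'
    filter_upwards [m1'] with y hy hyD
    by_contra hc
    exact hy ⟨hyD, not_lt.mp hc⟩
  filter_upwards [n1, n2, n3, hF, indicator_ae_eq_of_ae_eq_set (f := (1 : ℂ → ℝ)) hE,
    indicator_ae_eq_of_ae_eq_set (f := (1 : ℂ → ℝ)) hE'] with y h1 h2 h3 h4 h5 h6
  rw [← h5, ← h6]
  by_cases hy : y ∈ D
  · have a1 := h2 hy
    have a2 := h3 hy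
    have a3 : ¬ ts ≤ p y := not_le.mpr a2
    rw [indicator_of_mem hy, indicator_of_mem (show y ∈ {y | 0 < p y} from a1), indicator_of_notMem (show y ∉ {y | ts ≤ p y} from a3)]
    simp
  · have a1 := h4 hy
    have a2 := h1 _ a1
    rw [indicator_of_notMem hy]
    by_cases hp : 0 < p y
    · have hp2 : ts ≤ p y := by
        by_contra hc
        exact a2 hp (not_le.mp hc) rfl
      rw [indicator_of_mem (show y ∈ {y | 0 < p y} from hp), indicator_of_mem (show y ∈ {y | ts ≤ p y} from hp2)]
      simp
    · have hp2 : ¬ ts ≤ p y := fun hc => hp (by linarith)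
      rw [indicator_of_notMem (show y ∉ {y | 0 < p y} from hp), indicator_of_notMem (show y ∉ {y | ts ≤ p y} from hp2)]
      simp

end RP

namespace RP
open scoped Topology Gradient

section
variable {W : Set (ℂ → ℝ)} {A : Set ℂ} {R : ℝ} {φ : ℕ → ℂ → ℝ} {ε : ℕ → ℝ} {p : ℂ → ℝ} {V C : ℝ}

lemma Sol.mA_max (h : Sol W A R φ ε p V C) {t : ℝ} (ht : 0 ≤ t) :
    mA A p t ≤ max 0 (volume.real A - 2 * Real.pi * t) := by
  rcases (mu_nonneg (p := p) t).eq_or_lt with h0 | h0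
  · exact le_max_of_le_left ((h.mA_le_mu ht).trans h0.symm.le)
  · refine le_max_of_le_right ?_
    have := h.NA_nonneg ht h0
    unfold NA at this; linarith

/-- the exterior configuration -/
structure Ext (D A : Set ℂ) (p : ℂ → ℝ) (P : ℝ) : Prop where
  mD : MeasurableSet D
  fD : volume D ≠ ⊤
  dis : Disjoint A D
  cov : ∀ y, y ∉ A → y ∉ D → p y ≤ 0
  eq : ∀ᵐ y, y ∈ D → p y = P

variable {D : Set ℂ} {P : ℝ}

lemma Ext.ae_lo (e : Ext D A p P) {t : ℝ} (ht : 0 ≤ t) (htP : t < P) :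
    {y | t < p y} =ᵐ[volume] ((A ∩ {y | t < p y}) ∪ D : Set ℂ) := by
  filter_upwards [e.eq] with y hy
  apply propext
  change t < p y ↔ (y ∈ A ∧ t < p y) ∨ y ∈ D
  by_cases h1 : y ∈ D
  · simp [h1, hy h1, htP]
  · by_cases h2 : y ∈ A
    · simp [h1, h2]
    · have := e.cov y h2 h1
      simp only [h1, h2, false_and, or_self, iff_false, not_lt]; linarith

lemma Ext.ae_hi (e : Ext D A p P) {t : ℝ} (ht : 0 ≤ t) (htP : P ≤ t) :
    {y | t < p y} =ᵐ[volume] (A ∩ {y | t < p y} : Set ℂ) := by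
  filter_upwards [e.eq] with y hy
  apply propext
  change t < p y ↔ y ∈ A ∧ t < p y
  by_cases h1 : y ∈ D
  · have : y ∉ A := fun h2 => disjoint_left.mp e.dis h2 h1
    simp only [this, false_and, iff_false, not_lt, hy h1]; exact htP
  · by_cases h2 : y ∈ A
    · simp [h2]
    · have := e.cov y h2 h1
      simp only [h2, false_and, iff_false, not_lt]; linarith

lemma Ext.mu_lo (e : Ext D A p P) (hs : Sol W A R φ ε p V C) {t : ℝ} (ht : 0 ≤ t) (htP : t < P) :
    mu p t = mA A p t + volume.real D := by
  unfold mu mA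
  rw [measureReal_congr (e.ae_lo ht htP), measureReal_union (e.dis.mono_left inter_subset_left) e.mD
    (measure_ne_top_of_subset inter_subset_left hs.finA) e.fD]

lemma Ext.mu_hi (e : Ext D A p P) {t : ℝ} (ht : 0 ≤ t) (htP : P ≤ t) : mu p t = mA A p t := by
  unfold mu mA
  rw [measureReal_congr (e.ae_hi ht htP)]

/-- `{t<p}` versus `D` -/
lemma Ext.int_lo (e : Ext D A p P) (hs : Sol W A R φ ε p V C) {t : ℝ} (ht : 0 ≤ t) (htP : t < P) :
    ∫ y, |{y | t < p y}.indicator (1 : ℂ → ℝ) y - D.indicator 1 y| = mA A p t := by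
  have hm : MeasurableSet (A ∩ {y | t < p y}) := hs.mA.inter (hs.meas t)
  have := ind_integral hm
  unfold mA
  rw [← this]
  refine integral_congr_ae ?_
  filter_upwards [indicator_ae_eq_of_ae_eq_set (f := (1 : ℂ → ℝ)) (e.ae_lo ht htP)] with y hy
  rw [hy, indicator_union_of_disjoint (e.dis.mono_left inter_subset_left)]
  simp only [add_sub_cancel_right]
  exact abs_of_nonneg (ind_nonneg _ y)

lemma Ext.int_hi (e : Ext D A p P) (hs : Sol W A R φ ε p V C) {t : ℝ} (ht : 0 ≤ t) (htP : t < P) :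
    ∫ y, |{y | t < p y}.indicator (1 : ℂ → ℝ) y - {y | P < p y}.indicator 1 y - D.indicator 1 y| = mA A p t - mA A p P := by
  have hm : MeasurableSet (A ∩ {y | t < p y}) := hs.mA.inter (hs.meas t)
  have hm' : MeasurableSet (A ∩ {y | P < p y}) := hs.mA.inter (hs.meas P)
  have hsub : A ∩ {y | P < p y} ⊆ A ∩ {y | t < p y} :=
    inter_subset_inter_right _ fun y (hy : P < p y) => show t < p y by linarith
  unfold mA
  rw [← ind_diff_int hm hm' (measure_ne_top_of_subset inter_subset_left hs.finA) hsub]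
  refine integral_congr_ae ?_
  filter_upwards [indicator_ae_eq_of_ae_eq_set (f := (1 : ℂ → ℝ)) (e.ae_lo ht htP),
    indicator_ae_eq_of_ae_eq_set (f := (1 : ℂ → ℝ)) (e.ae_hi (by linarith) le_rfl)] with y hy hy'
  rw [hy, hy', indicator_union_of_disjoint (e.dis.mono_left inter_subset_left)]
  simp only
  congr 1; ring
end

lemma int_tri {f g k : ℂ → ℝ} (hf : Integrable f) (hg : Integrable g) (hk : Integrable k) :
    ∫ y, |f y - k y| ≤ (∫ y, |f y - g y|) + ∫ y, |g y - k y| := by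
  rw [← integral_add (f := fun y => |f y - g y|) (g := fun y => |g y - k y|) (hf.sub hg).abs (hg.sub hk).abs]
  exact integral_mono (hf.sub hk).abs ((hf.sub hg).abs.add (hg.sub hk).abs) fun y => abs_sub_le _ _ _

theorem ext_core {D : Set ℂ} {R0 : ℝ} (hDR : D ⊆ closedBall 0 R0) (hDpos : 0 < volume.real D)
    {W : ℕ → Set (ℂ → ℝ)} {A : ℕ → Set ℂ} {R : ℕ → ℝ} {φ : ℕ → ℕ → ℂ → ℝ} {ε : ℕ → ℕ → ℝ}
    {p : ℕ → ℂ → ℝ} {V C P h δ : ℕ → ℝ} {M : ℝ}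
    (hs : ∀ n, Sol (W n) (A n) (R n) (φ n) (ε n) (p n) (V n) (C n))
    (he : ∀ n, Ext D (A n) (p n) (P n)) (h0 : ∀ n, 0 < h n) (h1 : ∀ n, h n ≤ 1) (hl : Tendsto h atTop (𝓝 0))
    (hP : ∀ n, 3 ≤ P n) (hδ : Tendsto δ atTop (𝓝 0)) (hd : ∀ n, dA (A n) (p n) ≤ δ n * h n ^ 2)
    (hM : ∀ n, volume.real (A n) - 2 * Real.pi * P n ≤ M) :
    ∃ (a₁ : ℂ) (s₁ : ℝ) (a₂ : ℂ) (s₂ : ℝ), 0 ≤ s₁ ∧ 0 ≤ s₂ ∧ D.indicator (1 : ℂ → ℝ) =ᵐ[volume]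
      fun x => (ball a₁ s₁).indicator (1 : ℂ → ℝ) x - (ball a₂ s₂).indicator 1 x := by
  have hpi := Real.pi_pos
  -- uniform bound and extraction
  have hb : ∀ n, mA (A n) (p n) (P n - 3 * h n) ∈ Icc 0 (max 0 (M + 6 * Real.pi)) := by
    intro n
    refine ⟨mA_nonneg _, ((hs n).mA_max (by linarith [hP n, h1 n])).trans ?_⟩
    refine max_le_max le_rfl ?_
    have : Real.pi * h n ≤ Real.pi * 1 := mul_le_mul_of_nonneg_left (h1 n) hpi.le
    nlinarith [hM n]
  obtain ⟨mi, hmi, ψ, hψ, hml⟩ := isCompact_Icc.tendsto_subseq hb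
  have hψt := hψ.tendsto_atTop
  clear hb
  -- pass to the subsequence
  obtain ⟨W, A, R, φ, ε, p, V, C, P, h, δ, hs, he, h0, h1, hl, hP, hδ, hd, hM, hml⟩ :
    ∃ (W : ℕ → Set (ℂ → ℝ)) (A : ℕ → Set ℂ) (R : ℕ → ℝ) (φ : ℕ → ℕ → ℂ → ℝ) (ε : ℕ → ℕ → ℝ)
    (p : ℕ → ℂ → ℝ) (V C P h δ : ℕ → ℝ),
    (∀ n, Sol (W n) (A n) (R n) (φ n) (ε n) (p n) (V n) (C n)) ∧ (∀ n, Ext D (A n) (p n) (P n)) ∧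
    (∀ n, 0 < h n) ∧ (∀ n, h n ≤ 1) ∧ (Tendsto h atTop (𝓝 0)) ∧ (∀ n, 3 ≤ P n) ∧ (Tendsto δ atTop (𝓝 0)) ∧
    (∀ n, dA (A n) (p n) ≤ δ n * h n ^ 2) ∧ (∀ n, volume.real (A n) - 2 * Real.pi * P n ≤ M) ∧
    Tendsto (fun n => mA (A n) (p n) (P n - 3 * h n)) atTop (𝓝 mi) :=
    ⟨fun n => W (ψ n), fun n => A (ψ n), fun n => R (ψ n), fun n => φ (ψ n), fun n => ε (ψ n), fun n => p (ψ n),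
      fun n => V (ψ n), fun n => C (ψ n), fun n => P (ψ n), fun n => h (ψ n), fun n => δ (ψ n), fun n => hs _,
      fun n => he _, fun n => h0 _, fun n => h1 _, hl.comp hψt, fun n => hP _, hδ.comp hψt, fun n => hd _,
      fun n => hM _, hml⟩
  have hdh : ∀ n, dA (A n) (p n) / h n ≤ δ n * h n := fun n => by
    rw [div_le_iff₀ (h0 n)]; have := hd n; nlinarith
  have mup : ∀ n, 0 < mu (p n) (P n - h n) := fun n => by
    rw [(he n).mu_lo (hs n) (by linarith [hP n, h1 n]) (by linarith [h0 n])]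
    have := mA_nonneg (A := A n) (p := p n) (P n - h n); linarith
  have N2 : ∀ n, NA (A n) (p n) (P n - 2 * h n) ≤ δ n * h n := fun n =>
    ((hs n).NA_le (k := h n) (by linarith [hP n, h1 n]) (h0 n) (by
      have := mup n
      rwa [show P n - 2 * h n + h n = P n - h n by ring])).trans (hdh n)
  have N3 : ∀ n, 0 ≤ NA (A n) (p n) (P n - 3 * h n) := fun n =>
    (hs n).NA_nonneg (by linarith [hP n, h1 n])
      ((mup n).trans_le ((hs n).mu_anti (by linarith [hP n, h1 n]) (by linarith [h0 n])))
  have diff1 : ∀ n, mA (A n) (p n) (P n - 3 * h n) - mA (A n) (p n) (P n - 3 * h n + h n) ≤ (2 * Real.pi + δ n) * h n := by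
    intro n
    have a := N2 n
    have b := N3 n
    rw [show P n - 3 * h n + h n = P n - 2 * h n by ring]
    unfold NA at a b
    linarith
  have diff1' : ∀ n, 0 ≤ mA (A n) (p n) (P n - 3 * h n) - mA (A n) (p n) (P n - 3 * h n + h n) := fun n =>
    sub_nonneg.mpr ((hs n).mA_anti (by linarith [h0 n]))
  have lim0 : Tendsto (fun n => (2 * Real.pi + δ n) * h n) atTop (𝓝 0) := by
    simpa using (hδ.const_add (2 * Real.pi)).mul hl
  have hml2 : Tendsto (fun n => mA (A n) (p n) (P n - 3 * h n + h n)) atTop (𝓝 mi) := by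
    have := hml.sub (squeeze_zero diff1' diff1 lim0)
    simpa using this
  -- outer disc
  set a := Real.sqrt ((mi + volume.real D) / Real.pi) with ha
  have hap : 0 < (mi + volume.real D) / Real.pi := div_pos (by linarith [hmi.1]) hpi
  have ha0 : 0 < a := Real.sqrt_pos.mpr hap
  have ha2 : Real.pi * a ^ 2 = mi + volume.real D := by rw [ha, Real.sq_sqrt hap.le]; field_simp
  obtain ⟨c₁, hc₁⟩ := near_disc hs (fun n => P n - 3 * h n) h δ (fun n => by linarith [hP n, h1 n]) h0 hδ diff1 ha0
    (by
      rw [ha2]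
      refine (hml.add_const _).congr fun n => ?_
      rw [(he n).mu_lo (hs n) (by linarith [hP n, h1 n]) (by linarith [h0 n])])
    (by
      rw [ha2]
      refine (hml2.add_const _).congr fun n => ?_
      rw [(he n).mu_lo (hs n) (by linarith [hP n, h1 n, h0 n]) (by linarith [h0 n])])
  have mD := (he 0).mD
  have iD := ind_integrable mD (he 0).fD
  have iS : ∀ n t, 0 ≤ t → Integrable ({y | t < p n y}.indicator (1 : ℂ → ℝ)) := fun n t ht =>
    ind_integrable ((hs n).meas t) ((hs n).fin ht)
  have t0 : ∀ n, 0 ≤ P n - 3 * h n := fun n => by linarith [hP n, h1 n]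
  rcases hmi.1.eq_or_lt with hz | hz
  · -- no hole
    rw [← hz] at hml
    refine final_compact (c₁ := c₁) (r₁ := fun _ => a) (c₂ := fun _ => 0) (r₂ := fun _ => 0) (M := a) mD hDR hDpos
      (fun _ => ha0.le) (fun _ => le_rfl) (fun _ => le_rfl) (fun _ => ha0.le) ?_
    have hsum := hc₁.add hml
    rw [add_zero] at hsum
    refine squeeze_zero (fun n => integral_nonneg fun y => abs_nonneg _) (fun n => ?_) hsum
    rw [← (he n).int_lo (hs n) (t0 n) (by linarith [h0 n])]
    refine le_trans (le_of_eq ?_) (int_tri (ind_ball_integrable _ _) (iS n _ (t0 n)) iD)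
    congr 1; ext y; simp
  · -- hole
    have hpos2 : ∀ᶠ n in atTop, 0 < mu (p n) (P n + 2 * h n) := by
      have l1 : Tendsto (fun n => Real.sqrt (8 * Real.pi * (δ n * h n ^ 2)) + 10 * Real.pi * h n) atTop (𝓝 0) := by
        have := (((hδ.mul (hl.pow 2)).const_mul (8 * Real.pi)).sqrt).add (hl.const_mul (10 * Real.pi))
        simpa using this
      filter_upwards [l1.eventually (gt_mem_nhds (half_pos hz)), hml.eventually (lt_mem_nhds (half_lt_self hz))] with n hn hn'
      by_contra hc
      have hc0 : mu (p n) (P n + 2 * h n) = 0 := le_antisymm (not_lt.mp hc) (mu_nonneg _)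
      have hSn : 0 ≤ P n + 2 * h n := by linarith [hP n, h0 n]
      have hle : volume.real (A n) - 2 * Real.pi * (P n + 2 * h n) ≤ Real.sqrt (8 * Real.pi * (δ n * h n ^ 2)) := by
        by_cases hS : P n + 2 * h n ≤ volume.real (A n) / (2 * Real.pi)
        · refine Real.le_sqrt_of_sq_le (((hs n).top hSn hc0 hS).trans ?_)
          exact mul_le_mul_of_nonneg_left (hd n) (by positivity)
        · rw [not_le, div_lt_iff₀ (by positivity)] at hS
          exact le_trans (by linarith) (Real.sqrt_nonneg _)
      have h3 := (hs n).mA_max (t0 n)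
      have h4 : max 0 (volume.real (A n) - 2 * Real.pi * (P n - 3 * h n)) ≤
          Real.sqrt (8 * Real.pi * (δ n * h n ^ 2)) + 10 * Real.pi * h n := by
        refine max_le ?_ (by linarith)
        have := h0 n; positivity
      linarith
    obtain ⟨N, hN⟩ := eventually_atTop.mp hpos2
    have hN' : ∀ n, 0 < mu (p (n + N)) (P (n + N) + 2 * h (n + N)) := fun n => hN _ (by omega)
    have shift : ∀ {f : ℕ → ℝ} {l : Filter ℝ}, Tendsto f atTop l → Tendsto (fun n => f (n + N)) atTop l :=
      fun hf => hf.comp (tendsto_add_atTop_nat N)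
    have Nh : ∀ n, NA (A (n+N)) (p (n+N)) (P (n+N) + h (n+N)) ≤ δ (n+N) * h (n+N) := fun n =>
      ((hs _).NA_le (k := h (n+N)) (by linarith [hP (n+N), h0 (n+N)]) (h0 _) (by
        have := hN' n
        rwa [show P (n+N) + h (n+N) + h (n+N) = P (n+N) + 2 * h (n+N) by ring])).trans (hdh _)
    have mu1 : ∀ n, 0 < mu (p (n+N)) (P (n+N) + h (n+N)) := fun n =>
      (hN' n).trans_le ((hs _).mu_anti (by linarith [hP (n+N), h0 (n+N)]) (by linarith [h0 (n+N)]))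
    have mono : ∀ n, NA (A (n+N)) (p (n+N)) (P (n+N)) ≤ NA (A (n+N)) (p (n+N)) (P (n+N) + h (n+N)) := fun n =>
      (hs _).NA_mono (by linarith [hP (n+N)]) (by linarith [h0 (n+N)]) (mu1 n)
    have mono' : ∀ n, NA (A (n+N)) (p (n+N)) (P (n+N) - 3 * h (n+N)) ≤ NA (A (n+N)) (p (n+N)) (P (n+N)) := fun n =>
      (hs _).NA_mono (t0 _) (by linarith [h0 (n+N)]) ((mu1 n).trans_le ((hs _).mu_anti (by linarith [hP (n+N)]) (by linarith [h0 (n+N)])))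
    have diff2 : ∀ n, mA (A (n+N)) (p (n+N)) (P (n+N)) - mA (A (n+N)) (p (n+N)) (P (n+N) + h (n+N)) ≤ (2 * Real.pi + δ (n+N)) * h (n+N) := by
      intro n
      have a1 := Nh n
      have a2 := mono' n
      have a3 := N3 (n+N)
      unfold NA at a1 a2 a3
      linarith
    have diff2' : ∀ n, 0 ≤ mA (A (n+N)) (p (n+N)) (P (n+N)) - mA (A (n+N)) (p (n+N)) (P (n+N) + h (n+N)) := fun n =>
      sub_nonneg.mpr ((hs _).mA_anti (by linarith [h0 (n+N)]))
    have diff3 : ∀ n, mA (A (n+N)) (p (n+N)) (P (n+N) - 3 * h (n+N)) - mA (A (n+N)) (p (n+N)) (P (n+N)) ≤ (6 * Real.pi + δ (n+N)) * h (n+N) := by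
      intro n
      have a1 := Nh n
      have a2 := mono n
      have a3 := N3 (n+N)
      unfold NA at a1 a2 a3
      linarith
    have diff3' : ∀ n, 0 ≤ mA (A (n+N)) (p (n+N)) (P (n+N) - 3 * h (n+N)) - mA (A (n+N)) (p (n+N)) (P (n+N)) := fun n =>
      sub_nonneg.mpr ((hs _).mA_anti (by linarith [h0 (n+N)]))
    have lim6 : Tendsto (fun n => (6 * Real.pi + δ (n+N)) * h (n+N)) atTop (𝓝 0) := by
      simpa using ((shift hδ).const_add (6 * Real.pi)).mul (shift hl)
    have lim3 := squeeze_zero diff3' diff3 lim6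
    have lim2 := squeeze_zero diff2' diff2 (shift lim0)
    have hmP : Tendsto (fun n => mA (A (n+N)) (p (n+N)) (P (n+N))) atTop (𝓝 mi) := by
      have := (shift hml).sub lim3
      simpa using this
    have hmP2 : Tendsto (fun n => mA (A (n+N)) (p (n+N)) (P (n+N) + h (n+N))) atTop (𝓝 mi) := by
      have := hmP.sub lim2
      simpa using this
    set b := Real.sqrt (mi / Real.pi) with hbd
    have hbp : 0 < mi / Real.pi := div_pos hz hpi
    have hb0 : 0 < b := Real.sqrt_pos.mpr hbp
    have hb2 : Real.pi * b ^ 2 = mi := by rw [hbd, Real.sq_sqrt hbp.le]; field_simp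
    obtain ⟨c₂, hc₂⟩ := near_disc (fun n => hs (n+N)) (fun n => P (n+N)) (fun n => h (n+N)) (fun n => δ (n+N))
      (fun n => by linarith [hP (n+N)]) (fun n => h0 _) (shift hδ) diff2 hb0
      (by
        rw [hb2]
        refine hmP.congr fun n => ?_
        rw [(he (n+N)).mu_hi (by linarith [hP (n+N)]) le_rfl])
      (by
        rw [hb2]
        refine hmP2.congr fun n => ?_
        rw [(he (n+N)).mu_hi (by linarith [hP (n+N), h0 (n+N)]) (by linarith [h0 (n+N)])])
    refine final_compact (c₁ := fun n => c₁ (n+N)) (r₁ := fun _ => a) (c₂ := c₂) (r₂ := fun _ => b) (M := max a b) mD hDR hDpos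
      (fun _ => ha0.le) (fun _ => le_max_left _ _) (fun _ => hb0.le) (fun _ => le_max_right _ _) ?_
    have hsum := ((shift hc₁).add hc₂).add lim3
    simp only [add_zero] at hsum
    refine squeeze_zero (fun n => integral_nonneg fun y => abs_nonneg _) (fun n => ?_) hsum
    rw [← (he (n+N)).int_hi (hs (n+N)) (t0 _) (by linarith [h0 (n+N)])]
    have i1 := ind_ball_integrable (c₁ (n+N)) a
    have i2 := ind_ball_integrable (c₂ n) b
    have i3 := iS (n+N) _ (t0 (n+N))
    have i4 := iS (n+N) (P (n+N)) (by linarith [hP (n+N)])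
    have j1 : Integrable fun y => |(ball (c₁ (n+N)) a).indicator (1 : ℂ → ℝ) y - {y | P (n+N) - 3 * h (n+N) < p (n+N) y}.indicator 1 y| := (i1.sub i3).abs
    have j2 : Integrable fun y => |(ball (c₂ n) b).indicator (1 : ℂ → ℝ) y - {y | P (n+N) < p (n+N) y}.indicator 1 y| := (i2.sub i4).abs
    have j3 : Integrable fun y => |{y | P (n+N) - 3 * h (n+N) < p (n+N) y}.indicator (1 : ℂ → ℝ) y - {y | P (n+N) < p (n+N) y}.indicator 1 y - D.indicator 1 y| := ((i3.sub i4).sub iD).abs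
    have j4 : Integrable fun y => |(ball (c₁ (n+N)) a).indicator (1 : ℂ → ℝ) y - (ball (c₂ n) b).indicator 1 y - D.indicator 1 y| := ((i1.sub i2).sub iD).abs
    have j12 : Integrable fun y => |(ball (c₁ (n+N)) a).indicator (1 : ℂ → ℝ) y - {y | P (n+N) - 3 * h (n+N) < p (n+N) y}.indicator 1 y| + |(ball (c₂ n) b).indicator (1 : ℂ → ℝ) y - {y | P (n+N) < p (n+N) y}.indicator 1 y| := j1.add j2
    rw [← integral_add j1 j2, ← integral_add j12 j3]
    refine integral_mono j4 (j12.add j3) fun y => ?_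
    simp only [Pi.add_apply]
    generalize (ball (c₁ (n+N)) a).indicator (1 : ℂ → ℝ) y = q1
    generalize (ball (c₂ n) b).indicator (1 : ℂ → ℝ) y = q2
    generalize {y | P (n+N) - 3 * h (n+N) < p (n+N) y}.indicator (1 : ℂ → ℝ) y = q3
    generalize {y | P (n+N) < p (n+N) y}.indicator (1 : ℂ → ℝ) y = q4
    generalize D.indicator (1 : ℂ → ℝ) y = q5
    have e1 : q1 - q2 - q5 = (q1 - q3) + (-(q2 - q4)) + (q3 - q4 - q5) := by ring
    rw [e1]
    have := abs_add_three (q1 - q3) (-(q2 - q4)) (q3 - q4 - q5)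
    rwa [abs_neg] at this

end RP

namespace RP
open scoped Topology Gradient

variable {D : Set ℂ} {k : ℕ} {Γ : Fin k → Set ℂ} {x : Fin k → ℂ} {R0 R : ℝ}

/-- exterior test class -/
def We (D : Set ℂ) (R : ℝ) : Set (ℂ → ℝ) :=
  {φ | ContDiff ℝ 1 φ ∧ (∀ y, R < ‖y‖ → φ y = 0) ∧ ∀ y ∈ D, ∀ z ∈ D, φ y = φ z}

lemma grad_zero_of_const_ball {φ : ℂ → ℝ} {U : Set ℂ} (hU : IsOpen U) {y : ℂ} (hy : y ∈ U) {c : ℝ} (h : ∀ z ∈ U, φ z = c) :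
    ∇ φ y = 0 := by
  have : φ =ᶠ[𝓝 y] fun _ => c := by
    filter_upwards [hU.mem_nhds hy] with z hz using h z hz
  rw [this.gradient.eq_of_nhds]; simp [gradient_fun_const]

lemma isOpen_out (R : ℝ) : IsOpen {y : ℂ | R < ‖y‖} := isOpen_lt continuous_const continuous_norm

lemma Bd.etc (h : Bd D k Γ x R0) (hR : R0 < R) : TC (We D R) (closedBall 0 R \ D) R where
  hR := h.R0pos.trans hR
  mA := measurableSet_closedBall.diff h.op.measurableSet
  sub := diff_subset
  zero := ⟨contDiff_const, fun _ _ => rfl, fun _ _ _ _ => rfl⟩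
  add := by
    rintro φ ⟨h1, h2, h3⟩ χ ⟨g1, g2, g3⟩
    exact ⟨h1.add g1, fun y hy => by simp [h2 y hy, g2 y hy], fun y hy z hz => by simp only [h3 y hy z hz, g3 y hy z hz]⟩
  smul := by
    rintro a φ ⟨h1, h2, h3⟩
    exact ⟨contDiff_const.mul h1, fun y hy => by simp [h2 y hy], fun y hy z hz => by simp only [h3 y hy z hz]⟩
  comp := by
    rintro T hT hT0 φ ⟨h1, h2, h3⟩
    exact ⟨hT.comp h1, fun y hy => by simp [h2 y hy, hT0], fun y hy z hz => by simp only [h3 y hy z hz]⟩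
  c1 := fun φ h => h.1
  supp := fun φ h => h.2.1
  grad := by
    rintro φ ⟨h1, h2, h3⟩ y hy
    by_cases hyD : y ∈ D
    · exact grad_zero_of_const_ball h.op hyD (c := φ y) (fun z hz => h3 z hz y hyD)
    · refine grad_zero_of_const_ball (isOpen_out R) (c := 0) ?_ (fun z hz => h2 z hz)
      by_contra hc
      simp only [mem_setOf_eq, not_lt] at hc
      exact hy ⟨mem_closedBall_zero_iff.mpr hc, hyD⟩

lemma nr_congr_ae {F H : ℂ → ℂ} (h : F =ᵐ[volume] H) : nr F = nr H := by
  unfold nr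
  congr 1
  refine integral_congr_ae ?_
  filter_upwards [h] with y hy
  rw [hy]

/-- gluing for the exterior class -/
lemma Bd.glue_ext (h : Bd D k Γ x R0) (hR : R0 < R) {u : ℂ → ℝ} (hu1 : ContDiff ℝ 1 u)
    (hu : ∀ i, ∀ y ∈ Γ i, u y = u (x i)) {b : ℝ} (hb : ∀ y, ‖y‖ = R → u y = b) :
    ∃ χ : ℕ → ℂ → ℝ, (∀ n, χ n ∈ We D R) ∧ 
      Tendsto (fun n => nr (fun y => (closedBall 0 R \ D).indicator (∇ u) y - ∇ (χ n) y)) atTop (𝓝 0) := by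
  classical
  obtain ⟨c, hc, hcu, hcF⟩ := h.exists_c hu
  have hout : ∀ y : ℂ, R0 ≤ ‖y‖ → y ∉ D := fun y hy hyD => by
    have := h.sub hyD
    rw [mem_ball_zero_iff] at this
    linarith
  have hRn : R0 ≤ ‖(R0 : ℂ)‖ := by rw [Complex.norm_real]; exact le_abs_self _
  set F := insert b (Finset.univ.image (fun i => u (x i))) with hF
  have hFn : F.Nonempty := ⟨b, Finset.mem_insert_self _ _⟩
  obtain ⟨T, T1, T2, T3, T4⟩ := exists_trunc F hFn
  set χ : ℕ → ℂ → ℝ := fun n y => if R ≤ ‖y‖ then 0 else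
    if y ∈ D then T n (c R0) - T n b else T n (u y) - T n (c y) + T n (c R0) - T n b with hχ
  set S : Set ℂ := ball 0 R \ closure D with hS
  have hSo : IsOpen S := isOpen_ball.sdiff isClosed_closure
  have hlt : ∀ {y : ℂ}, ‖y‖ < R → ∀ᶠ z in 𝓝 y, ‖z‖ < R := fun hy =>
    continuous_norm.continuousAt.eventually (gt_mem_nhds hy)
  have loc1 : ∀ n, ∀ y ∈ S, ∃ d : ℝ, χ n =ᶠ[𝓝 y] fun z => T n (u z) + d := by
    intro n y hy
    refine ⟨- T n (c y) + T n (c R0) - T n b, ?_⟩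
    have hcy := hc y (fun hc => hy.2 (subset_closure hc))
    rw [eventually_nhdsWithin_iff] at hcy
    filter_upwards [hSo.mem_nhds hy, hcy] with z hz hz2
    have hzD : z ∉ D := fun hc => hz.2 (subset_closure hc)
    have hzR : ¬ R ≤ ‖z‖ := not_le.mpr (mem_ball_zero_iff.mp hz.1)
    simp only [hχ, hzD, hzR, if_false]; rw [hz2 hzD]; ring
  have loc2 : ∀ n, ∀ y ∉ S, ∃ d : ℝ, χ n =ᶠ[𝓝 y] fun _ => d := by
    intro n y hy
    rcases lt_trichotomy ‖y‖ R with hyR | hyR | hyR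
    · have hcl : y ∈ closure D := by
        by_contra hcl
        exact hy ⟨mem_ball_zero_iff.mpr hyR, hcl⟩
      refine ⟨T n (c R0) - T n b, ?_⟩
      by_cases hyD : y ∈ D
      · filter_upwards [h.op.mem_nhds hyD, hlt hyR] with z hz hz2
        simp only [hχ, hz, not_le.mpr hz2, if_true, if_false]
      · have hfr : y ∈ frontier D := by rw [h.op.frontier_eq]; exact ⟨hcl, hyD⟩
        have hcy := hc y hyD
        rw [eventually_nhdsWithin_iff] at hcy
        have h3 : ∀ᶠ z in 𝓝 y, T n (u z) = T n (u y) :=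
          hu1.continuous.continuousAt.eventually
            (T3 n (u y) (by rw [← hcu y hfr]; exact Finset.mem_insert_of_mem (hcF y hyD)))
        filter_upwards [hcy, h3, hlt hyR] with z hz hz3 hz2
        by_cases hzD : z ∈ D
        · simp only [hχ, hzD, not_le.mpr hz2, if_true, if_false]
        · simp only [hχ, hzD, not_le.mpr hz2, if_false]; rw [hz hzD, hz3, hcu y hfr]; ring
    · refine ⟨0, ?_⟩
      have h3 : ∀ᶠ z in 𝓝 y, T n (u z) = T n (u y) :=
          hu1.continuous.continuousAt.eventually (T3 n (u y) (by rw [hb y hyR]; exact Finset.mem_insert_self _ _))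
      have h4 : ∀ᶠ z : ℂ in 𝓝 y, R0 < ‖z‖ := continuous_norm.continuousAt.eventually (lt_mem_nhds (show R0 < ‖y‖ by rw [hyR]; exact hR))
      filter_upwards [h3, h4] with z hz3 hz4
      by_cases hzR : R ≤ ‖z‖
      · simp only [hχ, hzR, if_true]
      · simp only [hχ, hzR, hout z hz4.le, if_false]
        rw [hz3, hb y hyR, h.const_out hc hz4.le hRn]; ring
    · refine ⟨0, ?_⟩
      filter_upwards [(isOpen_out R).mem_nhds hyR] with z hz
      have hz' : R ≤ ‖z‖ := le_of_lt hz
      simp only [hχ, hz', if_true]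
  have gl := fun n => glue_C1 (T1 n) hu1 (loc1 n) (loc2 n)
  have hDR : ∀ y ∈ D, ¬ R ≤ ‖y‖ := fun y hy hyR => hout y (hR.le.trans hyR) hy
  refine ⟨χ, fun n => ⟨(gl n).1, fun y hy => ?_, fun y hy z hz => ?_⟩, ?_⟩
  · simp only [hχ, hy.le, if_true]
  · simp only [hχ, hy, hz, hDR y hy, hDR z hz, if_true, if_false]
  · simp only [(gl _).2]
    have h1 := approx_grad hu1 hSo.measurableSet (diff_subset.trans ball_subset_closedBall) T1 T2 T4
    refine h1.congr fun n => nr_congr_ae ?_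
    have hz : ∀ᵐ y, ∀ i, u y = u (x i) → ∇ u y = 0 := by
      rw [ae_all_iff]
      exact fun i => grad_zero_level hu1 _
    have hs : ∀ᵐ y : ℂ, y ∉ sphere (0:ℂ) R := compl_mem_ae_iff.mpr (Measure.addHaar_sphere volume (0:ℂ) R)
    filter_upwards [hz, hs] with y hy1 hy2
    congr 1
    by_cases hyS : y ∈ S
    · rw [indicator_of_mem hyS, indicator_of_mem]
      exact ⟨ball_subset_closedBall hyS.1, fun hc => hyS.2 (subset_closure hc)⟩
    · rw [indicator_of_notMem hyS]
      by_cases hyA : y ∈ closedBall 0 R \ D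
      · rw [indicator_of_mem hyA]
        have hyb : y ∈ ball (0:ℂ) R := by
          have h1 := hyA.1
          rw [mem_closedBall] at h1
          rw [mem_sphere] at hy2
          exact lt_of_le_of_ne h1 hy2
        have hcl : y ∈ closure D := by
          by_contra hcl
          exact hyS ⟨hyb, hcl⟩
        have hfr : y ∈ frontier D := by rw [h.op.frontier_eq]; exact ⟨hcl, hyA.2⟩
        rw [h.fr] at hfr
        obtain ⟨i, hi⟩ := mem_iUnion.mp hfr
        exact (hy1 i (hu i y hi)).symm
      · rw [indicator_of_notMem hyA]

end RP

namespace RP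
open scoped Topology Gradient

variable {D : Set ℂ} {k : ℕ} {Γ : Fin k → Set ℂ} {x : Fin k → ℂ} {R0 R : ℝ}

lemma nr_le {F : ℂ → ℂ} {M R : ℝ} (hM : 0 ≤ M) (hR : 0 ≤ R) (h1 : ∀ y, ‖F y‖ ≤ M) (h2 : ∀ y, R < ‖y‖ → F y = 0) :
    nr F ≤ 2 * M * R := by
  unfold nr
  rw [Real.sqrt_le_left (by positivity)]
  have hi : Integrable ((closedBall (0:ℂ) R).indicator fun _ => M ^ 2) := by
    rw [integrable_indicator_iff measurableSet_closedBall]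
    exact integrableOn_const measure_closedBall_lt_top.ne
  have h3 : ∫ y, ‖F y‖ ^ 2 ≤ ∫ y, (closedBall (0:ℂ) R).indicator (fun _ => M ^ 2) y := by
    refine integral_mono_of_nonneg (Eventually.of_forall fun y => by positivity) hi (Eventually.of_forall fun y => ?_)
    by_cases hy : y ∈ closedBall (0:ℂ) R
    · simp only [indicator_of_mem hy]
      gcongr; exact h1 y
    · simp only [indicator_of_notMem hy]
      rw [mem_closedBall_zero_iff, not_le] at hy
      simp [h2 y hy]
  refine h3.trans ?_
  rw [integral_indicator measurableSet_closedBall, setIntegral_const]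
  have : volume.real (closedBall (0:ℂ) R) = Real.pi * R ^ 2 := by
    rw [← volume_real_ball (0:ℂ) R hR, Measure.real, Measure.real, Measure.addHaar_closedBall_eq_addHaar_ball]
  rw [this, smul_eq_mul]
  have := Real.pi_le_four
  nlinarith [mul_nonneg (sq_nonneg M) (sq_nonneg R)]

lemma far_K {z y : ℂ} {R1 : ℝ} (hR : 0 < R1) (hz : ‖z‖ ≤ R1) (hy : 2 * R1 ≤ ‖y‖) :
    ‖K (z - y) - K (-y)‖ ≤ 2 * R1 / ‖y‖ ^ 2 := by
  have hy0 : 0 < ‖y‖ := by linarith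
  have h1 : ‖y‖ / 2 ≤ ‖z - y‖ := by
    have := norm_sub_norm_le y z
    rw [norm_sub_rev]; linarith
  have hzy : 0 < ‖z - y‖ := by linarith
  have e : K (z - y) - K (-y) = - (starRingEnd ℂ) z * ((starRingEnd ℂ) (z - y))⁻¹ * ((starRingEnd ℂ) (-y))⁻¹ := by
    unfold K
    have a1 : (starRingEnd ℂ) (z - y) ≠ 0 := by rw [Ne, map_eq_zero]; exact norm_pos_iff.mp hzy
    have a2 : (starRingEnd ℂ) (-y) ≠ 0 := by rw [Ne, map_eq_zero, neg_eq_zero]; exact norm_pos_iff.mp hy0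
    field_simp
    simp only [map_sub, map_neg]; ring
  rw [e, norm_mul, norm_mul, norm_neg, norm_inv, norm_inv, RCLike.norm_conj, RCLike.norm_conj, RCLike.norm_conj, norm_neg]
  rw [← div_eq_mul_inv, ← div_eq_mul_inv, div_div, div_le_div_iff₀ (by positivity) (by positivity)]
  have h2 : ‖z‖ * ‖y‖ ^ 2 ≤ R1 * ‖y‖ ^ 2 := by gcongr
  have h3 : R1 * (‖y‖ / 2) * ‖y‖ ≤ R1 * ‖z - y‖ * ‖y‖ := by gcongr
  nlinarith

lemma far_log {z y : ℂ} {R1 : ℝ} (hR : 0 < R1) (hz : ‖z‖ ≤ R1) (hy : 2 * R1 ≤ ‖y‖) :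
    |Real.log ‖z - y‖ - Real.log ‖y‖| ≤ 2 * R1 / ‖y‖ := by
  have hy0 : 0 < ‖y‖ := by linarith
  have h1 : ‖y‖ - R1 ≤ ‖z - y‖ := by
    have := norm_sub_norm_le y z
    rw [norm_sub_rev]; linarith
  have h2 : ‖z - y‖ ≤ ‖y‖ + R1 := by
    have := norm_sub_le z y
    linarith
  have hzy : 0 < ‖z - y‖ := by linarith
  rw [← Real.log_div hzy.ne' hy0.ne']
  set t := ‖z - y‖ / ‖y‖ with ht
  have ht0 : 0 < t := by positivity
  have e : t * ‖y‖ = ‖z - y‖ := by rw [ht]; field_simp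
  have a1 := Real.log_le_sub_one_of_pos ht0
  have a2 := Real.one_sub_inv_le_log_of_pos ht0
  have b1 : t - 1 ≤ R1 / ‖y‖ := by rw [le_div_iff₀ hy0]; nlinarith
  have b2 : 1 - t ≤ R1 / ‖y‖ := by rw [le_div_iff₀ hy0]; nlinarith
  have b3 : R1 / ‖y‖ ≤ 1 / 2 := by rw [div_le_iff₀ hy0]; linarith
  have b4 : 0 ≤ R1 / ‖y‖ := by positivity
  have e2 : 2 * R1 / ‖y‖ = 2 * (R1 / ‖y‖) := by ring
  rw [e2, abs_le]
  refine ⟨?_, by linarith⟩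
  refine le_trans ?_ a2
  have : t⁻¹ - 1 ≤ 2 * (R1 / ‖y‖) := by
    rw [sub_le_iff_le_add, inv_le_iff_one_le_mul₀ ht0]
    nlinarith
  linarith

section far
variable {f : ℂ → ℝ} {R1 : ℝ} {y : ℂ}

lemma far_G (hf : Integrable f) (hb : ∀ x, |f x| ≤ 1) (h0 : ∀ x, 0 ≤ f x) (hs : ∀ x, R1 < ‖x‖ → f x = 0)
    (hR : 0 < R1) (hy : 2 * R1 ≤ ‖y‖) :
    ‖G f y - (∫ z, f z) • K (-y)‖ ≤ (∫ z, f z) * (2 * R1 / ‖y‖ ^ 2) := by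
  rw [G, ← integral_smul_const, ← integral_sub (integrable_G hf hb y) (hf.smul_const _), ← integral_mul_const]
  refine norm_integral_le_of_norm_le (hf.mul_const _) (Eventually.of_forall fun z => ?_)
  rw [← smul_sub, norm_smul, Real.norm_of_nonneg (h0 z)]
  by_cases hz : R1 < ‖z‖
  · simp [hs z hz]
  · exact mul_le_mul_of_nonneg_left (far_K hR (not_lt.mp hz) hy) (h0 z)

lemma far_pot (hf : Integrable f) (hb : ∀ x, |f x| ≤ 1) (h0 : ∀ x, 0 ≤ f x) (hs : ∀ x, R1 < ‖x‖ → f x = 0)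
    (hR : 0 < R1) (hy : 2 * R1 ≤ ‖y‖) :
    |pot f y + 1 / (2 * Real.pi) * ((∫ z, f z) * Real.log ‖y‖)| ≤ 1 / (2 * Real.pi) * ((∫ z, f z) * (2 * R1 / ‖y‖)) := by
  have hpi := Real.pi_pos
  have e : pot f y + 1 / (2 * Real.pi) * ((∫ z, f z) * Real.log ‖y‖) =
      - (1 / (2 * Real.pi)) * ∫ z, (f z * Real.log ‖z - y‖ - f z * Real.log ‖y‖) := by
    rw [integral_sub (integrable_mul_log hf hb hs y) (hf.mul_const _), integral_mul_const, pot]; ring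
  rw [e, abs_mul, abs_neg, abs_of_pos (show 0 < 1 / (2 * Real.pi) by positivity), ← integral_mul_const]
  refine mul_le_mul_of_nonneg_left ?_ (by positivity)
  rw [← Real.norm_eq_abs]
  refine norm_integral_le_of_norm_le (hf.mul_const _) (Eventually.of_forall fun z => ?_)
  rw [← mul_sub, norm_mul, Real.norm_of_nonneg (h0 z), Real.norm_eq_abs]
  by_cases hz : R1 < ‖z‖
  · simp [hs z hz]
  · exact mul_le_mul_of_nonneg_left (far_log hR (not_lt.mp hz) hy) (h0 z)
end far

def om (D : Set ℂ) (y : ℂ) : ℝ := pot (D.indicator 1) y + (-(volume.real D / Real.pi)) * pot ((ball (0:ℂ) 1).indicator 1) y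

def omg (D : Set ℂ) (y : ℂ) : ℂ := (1 / (2 * Real.pi)) • G (D.indicator 1) y +
  (-(volume.real D / Real.pi)) • ((1 / (2 * Real.pi)) • G ((ball (0:ℂ) 1).indicator 1) y)

lemma Bd.hasGrad_om (h : Bd D k Γ x R0) (y : ℂ) : HasGradientAt (om D) (omg D y) y :=
  hasGrad_add (hasGradientAt_pot (ind_integrable h.op.measurableSet h.fin) (ind_abs_le D) h.tc.ind_supp y)
    (hasGrad_mul_const (hasGradientAt_pot (ind_ball_integrable 0 1) (ind_abs_le _) (R := 1)
      (fun z hz => indicator_of_notMem (by rw [mem_ball_zero_iff]; linarith) _) y) _)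

lemma Bd.cont_omg (h : Bd D k Γ x R0) : Continuous (omg D) := by
  have h1 := continuous_G (ind_integrable h.op.measurableSet h.fin) (ind_abs_le D)
  have h2 := continuous_G (ind_ball_integrable 0 1) (ind_abs_le _)
  unfold omg
  fun_prop

lemma int_ball1 : ∫ z, (ball (0:ℂ) 1).indicator (1 : ℂ → ℝ) z = Real.pi := by
  rw [ind_integral measurableSet_ball, volume_real_ball (0:ℂ) 1 zero_le_one]; ring

/-- far field bounds -/
lemma Bd.far (h : Bd D k Γ x R0) {R1 : ℝ} (h1 : 1 ≤ R1) (h2 : R0 ≤ R1) {y : ℂ} (hy : 2 * R1 ≤ ‖y‖) :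
    |om D y| ≤ 2 * volume.real D * R1 / ‖y‖ ∧ ‖omg D y‖ ≤ 2 * volume.real D * R1 / ‖y‖ ^ 2 := by
  have hpi := Real.pi_pos
  have hp3 := Real.pi_gt_three
  have hy0 : 0 < ‖y‖ := by linarith
  have hm : 0 ≤ volume.real D := measureReal_nonneg
  have hR1 : 0 < R1 := by linarith
  have fD := ind_integrable h.op.measurableSet h.fin
  have sD : ∀ z, R1 < ‖z‖ → D.indicator (1 : ℂ → ℝ) z = 0 := fun z hz => h.tc.ind_supp z (by linarith)
  have fB := ind_ball_integrable 0 1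
  have sB : ∀ z, R1 < ‖z‖ → (ball (0:ℂ) 1).indicator (1 : ℂ → ℝ) z = 0 := fun z hz =>
    indicator_of_notMem (by rw [mem_ball_zero_iff]; linarith) _
  have eD := ind_integral (A := D) h.op.measurableSet
  constructor
  · have a1 := far_pot fD (ind_abs_le D) (ind_nonneg D) sD hR1 hy
    have a2 := far_pot fB (ind_abs_le _) (ind_nonneg _) sB hR1 hy
    rw [eD] at a1
    rw [int_ball1] at a2
    set q := volume.real D / Real.pi with hq
    have hq0 : 0 ≤ q := by positivity
    have hqe : volume.real D = q * Real.pi := by rw [hq]; field_simp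
    rw [abs_le] at a1 a2 ⊢
    unfold om
    rw [← hq]
    rw [hqe] at a1 ⊢
    have c1 := mul_le_mul_of_nonneg_left a2.1 hq0
    have c2 := mul_le_mul_of_nonneg_left a2.2 hq0
    have e1 : 1 / (2 * Real.pi) * (q * Real.pi * (2 * R1 / ‖y‖)) = q * R1 / ‖y‖ := by field_simp
    have e2 : 1 / (2 * Real.pi) * (Real.pi * (2 * R1 / ‖y‖)) = R1 / ‖y‖ := by field_simp
    have e3 : 2 * (q * Real.pi) * R1 / ‖y‖ = 2 * Real.pi * (q * R1 / ‖y‖) := by ring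
    have e4 : q * (R1 / ‖y‖) = q * R1 / ‖y‖ := by ring
    rw [e1] at a1
    rw [e2] at c1 c2
    rw [e3]
    have hnn : 0 ≤ q * R1 / ‖y‖ := by positivity
    have e5 : 1 / (2 * Real.pi) * (q * Real.pi * Real.log ‖y‖) = q * (1 / (2 * Real.pi) * (Real.pi * Real.log ‖y‖)) := by ring
    rw [e5] at a1
    constructor <;> nlinarith
  · have a1 := far_G fD (ind_abs_le D) (ind_nonneg D) sD hR1 hy
    have a2 := far_G fB (ind_abs_le _) (ind_nonneg _) sB hR1 hy
    rw [eD] at a1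
    rw [int_ball1] at a2
    set gD := G (D.indicator 1) y
    set gB := G ((ball (0:ℂ) 1).indicator 1) y
    have e : omg D y = (1 / (2 * Real.pi)) • ((gD - volume.real D • K (-y)) - (volume.real D / Real.pi) • (gB - Real.pi • K (-y))) := by
      unfold omg
      have : (volume.real D / Real.pi) • (Real.pi • K (-y)) = volume.real D • K (-y) := by
        rw [smul_smul]; congr 1; field_simp
      rw [smul_sub, smul_sub, smul_sub (volume.real D / Real.pi), this]
      module
    rw [e, norm_smul, Real.norm_of_nonneg (show 0 ≤ 1 / (2 * Real.pi) by positivity)]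
    have b1 := norm_sub_le (gD - volume.real D • K (-y)) ((volume.real D / Real.pi) • (gB - Real.pi • K (-y)))
    rw [norm_smul, Real.norm_of_nonneg (show 0 ≤ volume.real D / Real.pi by positivity)] at b1
    have b2 := mul_le_mul_of_nonneg_left a2 (show 0 ≤ volume.real D / Real.pi by positivity)
    have e2 : volume.real D / Real.pi * (Real.pi * (2 * R1 / ‖y‖ ^ 2)) = 2 * volume.real D * R1 / ‖y‖ ^ 2 := by field_simp
    have e3 : volume.real D * (2 * R1 / ‖y‖ ^ 2) = 2 * volume.real D * R1 / ‖y‖ ^ 2 := by ring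
    rw [e2] at b2
    rw [e3] at a1
    have hnn : 0 ≤ 2 * volume.real D * R1 / ‖y‖ ^ 2 := by positivity
    rw [div_mul_eq_mul_div, one_mul, div_le_iff₀ (by positivity)]
    nlinarith

end RP

namespace RP
open scoped Topology Gradient

variable {D : Set ℂ} {k : ℕ} {Γ : Fin k → Set ℂ} {x : Fin k → ℂ} {R0 R : ℝ}

lemma hasDeriv_possq (a q : ℝ) : HasDerivAt (fun q : ℝ => (max 0 (q - a)) ^ 2) (2 * max 0 (q - a)) q := by
  rcases lt_trichotomy q a with h | h | h
  · have : (fun q : ℝ => (max 0 (q - a)) ^ 2) =ᶠ[𝓝 q] fun _ => 0 := by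
      filter_upwards [gt_mem_nhds h] with z hz
      rw [max_eq_left (by linarith)]; ring
    rw [max_eq_left (by linarith), mul_zero]
    exact (hasDerivAt_const q (0:ℝ)).congr_of_eventuallyEq this
  · subst h
    simp only [sub_self, max_self, mul_zero]
    rw [hasDerivAt_iff_isLittleO]
    simp only [sub_self, max_self, smul_zero, sub_zero]
    have h1 : (fun z : ℝ => (z - q) ^ 2) =o[𝓝 q] fun z => z - q := by
      have := Asymptotics.isLittleO_pow_sub_sub q (m := 2) (by norm_num)
      simpa using this
    refine Asymptotics.IsBigO.trans_isLittleO ?_ h1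
    refine Asymptotics.IsBigO.of_bound 1 (Eventually.of_forall fun z => ?_)
    have e : ((0:ℝ)) ^ 2 = 0 := by norm_num
    rw [e, sub_zero, one_mul, Real.norm_of_nonneg (by positivity), Real.norm_of_nonneg (by positivity)]
    rcases le_total z q with hz | hz
    · rw [max_eq_left (by linarith)]; nlinarith [sq_nonneg (z - q)]
    · rw [max_eq_right (by linarith)]
  · have : (fun q : ℝ => (max 0 (q - a)) ^ 2) =ᶠ[𝓝 q] fun z => (z - a) ^ 2 := by
      filter_upwards [lt_mem_nhds h] with z hz
      rw [max_eq_right (by linarith)]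
    rw [max_eq_right (by linarith)]
    refine HasDerivAt.congr_of_eventuallyEq ?_ this
    have := ((hasDerivAt_id q).sub_const a).fun_pow 2
    exact HasDerivAt.congr_deriv this (by simp)

lemma hasGrad_radial {T T' : ℝ → ℝ} (hT : ∀ q, HasDerivAt T (T' q) q) (y : ℂ) :
    HasGradientAt (fun y : ℂ => T (‖y‖ ^ 2)) ((2 * T' (‖y‖ ^ 2)) • y) y := by
  have h0 := hasGrad_normsq 2 y
  have h1 : HasGradientAt (fun y : ℂ => ‖y‖ ^ 2) ((2:ℝ) • y) y := by
    convert h0 using 2; ring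
  have := hasGrad_comp h1 (hT (‖y‖ ^ 2))
  rwa [smul_smul, mul_comm] at this

/-- energy convergence -/
lemma Sol.nr_lim {W A R φ ε p V C} (h : Sol W A R φ ε p V C) :
    Tendsto (fun n => nr (fun y => XA A y + ∇ (φ n) y) ^ 2) atTop (𝓝 V) := by
  have h1 : Tendsto (fun n => ∫ y, inner ℝ (XA A y + ∇ (φ n) y) (∇ (φ n) y)) atTop (𝓝 0) := by
    have hb : ∀ n, |∫ y, inner ℝ (XA A y + ∇ (φ n) y) (∇ (φ n) y)| ≤ ε n * C := fun n =>
      (h.test n _ (h.mem n)).trans (mul_le_mul_of_nonneg_left (h.bdd n) (h.εnn n))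
    have h2 := h.ε0.mul_const C
    rw [zero_mul] at h2
    exact squeeze_zero_norm hb h2
  have h2 := h.Vlim.add h1
  rw [add_zero] at h2
  refine h2.congr fun n => ?_
  have hm : MemLp (fun y => XA A y + ∇ (φ n) y) 2 := h.memX.add (h.memG (h.mem n))
  rw [← integral_add (ip_int hm h.memX) (ip_int hm (h.memG (h.mem n))), nr_sq]
  congr 1; ext y
  rw [← inner_add_right, real_inner_self_eq_norm_sq]

/-- minimality against the closure -/
lemma Sol.V_le {W A R φ ε p V C} (h : Sol W A R φ ε p V C) {H : ℂ → ℂ} (hH : MemLp H 2)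
    {χ : ℕ → ℂ → ℝ} (hχ : ∀ m, χ m ∈ W) (hl : Tendsto (fun m => nr (fun x => H x - ∇ (χ m) x)) atTop (𝓝 0)) :
    V ≤ nr (fun y => XA A y + H y) ^ 2 := by
  have h1 : Tendsto (fun m => (nr (fun y => XA A y + H y) + nr (fun x => H x - ∇ (χ m) x)) ^ 2) atTop
      (𝓝 (nr (fun y => XA A y + H y) ^ 2)) := by
    have := (hl.const_add (nr (fun y => XA A y + H y))).pow 2
    rwa [add_zero] at this
  refine ge_of_tendsto' h1 fun m => (h.Vmin _ (hχ m)).trans ?_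
  have h2 := nr_sub_le (h.memX.add hH) (hH.sub (h.memG (hχ m)))
  have e : nr (fun y => XA A y + ∇ (χ m) y) = nr (fun y => (XA A + H) y - (H - ∇ (χ m)) y) := by
    congr 1; ext y; simp only [Pi.add_apply, Pi.sub_apply]; ring
  rw [e]
  gcongr
  · exact nr_nonneg _
  · exact h2

lemma ae_closedBall (c : ℂ) (R : ℝ) : closedBall c R =ᵐ[volume] ball c R := by
  have : ∀ᵐ y : ℂ, y ∉ sphere c R := compl_mem_ae_iff.mpr (Measure.addHaar_sphere volume c R)
  filter_upwards [this] with y hy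
  apply propext
  change dist y c ≤ R ↔ dist y c < R
  exact ⟨fun h => lt_of_le_of_ne h hy, le_of_lt⟩

lemma int_normsq_ball (hR : 0 < R) : ∫ y in closedBall (0:ℂ) R, ‖y‖ ^ 2 = Real.pi * R ^ 4 / 2 := by
  have hpi := Real.pi_pos
  rw [setIntegral_congr_set (ae_closedBall 0 R)]
  have h1 := virial (ind_ball_integrable 0 R) (ind_abs_le _) (R := R)
    (fun z hz => indicator_of_notMem (by rw [mem_ball_zero_iff]; linarith) _)
  rw [ind_integral measurableSet_ball, volume_real_ball (0:ℂ) R hR.le] at h1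
  have e : ∀ y : ℂ, (ball (0:ℂ) R).indicator (1 : ℂ → ℝ) y * inner ℝ y (G ((ball (0:ℂ) R).indicator 1) y) =
      - Real.pi * (ball (0:ℂ) R).indicator (fun y => ‖y‖ ^ 2) y := by
    intro y
    by_cases hy : y ∈ ball (0:ℂ) R
    · rw [G_ball 0 y R hR (by rw [sub_zero]; exact (mem_ball_zero_iff.mp hy).le)]
      simp only [indicator_of_mem hy, sub_zero, inner_neg_right, inner_smul_right, real_inner_self_eq_norm_sq, Pi.one_apply]
      ring
    · simp [indicator_of_notMem hy]
  simp only [e] at h1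
  rw [integral_const_mul, integral_indicator measurableSet_ball] at h1
  set I := ∫ y in ball (0:ℂ) R, ‖y‖ ^ 2
  have : Real.pi * I = Real.pi * (Real.pi * R ^ 4 / 2) := by nlinarith
  exact mul_left_cancel₀ hpi.ne' this

lemma Bd.volA (h : Bd D k Γ x R0) (hR : R0 < R) : volume.real (closedBall 0 R \ D) = Real.pi * R ^ 2 - volume.real D := by
  have h0 := h.R0pos
  rw [measureReal_diff (h.sub.trans (ball_subset_closedBall.trans (closedBall_subset_closedBall hR.le))) h.op.measurableSet measure_closedBall_lt_top.ne]
  congr 1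
  rw [← volume_real_ball (0:ℂ) R (by linarith), Measure.real, Measure.real, Measure.addHaar_closedBall_eq_addHaar_ball]

lemma Bd.G_A (h : Bd D k Γ x R0) (hR : R0 < R) {y : ℂ} (hy : ‖y‖ ≤ R) :
    G ((closedBall 0 R \ D).indicator 1) y = - (Real.pi • y) - G (D.indicator 1) y := by
  have h0 := h.R0pos
  have e := G_ball 0 y R (by linarith) (by rwa [sub_zero])
  rw [sub_zero] at e
  rw [← e]
  unfold G
  rw [← integral_sub (integrable_G (ind_ball_integrable 0 R) (ind_abs_le _) y)
    (integrable_G (ind_integrable h.op.measurableSet h.fin) (ind_abs_le D) y)]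
  refine integral_congr_ae ?_
  filter_upwards [ae_closedBall 0 R] with z hz
  rw [← sub_smul]
  congr 1
  have hz' : z ∈ closedBall (0:ℂ) R ↔ z ∈ ball (0:ℂ) R := iff_of_eq hz
  by_cases hD : z ∈ D
  · have hb : z ∈ ball (0:ℂ) R := ball_subset_ball hR.le (h.sub hD)
    simp [indicator, hD, hb]
  · by_cases hb : z ∈ ball (0:ℂ) R
    · have := hz'.mpr hb
      have hzA : z ∈ closedBall (0:ℂ) R \ D := ⟨this, hD⟩
      rw [indicator_of_mem hb, indicator_of_notMem hD, indicator_of_mem hzA]; simp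
    · have := mt hz'.mp hb
      rw [indicator_of_notMem hb, indicator_of_notMem hD, indicator_of_notMem (fun hc : z ∈ closedBall (0:ℂ) R \ D => this hc.1)]; simp

end RP

namespace RP
open scoped Topology Gradient

variable {D : Set ℂ} {k : ℕ} {Γ : Fin k → Set ℂ} {x : Fin k → ℂ} {R0 R : ℝ}

lemma Bd.Γ_norm (h : Bd D k Γ x R0) {i : Fin k} {y : ℂ} (hy : y ∈ Γ i) : ‖y‖ ≤ R0 := by
  have h1 := (frontier_subset_closure (h.Γ_fr i hy))
  have h2 := closure_minimal (h.sub.trans ball_subset_closedBall) isClosed_closedBall h1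
  exact mem_closedBall_zero_iff.mp h2

lemma Bd.ext_V (h : Bd D k Γ x R0) (hR : R0 < R) {φ ε p V C} (hs : Sol (We D R) (closedBall 0 R \ D) R φ ε p V C) :
    V ≤ (2 * (R0 + 1) * (R0 + 1)) ^ 2 := by
  have h0 := h.R0pos
  set a := R0 ^ 2 with ha
  set T : ℝ → ℝ := fun q => (max 0 (q - a)) ^ 2 * (-(1/4)) + (max 0 (q - (a + 1))) ^ 2 * (1/4) with hT
  set T' : ℝ → ℝ := fun q => 2 * max 0 (q - a) * (-(1/4)) + 2 * max 0 (q - (a + 1)) * (1/4) with hT'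
  have hd : ∀ q, HasDerivAt T (T' q) q := fun q =>
    ((hasDeriv_possq a q).mul_const _).add ((hasDeriv_possq (a+1) q).mul_const _)
  have hg := hasGrad_radial hd
  have hcT' : Continuous T' := by simp only [hT']; fun_prop
  have hc1 : ContDiff ℝ 1 (fun y : ℂ => T (‖y‖ ^ 2)) := contDiff_of_grad hg (by fun_prop)
  have hT0 : ∀ y : ℂ, ‖y‖ ≤ R0 → T (‖y‖ ^ 2) = 0 := by
    intro y hy
    have : ‖y‖ ^ 2 ≤ a := by rw [ha]; gcongr
    simp only [hT]
    rw [max_eq_left (by linarith), max_eq_left (by linarith)]; norm_num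
  obtain ⟨χ, hχ, hl⟩ := h.glue_ext hR hc1 (fun i y hy => by rw [hT0 y (h.Γ_norm hy), hT0 _ (h.Γ_norm (h.mem i))])
    (b := T (R ^ 2)) (fun y hy => by rw [hy])
  have hm := memLp_ind hs.mA hs.sub (continuous_grad hc1)
  refine (hs.V_le hm hχ hl).trans ?_
  have hn := nr_nonneg (fun y => XA (closedBall 0 R \ D) y + (closedBall 0 R \ D).indicator (∇ fun y : ℂ => T (‖y‖ ^ 2)) y)
  gcongr
  rw [gradient_eq hg]
  have e : ∀ y, y ∈ closedBall 0 R \ D → XA (closedBall 0 R \ D) y + (closedBall 0 R \ D).indicator (fun y : ℂ => (2 * T' (‖y‖ ^ 2)) • y) y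
      = (1 + 2 * T' (‖y‖ ^ 2)) • y := by
    intro y hy
    simp only [XA, indicator_of_mem hy]
    rw [add_smul, one_smul]
  have b1 : ∀ q, 0 ≤ 1 + 2 * T' q ∧ 1 + 2 * T' q ≤ 1 := by
    intro q
    simp only [hT']
    rcases max_cases 0 (q - a) with h1 | h1 <;> rcases max_cases 0 (q - (a+1)) with h2 | h2 <;> constructor <;> linarith
  have b2 : ∀ y : ℂ, R0 + 1 < ‖y‖ → 1 + 2 * T' (‖y‖ ^ 2) = 0 := by
    intro y hy
    have : a + 1 ≤ ‖y‖ ^ 2 := by nlinarith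
    simp only [hT']
    rw [max_eq_right (by linarith), max_eq_right (by linarith)]; ring
  refine nr_le (by linarith) (by linarith) (fun y => ?_) (fun y hy => ?_)
  · by_cases hyA : y ∈ closedBall 0 R \ D
    · rw [e y hyA, norm_smul, Real.norm_of_nonneg (b1 _).1]
      by_cases hy : R0 + 1 < ‖y‖
      · rw [b2 y hy]; linarith
      · push Not at hy
        have := mul_le_mul_of_nonneg_right (b1 (‖y‖ ^ 2)).2 (norm_nonneg y)
        linarith
    · simp only [XA, indicator_of_notMem hyA]; simp; linarith
  · by_cases hyA : y ∈ closedBall 0 R \ D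
    · rw [e y hyA, b2 y hy, zero_smul]
    · simp only [XA, indicator_of_notMem hyA]; simp

lemma Bd.ext_d (h : Bd D k Γ x R0) {R1 Ω : ℝ} (h1 : 1 ≤ R1) (h2 : R0 ≤ R1) (hR : 4 * R1 ≤ R) (hΩ : 1 / 2 ≤ Ω)
    (hu : ∀ i, ∀ y ∈ Γ i, uu D Ω y = uu D Ω (x i)) 
    {φ ε p V C} (hs : Sol (We D R) (closedBall 0 R \ D) R φ ε p V C) :
    dA (closedBall 0 R \ D) p ≤ (2 * (R0 + 1) * (R0 + 1)) * (64 * volume.real D * R1) / R := by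
  have h0 := h.R0pos
  have hR0R : R0 < R := by linarith
  have hRpos : 0 < R := by linarith
  set m := volume.real D with hm
  have hm0 : 0 ≤ m := measureReal_nonneg
  set T : ℝ → ℝ := fun q => (max 0 (q - R ^ 2 / 4)) ^ 2 * (16 / (9 * R ^ 4)) with hT
  set T' : ℝ → ℝ := fun q => 2 * max 0 (q - R ^ 2 / 4) * (16 / (9 * R ^ 4)) with hT'
  have hd : ∀ q, HasDerivAt T (T' q) q := fun q => (hasDeriv_possq (R^2/4) q).mul_const _
  have hg := hasGrad_radial hd
  have hcT' : Continuous T' := by simp only [hT']; fun_prop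
  have hcT : Continuous T := by simp only [hT]; fun_prop
  set g : ℂ → ℂ := fun y => T (‖y‖ ^ 2) • omg D y + om D y • ((2 * T' (‖y‖ ^ 2)) • y) with hgd
  have hgr : ∀ y, HasGradientAt (fun y => T (‖y‖ ^ 2) * om D y) (g y) y := fun y => hasGrad_mul (hg y) (h.hasGrad_om y)
  have hco := h.cont_omg
  have hcom : Continuous (om D) := (contDiff_of_grad h.hasGrad_om hco).continuous
  have hgc : Continuous g := by simp only [hgd]; fun_prop
  have huc := h.contDiff_uu Ω
  have hur : ∀ y, HasGradientAt (fun y => uu D Ω y + (-1) * (T (‖y‖ ^ 2) * om D y)) (∇ (uu D Ω) y + (-1 : ℝ) • g y) y := fun y =>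
    hasGrad_add (hasGrad huc y) (hasGrad_mul_const (hgr y) (-1))
  have hc1 : ContDiff ℝ 1 (fun y => uu D Ω y + (-1) * (T (‖y‖ ^ 2) * om D y)) := contDiff_of_grad hur (by
    have := continuous_grad huc
    fun_prop)
  have hT0 : ∀ y : ℂ, ‖y‖ ≤ R / 2 → T (‖y‖ ^ 2) = 0 ∧ T' (‖y‖ ^ 2) = 0 := by
    intro y hy
    have : ‖y‖ ^ 2 ≤ (R / 2) ^ 2 := by gcongr
    simp only [hT, hT']
    rw [max_eq_left (by linarith)]; norm_num
  have hT1 : ∀ y : ℂ, ‖y‖ ≤ R → (0 ≤ T (‖y‖ ^ 2) ∧ T (‖y‖ ^ 2) ≤ 1) ∧ 0 ≤ T' (‖y‖ ^ 2) ∧ T' (‖y‖ ^ 2) ≤ 8 / (3 * R ^ 2) := by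
    intro y hy
    have h3 : ‖y‖ ^ 2 ≤ R ^ 2 := by gcongr
    have hmx : max 0 (‖y‖ ^ 2 - R ^ 2 / 4) ≤ 3 * R ^ 2 / 4 := max_le (by positivity) (by linarith)
    have hmx0 : 0 ≤ max 0 (‖y‖ ^ 2 - R ^ 2 / 4) := le_max_left _ _
    simp only [hT, hT']
    refine ⟨⟨by positivity, ?_⟩, by positivity, ?_⟩
    · calc _ ≤ (3 * R ^ 2 / 4) ^ 2 * (16 / (9 * R ^ 4)) := by gcongr
        _ = 1 := by field_simp; norm_num
    · calc _ ≤ 2 * (3 * R ^ 2 / 4) * (16 / (9 * R ^ 4)) := by gcongr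
        _ = 8 / (3 * R ^ 2) := by field_simp; norm_num
  have hTR : T (R ^ 2) = 1 := by
    simp only [hT]
    rw [max_eq_right (by nlinarith)]
    field_simp; norm_num
  have hval : ∀ y : ℂ, ‖y‖ = R → uu D Ω y + (-1) * (T (‖y‖ ^ 2) * om D y) =
      Ω / 2 * R ^ 2 + m / Real.pi * (- (1 ^ 2 / 2) * Real.log R) := by
    intro y hy
    rw [hy, hTR, om, uu, pot_ball_out 0 y 1 one_pos (by rw [sub_zero, hy]; linarith), sub_zero, hy]; ring
  have hgam : ∀ i, ∀ y ∈ Γ i, T (‖y‖ ^ 2) = 0 := fun i y hy => (hT0 y (by linarith [h.Γ_norm hy])).1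
  obtain ⟨χ, hχ, hl⟩ := h.glue_ext hR0R hc1 (fun i y hy => by rw [hgam i y hy, hgam i _ (h.mem i), hu i y hy]; ring) hval
  have hmu := memLp_ind hs.mA hs.sub (continuous_grad hc1)
  have hmg := memLp_ind hs.mA hs.sub hgc
  have l1 := hs.closure_zero hmu hχ hl
  have hgu : ∇ (uu D Ω) = fun y => (1 / (2 * Real.pi)) • G (D.indicator 1) y + Ω • y := gradient_eq (h.hasGrad_uu Ω)
  have l2 := hs.lim_both (-1) (Ω - 1/2) (H := ∇ (uu D Ω)) (fun y hy => by
    rw [hgu, h.G_A hR0R (mem_closedBall_zero_iff.mp hy.1)]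
    have : (1 / (2 * Real.pi)) • (Real.pi • y) = (1/2 : ℝ) • y := by
      rw [smul_smul]; congr 1; have := Real.pi_pos; field_simp
    simp only [smul_sub, smul_neg, this]
    module)
  have l3 := l2.sub l1
  have hmem : ∀ n, MemLp (fun y => XA (closedBall 0 R \ D) y + ∇ (φ n) y) 2 := fun n => hs.memX.add (hs.memG (hs.mem n))
  have hmu0 := memLp_ind hs.mA hs.sub (continuous_grad huc)
  have e : ∀ n, (∫ y, inner ℝ (XA (closedBall 0 R \ D) y + ∇ (φ n) y) ((closedBall 0 R \ D).indicator (∇ (uu D Ω)) y)) -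
      ∫ y, inner ℝ (XA (closedBall 0 R \ D) y + ∇ (φ n) y) ((closedBall 0 R \ D).indicator (∇ (fun y => uu D Ω y + (-1) * (T (‖y‖ ^ 2) * om D y))) y) =
      ∫ y, inner ℝ (XA (closedBall 0 R \ D) y + ∇ (φ n) y) ((closedBall 0 R \ D).indicator g y) := by
    intro n
    rw [← integral_sub (ip_int (hmem n) hmu0) (ip_int (hmem n) hmu)]
    congr 1; ext y
    rw [← inner_sub_right]
    congr 1
    by_cases hy : y ∈ closedBall 0 R \ D
    · simp only [indicator_of_mem hy]
      rw [(hur y).gradient]; module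
    · simp only [indicator_of_notMem hy, sub_zero]
  simp only [e] at l3
  have hnrg : nr ((closedBall 0 R \ D).indicator g) ≤ 2 * (16 * (2 * m * R1) / R ^ 2) * R := by
    refine nr_le (by positivity) hRpos.le (fun y => ?_) (fun y hy => indicator_of_notMem (fun hc => ?_) _)
    · by_cases hy : y ∈ closedBall 0 R \ D
      · rw [indicator_of_mem hy]
        have hyR : ‖y‖ ≤ R := mem_closedBall_zero_iff.mp hy.1
        by_cases hy2 : ‖y‖ ≤ R / 2
        · simp only [hgd]
          rw [(hT0 y hy2).1, (hT0 y hy2).2]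
          simp; positivity
        · push Not at hy2
          have hy0 : 0 < ‖y‖ := by linarith
          obtain ⟨f1, f2⟩ := h.far h1 h2 (y := y) (by linarith)
          rw [← hm] at f1 f2
          obtain ⟨⟨t1, t2⟩, t3, t4⟩ := hT1 y hyR
          have g1 : |om D y| ≤ 2 * m * R1 / (R / 2) := f1.trans (by gcongr)
          have g2 : ‖omg D y‖ ≤ 2 * m * R1 / (R / 2) ^ 2 := f2.trans (by gcongr)
          simp only [hgd]
          refine (norm_add_le _ _).trans ?_
          rw [norm_smul, norm_smul, norm_smul, Real.norm_of_nonneg t1, Real.norm_eq_abs (om D y), Real.norm_of_nonneg (by positivity : 0 ≤ 2 * T' (‖y‖ ^ 2))]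
          calc _ ≤ 1 * (2 * m * R1 / (R / 2) ^ 2) + 2 * m * R1 / (R / 2) * (2 * (8 / (3 * R ^ 2)) * R) := by gcongr
            _ = (4 + 32 / 3) * (2 * m * R1) / R ^ 2 := by field_simp; ring
            _ ≤ 16 * (2 * m * R1) / R ^ 2 := by gcongr; norm_num
      · rw [indicator_of_notMem hy, norm_zero]; positivity
    · have := mem_closedBall_zero_iff.mp hc.1
      linarith
  have hnrV : Tendsto (fun n => nr (fun y => XA (closedBall 0 R \ D) y + ∇ (φ n) y)) atTop (𝓝 (Real.sqrt V)) := by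
    have := (Real.continuous_sqrt.tendsto V).comp hs.nr_lim
    refine this.congr fun n => ?_
    simp only [Function.comp]
    exact Real.sqrt_sq (nr_nonneg _)
  have l4 := hnrV.mul_const (2 * (16 * (2 * m * R1) / R ^ 2) * R)
  have l5 := le_of_tendsto_of_tendsto' l3 l4 (fun n => (le_abs_self _).trans ((ip_le (hmem n) hmg).trans
    (mul_le_mul_of_nonneg_left hnrg (nr_nonneg _))))
  have hV := h.ext_V hR0R hs
  have hsV : Real.sqrt V ≤ 2 * (R0 + 1) * (R0 + 1) := by
    rw [Real.sqrt_le_left (by positivity)]; exact hV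
  have h5 := mul_nonneg (sub_nonneg.mpr hΩ) hs.Vnn
  have e6 : 2 * (16 * (2 * m * R1) / R ^ 2) * R = (64 * m * R1) / R := by field_simp; ring
  rw [e6] at l5
  have h6 : Real.sqrt V * ((64 * m * R1) / R) ≤ 2 * (R0 + 1) * (R0 + 1) * ((64 * m * R1) / R) := by gcongr
  rw [mul_div_assoc]
  linarith

end RP

namespace RP
open scoped Topology Gradient

variable {D : Set ℂ} {k : ℕ} {Γ : Fin k → Set ℂ} {x : Fin k → ℂ} {R0 R : ℝ}

lemma Bd.ext_P (h : Bd D k Γ x R0) (hR : R0 < R) {φ ε p V C} (hs : Sol (We D R) (closedBall 0 R \ D) R φ ε p V C) :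
    ∃ P, Ext D (closedBall 0 R \ D) p P ∧ 2 * P * volume.real D = R ^ 2 * volume.real D - volume.real D ^ 2 / (2 * Real.pi)
      - (∫ y in D, ‖y‖ ^ 2) - V + 2 * dA (closedBall 0 R \ D) p := by
  have hpi := Real.pi_pos
  have h0 := h.R0pos
  have hm := h.vol_pos
  obtain ⟨z0, hz0, hz0D⟩ : ∃ z0, Tendsto (fun n => φ n z0) atTop (𝓝 (p z0)) ∧ z0 ∈ D := by
    by_contra hc
    push Not at hc
    have : volume D = 0 := by
      refine measure_mono_null (fun z hz => ?_) hs.aeconv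
      exact fun hz' => hc z hz' hz
    exact (h.op.measure_pos volume h.conn.nonempty).ne' this
  have heq : ∀ᵐ y, y ∈ D → p y = p z0 := by
    filter_upwards [hs.aeconv] with y hy hyD
    refine tendsto_nhds_unique hy (hz0.congr fun n => (hs.mem n).2.2 z0 hz0D y hyD)
  refine ⟨p z0, ⟨h.op.measurableSet, h.fin, disjoint_sdiff_left, fun y hyA hyD => ?_, heq⟩, ?_⟩
  · refine (hs.psupp y ?_).le
    by_contra hc
    exact hyA ⟨mem_closedBall_zero_iff.mpr (not_lt.mp hc), hyD⟩
  · have hDA : D ⊆ closedBall 0 R := h.sub.trans (ball_subset_closedBall.trans (closedBall_subset_closedBall hR.le))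
    have e1 : ∫ y, p y = (∫ y in closedBall 0 R \ D, p y) + p z0 * volume.real D := by
      rw [← setIntegral_eq_integral_of_forall_compl_eq_zero (s := closedBall 0 R) (fun y hy => hs.psupp y (by
        rw [mem_closedBall_zero_iff] at hy; linarith)), ← diff_union_of_subset hDA,
        setIntegral_union disjoint_sdiff_left h.op.measurableSet hs.pint.integrableOn hs.pint.integrableOn, diff_union_of_subset hDA]
      congr 1
      rw [setIntegral_congr_ae h.op.measurableSet heq, setIntegral_const, smul_eq_mul, mul_comm]
    have hi : IntegrableOn (fun y : ℂ => ‖y‖ ^ 2) (closedBall 0 R) :=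
      (continuous_norm.pow 2).continuousOn.integrableOn_compact (isCompact_closedBall 0 R)
    have e2 : ∫ y in closedBall 0 R \ D, ‖y‖ ^ 2 = Real.pi * R ^ 4 / 2 - ∫ y in D, ‖y‖ ^ 2 := by
      rw [integral_diff h.op.measurableSet hi hDA, int_normsq_ball (by linarith)]
    have e3 := hs.Veq
    rw [e1, e2] at e3
    have e4 : dA (closedBall 0 R \ D) p = _ := rfl
    rw [dA, h.volA hR] at e4
    rw [dA, h.volA hR]
    set m := volume.real D
    set I := ∫ y in D, ‖y‖ ^ 2
    set J := ∫ y in closedBall 0 R \ D, p y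
    have e5 : (Real.pi * R ^ 2 - m) ^ 2 / (4 * Real.pi) = Real.pi * R ^ 4 / 4 - R ^ 2 * m / 2 + m ^ 2 / (4 * Real.pi) := by
      field_simp; ring
    have e6 : m ^ 2 / (2 * Real.pi) = 2 * (m ^ 2 / (4 * Real.pi)) := by field_simp; norm_num
    rw [e5, e6, e3]; ring

set_option maxHeartbeats 1000000 in
theorem Bd.ext_final (h : Bd D k Γ x R0) {Ω : ℝ} (hΩ : 1 / 2 ≤ Ω)
    (hu : ∀ i, ∀ y ∈ Γ i, uu D Ω y = uu D Ω (x i)) :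
    ∃ (a₁ : ℂ) (s₁ : ℝ) (a₂ : ℂ) (s₂ : ℝ), 0 ≤ s₁ ∧ 0 ≤ s₂ ∧ D.indicator (1 : ℂ → ℝ) =ᵐ[volume]
      fun x => (ball a₁ s₁).indicator (1 : ℂ → ℝ) x - (ball a₂ s₂).indicator 1 x := by
  have hpi := Real.pi_pos
  have h0 := h.R0pos
  have hm := h.vol_pos
  set m := volume.real D with hmd
  set Vb := (2 * (R0 + 1) * (R0 + 1)) ^ 2 with hVb
  have hVb0 : 0 ≤ Vb := by positivity
  set R1 := max R0 1 with hR1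
  have h1 : 1 ≤ R1 := le_max_right _ _
  have h2 : R0 ≤ R1 := le_max_left _ _
  set M := Real.pi / m * (R0 ^ 2 * m + Vb) with hM
  have hM0 : 0 ≤ M := by positivity
  set K := (2 * (R0 + 1) * (R0 + 1)) * (64 * m * R1) with hK
  have hK0 : 0 ≤ K := by positivity
  set R2 := 4 * R1 + m + M + 6 with hR2
  set R : ℕ → ℝ := fun n => R2 + ((n:ℝ) + 1) ^ 3 with hRd
  have hRn : ∀ n, R2 ≤ R n := fun n => by simp only [hRd]; have : (0:ℝ) ≤ ((n:ℝ)+1)^3 := by positivity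
                                          linarith
  have hR0R : ∀ n, R0 < R n := fun n => by have := hRn n; linarith
  have ex := fun n => (h.etc (hR0R n)).exists_sol
  choose φ ε p V C hs using ex
  have ex2 := fun n => h.ext_P (hR0R n) (hs n)
  choose P hP1 hP2 using ex2
  have hI : ∫ y in D, ‖y‖ ^ 2 ≤ R0 ^ 2 * m := by
    have := norm_setIntegral_le_of_norm_le_const (f := fun y : ℂ => ‖y‖ ^ 2) (C := R0 ^ 2) (lt_top_iff_ne_top.mpr h.fin) (fun y hy => by
      rw [Real.norm_of_nonneg (by positivity)]
      have := (mem_ball_zero_iff.mp (h.sub hy)).le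
      gcongr)
    exact (le_abs_self _).trans this
  have hMn : ∀ n, volume.real (closedBall 0 (R n) \ D) - 2 * Real.pi * P n ≤ M := by
    intro n
    have e := hP2 n
    have hV := h.ext_V (hR0R n) (hs n)
    have hd := (hs n).d_nonneg
    rw [h.volA (hR0R n), ← hmd]
    rw [← hmd] at e
    have eP : 2 * Real.pi * P n = Real.pi / m * (2 * P n * m) := by field_simp
    rw [eP, e]
    have : Real.pi / m * (R n ^ 2 * m - m ^ 2 / (2 * Real.pi) - (∫ y in D, ‖y‖ ^ 2) - V n + 2 * dA (closedBall 0 (R n) \ D) (p n))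
      = Real.pi * R n ^ 2 - m / 2 - Real.pi / m * ((∫ y in D, ‖y‖ ^ 2) + V n - 2 * dA (closedBall 0 (R n) \ D) (p n)) := by
      field_simp; ring
    rw [this]
    have h3 : Real.pi / m * ((∫ y in D, ‖y‖ ^ 2) + V n - 2 * dA (closedBall 0 (R n) \ D) (p n)) ≤ M := by
      rw [hM]
      refine mul_le_mul_of_nonneg_left ?_ (by positivity)
      linarith
    linarith
  have hP3 : ∀ n, 3 ≤ P n := by
    intro n
    have e := hMn n
    rw [h.volA (hR0R n), ← hmd] at e
    have h3 := hRn n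
    have h4 : R n ≤ R n ^ 2 := by nlinarith
    have h5 : m + M + 6 ≤ R n ^ 2 := by linarith
    have h6 := Real.pi_gt_three
    have h7 : Real.pi * (m + M + 6) ≤ Real.pi * R n ^ 2 := by gcongr
    by_contra hc
    push Not at hc
    have h8 : Real.pi * P n < Real.pi * 3 := by gcongr
    have h9 : 3 * (m + M) ≤ Real.pi * (m + M) := mul_le_mul_of_nonneg_right h6.le (by linarith)
    have h10 : Real.pi * (m + M + 6) = Real.pi * (m + M) + 6 * Real.pi := by ring
    have h11 : 2 * Real.pi * P n = 2 * (Real.pi * P n) := by ring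
    linarith
  have hd : ∀ n, dA (closedBall 0 (R n) \ D) (p n) ≤ (K * en n) * en n ^ 2 := by
    intro n
    have h3 := hRn n
    refine (h.ext_d h1 h2 (by linarith) hΩ hu (hs n)).trans ?_
    rw [← hmd, ← hK]
    have e : (K * en n) * en n ^ 2 = K / ((n:ℝ) + 1) ^ 3 := by
      unfold en; field_simp
    rw [e]
    refine div_le_div_of_nonneg_left hK0 (by positivity) ?_
    simp only [hRd]; linarith
  have hδ : Tendsto (fun n => K * en n) atTop (𝓝 0) := by
    have := en_tendsto.const_mul K
    rwa [mul_zero] at this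
  exact ext_core (h.sub.trans ball_subset_closedBall) hm hs hP1 en_pos en_le en_tendsto hP3 hδ hd hMn

end RP

namespace RP
open scoped Topology Gradient

variable {D : Set ℂ} {k : ℕ} {Γ : Fin k → Set ℂ} {x : Fin k → ℂ} {R0 R : ℝ}

lemma zero_of_inner {v : ℂ} {s : ℝ} (hs : 0 < s) (h : ∀ w : ℂ, ‖w‖ = s → inner ℝ v w = 0) : v = 0 := by
  by_contra hv
  have hv0 : 0 < ‖v‖ := norm_pos_iff.mpr hv
  have h1 := h ((s / ‖v‖) • v) (by rw [norm_smul, Real.norm_of_nonneg (by positivity)]; field_simp)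
  rw [inner_smul_right, real_inner_self_eq_norm_sq] at h1
  have : 0 < s / ‖v‖ * ‖v‖ ^ 2 := by positivity
  linarith

lemma preconn_sphere (a : ℂ) (r : ℝ) : IsPreconnected (sphere a r) :=
  isPreconnected_sphere (by rw [Complex.rank_real_complex]; norm_num) a r

lemma normsq_pm (a w : ℂ) : ‖a + w‖ ^ 2 = ‖a - w‖ ^ 2 + 4 * inner ℝ a w := by
  rw [norm_add_sq_real, norm_sub_sq_real]; ring

lemma log_contra {s1 s2 d Ω : ℝ} (h2 : 0 < s2) (hd : |d| ≤ s1 - s2) (hdΩ : 0 < d * Ω) (hΩ : Ω ≤ 0 ∨ 1 / 2 ≤ Ω)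
    (he : s2 ^ 2 / 2 * (Real.log (s1 - d) - Real.log (s1 + d)) + d * (1 - 2 * Ω) * s1 = 0) : False := by
  have hd1 := abs_le.mp hd
  have p1 : 0 < s1 - d := by linarith
  have p2 : 0 < s1 + d := by linarith
  rcases hΩ with hΩ | hΩ
  · have hdn : d < 0 := by
      by_contra hc
      push Not at hc
      nlinarith
    have e1 : Real.log (s1 - d) - Real.log (s1 + d) = Real.log ((s1 - d) / (s1 + d)) := (Real.log_div p1.ne' p2.ne').symm
    have e2 := Real.log_le_sub_one_of_pos (show 0 < (s1 - d) / (s1 + d) by positivity)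
    have e3 : (s1 - d) / (s1 + d) - 1 = -2 * d / (s1 + d) := by field_simp; ring
    rw [e3, ← e1] at e2
    have h3 : s2 ^ 2 / 2 * (Real.log (s1 - d) - Real.log (s1 + d)) ≤ s2 ^ 2 / 2 * (-2 * d / (s1 + d)) := by gcongr
    have h4 : s2 ^ 2 / 2 * (-2 * d / (s1 + d)) ≤ (s1 + d) ^ 2 / 2 * (-2 * d / (s1 + d)) := by
      have : 0 ≤ -2 * d / (s1 + d) := div_nonneg (by linarith) p2.le
      have : s2 ≤ s1 + d := by linarith
      gcongr
    have h5 : (s1 + d) ^ 2 / 2 * (-2 * d / (s1 + d)) = - d * (s1 + d) := by field_simp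
    have h6 : 0 ≤ (d * Ω) * s1 := by nlinarith
    nlinarith
  · have hdp : 0 < d := by
      by_contra hc
      push Not at hc
      nlinarith
    have h3 := Real.log_lt_log p1 (show s1 - d < s1 + d by linarith)
    have h4 : 0 ≤ d * (2 * Ω - 1) * s1 := by
      have : 0 < s1 := by linarith
      have : 0 ≤ 2 * Ω - 1 := by linarith
      positivity
    have h5 : 0 < s2 ^ 2 / 2 * (Real.log (s1 + d) - Real.log (s1 - d)) := mul_pos (by positivity) (by linarith)
    nlinarith

lemma pot_congr_sub {f g j : ℂ → ℝ} (hfg : f =ᵐ[volume] fun z => g z - j z) (hg : Integrable g) (hj : Integrable j)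
    (hgb : ∀ x, |g x| ≤ 1) (hjb : ∀ x, |j x| ≤ 1) {R S : ℝ} (hgs : ∀ x, R < ‖x‖ → g x = 0) (hjs : ∀ x, S < ‖x‖ → j x = 0) (y : ℂ) :
    pot f y = pot g y - pot j y := by
  have : ∫ z, f z * Real.log ‖z - y‖ = (∫ z, g z * Real.log ‖z - y‖) - ∫ z, j z * Real.log ‖z - y‖ := by
    rw [← integral_sub (integrable_mul_log hg hgb hgs y) (integrable_mul_log hj hjb hjs y)]
    refine integral_congr_ae ?_
    filter_upwards [hfg] with z hz
    rw [hz]; ring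
  rw [pot, pot, pot, this]; ring

lemma ball_supp (a : ℂ) (r : ℝ) : ∀ z, ‖a‖ + r < ‖z‖ → (ball a r).indicator (1 : ℂ → ℝ) z = 0 := by
  intro z hz
  refine indicator_of_notMem (fun hc => ?_) _
  rw [mem_ball, dist_eq_norm] at hc
  have := norm_sub_norm_le z a
  linarith

theorem Bd.classify (h : Bd D k Γ x R0) {Ω : ℝ} (hΩ : Ω ≤ 0 ∨ 1 / 2 ≤ Ω)
    (hu : ∀ S ⊆ frontier D, IsPreconnected S → ∀ y ∈ S, ∀ z ∈ S, uu D Ω y = uu D Ω z) {a₁ a₂ : ℂ} {s₁ s₂ : ℝ}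
    (hD : D.indicator (1 : ℂ → ℝ) =ᵐ[volume] fun x => (ball a₁ s₁).indicator (1 : ℂ → ℝ) x - (ball a₂ s₂).indicator 1 x) :
    ∃ (a : ℂ) (g : ℝ → ℝ), (Ω ≠ 0 → a = 0) ∧ D.indicator (1 : ℂ → ℝ) =ᵐ[volume] fun x => g ‖x - a‖ := by
  classical
  have hvol := h.op.measure_pos volume h.conn.nonempty
  -- the conclusion from concentricity
  have concl : ∀ a : ℂ, (Ω ≠ 0 → a = 0) → a₁ = a → (s₂ ≤ 0 ∨ a₂ = a) →
      ∃ (a : ℂ) (g : ℝ → ℝ), (Ω ≠ 0 → a = 0) ∧ D.indicator (1 : ℂ → ℝ) =ᵐ[volume] fun x => g ‖x - a‖ := by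
    intro a ha h1 h2
    refine ⟨a, fun r => (if r < s₁ then 1 else 0) - (if 0 ≤ r ∧ r < s₂ then 1 else 0), ha, ?_⟩
    filter_upwards [hD] with z hz
    rw [hz]
    congr 1
    · simp only [indicator, mem_ball, dist_eq_norm, h1, Pi.one_apply]
    · rcases h2 with h2 | h2
      · have n1 : z ∉ ball a₂ s₂ := by rw [ball_eq_empty.mpr h2]; simp
        have n2 : ¬ (0 ≤ ‖z - a‖ ∧ ‖z - a‖ < s₂) := fun hc => by linarith [norm_nonneg (z - a)]
        rw [indicator_of_notMem n1, if_neg n2]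
      · simp [indicator, dist_eq_norm, h2]
  have hpt : ∀ᵐ z, (z ∈ D → z ∈ ball a₁ s₁ ∧ z ∉ ball a₂ s₂) ∧ (z ∈ ball a₂ s₂ → z ∈ ball a₁ s₁) ∧
      (z ∈ ball a₁ s₁ → z ∉ ball a₂ s₂ → z ∈ D) := by
    filter_upwards [hD] with z hz
    by_cases b0 : z ∈ D <;> by_cases b1 : z ∈ ball a₁ s₁ <;> by_cases b2 : z ∈ ball a₂ s₂ <;>
      simp only [indicator_of_mem, indicator_of_notMem, b0, b1, b2, Pi.one_apply, not_false_eq_true] at hz ⊢ <;> first | (exfalso; linarith) | tauto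
  have hs1 : 0 < s₁ := by
    by_contra hc
    push Not at hc
    have : volume D = 0 := by
      refine measure_mono_null (fun z hz => ?_) hpt
      intro hc2
      have := (hc2.1 hz).1
      rw [ball_eq_empty.mpr hc] at this
      exact this
    exact hvol.ne' this
  have D1 : D ∩ (closedBall a₁ s₁)ᶜ = ∅ := null_open isClosed_closedBall.isOpen_compl h.op (by
      refine measure_mono_null (fun z hz => ?_) hpt
      exact fun hc2 => hz.2 (ball_subset_closedBall (hc2.1 hz.1).1))
  have D2 : D ∩ ball a₂ s₂ = ∅ := null_open isOpen_ball h.op (by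
      refine measure_mono_null (fun z hz => ?_) hpt
      exact fun hc2 => (hc2.1 hz.1).2 hz.2)
  have D3 : D ⊆ ball a₁ s₁ := by
    have : D ⊆ closedBall a₁ s₁ := fun z hz => by
      by_contra hc
      have : z ∈ D ∩ (closedBall a₁ s₁)ᶜ := ⟨hz, hc⟩
      rw [D1] at this; exact this
    have := interior_maximal this h.op
    rwa [interior_closedBall _ hs1.ne'] at this
  have D4 : ∀ E : Set ℂ, IsOpen E → E ⊆ ball a₁ s₁ \ ball a₂ s₂ → closure E ⊆ closure D := by
    intro E hE hEs
    refine closure_minimal (fun z hz => ?_) isClosed_closure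
    by_contra hc
    have hop : IsOpen (E \ closure D) := hE.sdiff isClosed_closure
    refine (hop.measure_pos volume ⟨z, hz, hc⟩).ne' ?_
    refine measure_mono_null (fun z hz => ?_) hpt
    exact fun hc2 => hz.2 (subset_closure (hc2.2.2 (hEs hz.1).1 (hEs hz.1).2))
  have hfr : ∀ z ∈ closure D, z ∉ D → z ∈ frontier D := fun z h1 h2 => by rw [h.op.frontier_eq]; exact ⟨h1, h2⟩
  have hsn : ∀ z ∈ sphere a₁ s₁, z ∉ D := fun z hz hzD => by
    have := D3 hzD
    rw [mem_ball] at this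
    rw [mem_sphere] at hz
    linarith
  have hpot : ∀ y, pot (D.indicator 1) y = pot ((ball a₁ s₁).indicator 1) y - pot ((ball a₂ s₂).indicator 1) y :=
    pot_congr_sub hD (ind_ball_integrable _ _) (ind_ball_integrable _ _) (ind_abs_le _) (ind_abs_le _) (ball_supp _ _) (ball_supp _ _)
  by_cases hs2 : s₂ ≤ 0
  · -- disc
    refine concl a₁ (fun hΩ0 => ?_) rfl (Or.inl hs2)
    have hE : ball a₂ s₂ = ∅ := ball_eq_empty.mpr hs2
    have hsf : sphere a₁ s₁ ⊆ frontier D := fun z hz => hfr z (D4 (ball a₁ s₁) isOpen_ball (by rw [hE, diff_empty]) (by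
      rw [closure_ball _ hs1.ne']; exact sphere_subset_closedBall hz)) (hsn z hz)
    refine zero_of_inner hs1 fun w hw => ?_
    have h1 := hu _ hsf (preconn_sphere _ _) (a₁ + w) (by rw [mem_sphere, dist_eq_norm]; simpa using hw) (a₁ - w)
      (by rw [mem_sphere, dist_eq_norm]; simpa using hw)
    rw [uu, uu, hpot, hpot, pot_ball_out a₁ _ s₁ hs1 (by simp [hw]), pot_ball_out a₁ _ s₁ hs1 (by simp [hw]), hE, normsq_pm] at h1
    have e1 : ‖a₁ + w - a₁‖ = s₁ := by simp [hw]
    have e2 : ‖a₁ - w - a₁‖ = s₁ := by simp [hw]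
    have e3 : ∀ y, pot ((∅ : Set ℂ).indicator 1) y = 0 := fun y => by simp [pot]
    rw [e1, e2, e3, e3] at h1
    have : Ω * inner ℝ a₁ w = 0 := by linarith
    exact (mul_eq_zero.mp this).resolve_left hΩ0
  · push Not at hs2
    obtain ⟨-, hnest, hdist⟩ := nested_of_ae (a := a₁) (r := s₁) hs2 (by
      refine measure_mono_null (fun z hz => ?_) hpt
      exact fun hc2 => hz.2 (hc2.2.1 hz.1))
    have hnest' : ball a₂ s₂ ⊆ ball a₁ s₁ := by
      have := interior_maximal hnest isOpen_ball
      rwa [interior_closedBall _ hs1.ne'] at this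
    have hlt : s₂ < s₁ := by
      refine lt_of_le_of_ne (by linarith [norm_nonneg (a₂ - a₁)]) fun hc => ?_
      have : a₂ = a₁ := by
        rw [← sub_eq_zero, ← norm_le_zero_iff]; linarith
      have : volume D = 0 := by
        refine measure_mono_null (fun z hz => ?_) hpt
        intro hc2
        have h1 := hc2.1 hz
        rw [hc, this] at h1
        exact h1.2 h1.1
      exact hvol.ne' this
    have hann : closedBall a₁ s₁ \ ball a₂ s₂ ⊆ closure D :=
      (annulus_dense hs2 hlt hdist).trans (D4 _ (isOpen_ball.sdiff isClosed_closedBall) (diff_subset_diff_right ball_subset_closedBall))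
    have hsf1 : sphere a₁ s₁ ⊆ frontier D := fun z hz => hfr z (hann ⟨sphere_subset_closedBall hz, fun hc => by
      have := hnest' hc
      rw [mem_ball] at this
      rw [mem_sphere] at hz
      linarith⟩) (hsn z hz)
    have hsf2 : sphere a₂ s₂ ⊆ frontier D := by
      intro z hz
      have hz1 : z ∈ closure (ball a₂ s₂) := by rw [closure_ball _ hs2.ne']; exact sphere_subset_closedBall hz
      refine hfr z (hann ⟨closure_minimal hnest isClosed_closedBall hz1, fun hc => ?_⟩) (fun hzD => ?_)
      · rw [mem_ball] at hc
        rw [mem_sphere] at hz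
        linarith
      · obtain ⟨w, hw1, hw2⟩ := _root_.mem_closure_iff.mp hz1 D h.op hzD
        have : w ∈ D ∩ ball a₂ s₂ := ⟨hw1, hw2⟩
        rw [D2] at this; exact this
    -- sphere 2
    have hv : (2 * Ω) • a₂ - (a₂ - a₁) = 0 := by
      refine zero_of_inner hs2 fun w hw => ?_
      have m1 : a₂ + w ∈ sphere a₂ s₂ := by rw [mem_sphere, dist_eq_norm]; simpa using hw
      have m2 : a₂ - w ∈ sphere a₂ s₂ := by rw [mem_sphere, dist_eq_norm]; simpa using hw
      have n1 : ‖a₂ + w - a₁‖ ≤ s₁ := by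
        rw [← dist_eq_norm]
        exact closure_minimal hnest isClosed_closedBall (by rw [closure_ball _ hs2.ne']; exact sphere_subset_closedBall m1)
      have n2 : ‖a₂ - w - a₁‖ ≤ s₁ := by
        rw [← dist_eq_norm]
        exact closure_minimal hnest isClosed_closedBall (by rw [closure_ball _ hs2.ne']; exact sphere_subset_closedBall m2)
      have h1 := hu _ hsf2 (preconn_sphere _ _) _ m1 _ m2
      rw [uu, uu, hpot, hpot, pot_ball_in a₁ _ s₁ hs1 n1, pot_ball_in a₁ _ s₁ hs1 n2, pot_ball_out a₂ _ s₂ hs2 (by simp [hw]),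
        pot_ball_out a₂ _ s₂ hs2 (by simp [hw]), normsq_pm] at h1
      have e1 : ‖a₂ + w - a₂‖ = s₂ := by simp [hw]
      have e2 : ‖a₂ - w - a₂‖ = s₂ := by simp [hw]
      have e3 : ‖a₂ + w - a₁‖ ^ 2 = ‖a₂ - w - a₁‖ ^ 2 + 4 * inner ℝ (a₂ - a₁) w := by
        have := normsq_pm (a₂ - a₁) w
        rwa [show a₂ - a₁ + w = a₂ + w - a₁ by ring, show a₂ - a₁ - w = a₂ - w - a₁ by ring] at this
      rw [e1, e2, e3] at h1
      rw [inner_sub_left, inner_smul_left]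
      simp only [conj_trivial]
      linarith
    have hda : a₂ - a₁ = (2 * Ω) • a₂ := (sub_eq_zero.mp hv).symm
    by_cases hΩ0 : Ω = 0
    · refine concl a₁ (fun hc => absurd hΩ0 hc) rfl (Or.inr ?_)
      rw [hΩ0, mul_zero, zero_smul, sub_eq_zero] at hda
      exact hda
    · have ha2 : a₂ = 0 := by
        by_contra hne
        have hα : 0 < ‖a₂‖ := norm_pos_iff.mpr hne
        set α := ‖a₂‖ with hαd
        set e : ℂ := (1 / α) • a₂ with he
        have hen : ‖e‖ = 1 := by
          rw [he, norm_smul, Real.norm_of_nonneg (by positivity), ← hαd]; field_simp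
        have hae : a₂ = α • e := by rw [he, smul_smul, mul_one_div_cancel hα.ne', one_smul]
        have ha1 : a₁ = ((1 - 2 * Ω) * α) • e := by
          have : a₁ = a₂ - (a₂ - a₁) := by ring
          rw [this, hda, hae]; module
        set d := 2 * Ω * α with hd
        have hdle : |d| ≤ s₁ - s₂ := by
          rw [hda, norm_smul, ← hαd, Real.norm_eq_abs] at hdist
          rw [hd, abs_mul, abs_of_pos hα]; exact hdist
        have hd1 := abs_le.mp hdle
        have m1 : a₁ + s₁ • e ∈ sphere a₁ s₁ := by
          rw [mem_sphere, dist_eq_norm, add_sub_cancel_left, norm_smul, hen, mul_one, Real.norm_of_nonneg hs1.le]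
        have m2 : a₁ - s₁ • e ∈ sphere a₁ s₁ := by
          rw [mem_sphere, dist_eq_norm, sub_sub_cancel_left, norm_neg, norm_smul, hen, mul_one, Real.norm_of_nonneg hs1.le]
        have h1 := hu _ hsf1 (preconn_sphere _ _) _ m1 _ m2
        have k1 : ‖a₁ + s₁ • e - a₁‖ = s₁ := by rw [← dist_eq_norm]; exact m1
        have k2 : ‖a₁ - s₁ • e - a₁‖ = s₁ := by rw [← dist_eq_norm]; exact m2
        have k3 : ‖a₁ + s₁ • e - a₂‖ = s₁ - d := by
          rw [show a₁ + s₁ • e - a₂ = (s₁ - d) • e by rw [ha1, hae, hd]; module, norm_smul, hen, mul_one, Real.norm_of_nonneg (by linarith)]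
        have k4 : ‖a₁ - s₁ • e - a₂‖ = s₁ + d := by
          rw [show a₁ - s₁ • e - a₂ = (-(s₁ + d)) • e by rw [ha1, hae, hd]; module, norm_smul, hen, mul_one, norm_neg, Real.norm_of_nonneg (by linarith)]
        rw [uu, uu, hpot, hpot, pot_ball_out a₁ _ s₁ hs1 k1.ge, pot_ball_out a₁ _ s₁ hs1 k2.ge, pot_ball_out a₂ _ s₂ hs2 (by rw [k3]; linarith),
          pot_ball_out a₂ _ s₂ hs2 (by rw [k4]; linarith), k1, k2, k3, k4, normsq_pm] at h1
        have k5 : inner ℝ a₁ (s₁ • e) = (1 - 2 * Ω) * α * s₁ := by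
          rw [ha1, inner_smul_left, inner_smul_right, real_inner_self_eq_norm_sq, hen]
          simp
        rw [k5] at h1
        refine log_contra (s1 := s₁) (s2 := s₂) (d := d) hs2 hdle ?_ hΩ ?_
        · have : d * Ω = 2 * α * Ω ^ 2 := by rw [hd]; ring
          rw [this]; positivity
        · rw [hd] at h1 ⊢
          linarith
      have ha1 : a₁ = 0 := by
        rw [ha2] at hda; simpa using hda
      exact concl 0 (fun _ => rfl) ha1 (Or.inr ha2)

end RP

namespace RP
open scoped Topology Gradient

theorem transport (D : Set E2) (Ω : ℝ)
    (hDopen : IsOpen D) (hDconn : IsConnected D) (hDbdd : Bornology.IsBounded D)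
    (hDbdry : BoundaryIsFiniteUnionOfJordanCurves D)
    (u : E2 → ℝ) (hu : u = fun x => newtonConv (D.indicator 1) x + Ω / 2 * ‖x‖ ^ 2)
    (hrot : ∀ x ∈ frontier D, ∀ y ∈ connectedComponentIn (frontier D) x, u y = u x)
    (hΩ : Ω ≤ 0 ∨ (1 : ℝ) / 2 ≤ Ω) :
    ∃ (a : E2) (g : ℝ → ℝ), (Ω ≠ 0 → a = 0) ∧ 
      D.indicator (1 : E2 → ℝ) =ᵐ[volume] fun x => g ‖x - a‖ := by
  let e : ℂ ≃ₗᵢ[ℝ] E2 := Complex.orthonormalBasisOneI.repr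
  have hmp : MeasurePreserving e volume volume := e.measurePreserving
  set D' : Set ℂ := e ⁻¹' D with hD'
  have hfr : frontier D' = e ⁻¹' frontier D := (e.toHomeomorph.preimage_frontier D).symm
  have hind : ∀ z, D'.indicator (1 : ℂ → ℝ) z = D.indicator 1 (e z) := fun z => by
    simp only [indicator, Pi.one_apply]; rfl
  have huu : ∀ z, uu D' Ω z = u (e z) := by
    intro z
    rw [hu, uu, pot]
    simp only [LinearIsometryEquiv.norm_map, newtonConv]
    congr 1
    rw [← hmp.integral_comp e.toHomeomorph.measurableEmbedding, ← integral_const_mul]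
    congr 1
    ext y
    rw [NewtonianPotential, ← map_sub, LinearIsometryEquiv.norm_map, hind, one_div ‖z - y‖, Real.log_inv, norm_sub_rev z y]
    ring
  obtain ⟨k, Γ, hJ, hdis, hfrD⟩ := hDbdry
  have hsph : IsConnected (sphere (0 : E2) 1) :=
    isConnected_sphere (by rw [← Module.finrank_eq_rank]; simp) 0 zero_le_one
  have hΓ : ∀ i, IsClosed (Γ i) ∧ IsPreconnected (Γ i) ∧ (Γ i).Nonempty := by
    intro i
    obtain ⟨f, hf, -, hfi⟩ := hJ i
    rw [hfi]
    haveI : ConnectedSpace (sphere (0 : E2) 1) := isConnected_iff_connectedSpace.mp hsph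
    haveI : CompactSpace (sphere (0 : E2) 1) := isCompact_iff_compactSpace.mp (isCompact_sphere _ _)
    exact ⟨(isCompact_range hf).isClosed, isPreconnected_range hf, range_nonempty f⟩
  choose hΓ1 hΓ2 x hx using hΓ
  obtain ⟨R, hR⟩ := hDbdd.subset_ball 0
  have hpre : ∀ s : Set E2, e ⁻¹' s = e.symm '' s := fun s => (e.symm.toEquiv.image_eq_preimage_symm s).symm
  have hB : Bd D' k (fun i => e ⁻¹' Γ i) (fun i => e.symm (x i)) (max R 1) :=
    { op := hDopen.preimage e.continuous
      conn := by rw [hD', hpre]; exact hDconn.image _ e.symm.continuous.continuousOn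
      R0pos := lt_max_of_lt_right one_pos
      sub := fun z hz => by
        have := hR hz
        rw [mem_ball_zero_iff, LinearIsometryEquiv.norm_map] at this
        rw [mem_ball_zero_iff]
        exact lt_max_of_lt_left this
      cl := fun i => (hΓ1 i).preimage e.continuous
      pre := fun i => by
        show IsPreconnected (e ⁻¹' Γ i)
        rw [hpre]; exact (hΓ2 i).image _ e.symm.continuous.continuousOn
      mem := fun i => by simp [hx i]
      disj := fun i j hij => (hdis hij).preimage e
      fr := by rw [hfr, hfrD, preimage_iUnion] }
  have hS : ∀ S ⊆ frontier D', IsPreconnected S → ∀ y ∈ S, ∀ z ∈ S, uu D' Ω y = uu D' Ω z := by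
    intro S hS hSp y hy z hz
    rw [huu, huu]
    have hsub : e '' S ⊆ frontier D := by
      rintro _ ⟨w, hw, rfl⟩
      have := hS hw
      rw [hfr] at this
      exact this
    have hSi := hSp.image e e.continuous.continuousOn
    exact hrot _ (hsub ⟨z, hz, rfl⟩) _ (hSi.subset_connectedComponentIn ⟨z, hz, rfl⟩ hsub ⟨y, hy, rfl⟩)
  have hu' : ∀ i, ∀ y ∈ e ⁻¹' Γ i, uu D' Ω y = uu D' Ω (e.symm (x i)) := by
    intro i y hy
    refine hS (e ⁻¹' Γ i) ?_ (hB.pre i) y hy _ (hB.mem i)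
    rw [hB.fr]
    exact subset_iUnion (fun i => e ⁻¹' Γ i) i
  have hfin : ∃ a₁ s₁ a₂ s₂, 0 ≤ s₁ ∧ 0 ≤ s₂ ∧ D'.indicator (1 : ℂ → ℝ) =ᵐ[volume]
      fun x => (ball a₁ s₁).indicator 1 x - (ball a₂ s₂).indicator 1 x := by
    rcases hΩ with h | h
    · exact hB.int_final h hu'
    · exact hB.ext_final h hu'
  obtain ⟨a₁, s₁, a₂, s₂, -, -, hD⟩ := hfin
  obtain ⟨a, g, ha, hg⟩ := hB.classify hΩ hS hD
  refine ⟨e a, g, fun h => by rw [ha h, map_zero], ?_⟩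
  have hq : MeasurePreserving e.symm volume volume := e.symm.measurePreserving
  filter_upwards [hq.quasiMeasurePreserving.ae hg] with w hw
  rw [hind, e.apply_symm_apply] at hw
  rw [hw, ← e.norm_map, map_sub, e.apply_symm_apply]

end RP
/-- Radial symmetry of a uniformly rotating vortex patch `1_D` with angular velocity
`Ω ≤ 0` or `Ω ≥ 1/2`, where the boundary of `D` is a finite disjoint union of Jordan
curves: if `Ω ≠ 0` then `1_D` agrees a.e. with a function of `|x|` (so `D` coincides
up to a null set with a disk or annulus centered at the origin), and if `Ω = 0` then
`1_D` agrees a.e. with a function of `|x - a|` for some `a`. -/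
theorem radial_symmetry_of_uniformly_rotating_patch
    (D : Set E2) (Ω : ℝ)
    (hDopen : IsOpen D) (hDconn : IsConnected D) (hDbdd : Bornology.IsBounded D)
    (hDbdry : BoundaryIsFiniteUnionOfJordanCurves D)
    -- the stream function `u = N*1_D + (Ω/2)|x|²` :
    (u : E2 → ℝ) (hu : u = fun x => newtonConv (D.indicator 1) x + Ω / 2 * ‖x‖ ^ 2)
    -- rotating patch equation: `u` is constant on every connected component of `∂D` :
    (hrot : ∀ x ∈ frontier D, ∀ y ∈ connectedComponentIn (frontier D) x, u y = u x)
    -- the angular velocity condition :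
    (hΩ : Ω ≤ 0 ∨ (1 : ℝ) / 2 ≤ Ω) :
    (Ω ≠ 0 → ∃ g : ℝ → ℝ, D.indicator (1 : E2 → ℝ) =ᵐ[volume] fun x => g ‖x‖) ∧
    (Ω = 0 → ∃ (a : E2) (g : ℝ → ℝ),
      D.indicator (1 : E2 → ℝ) =ᵐ[volume] fun x => g ‖x - a‖) := by
  obtain ⟨a, g, ha, hg⟩ := RP.transport D Ω hDopen hDconn hDbdd hDbdry u hu hrot hΩ
  refine ⟨fun h => ⟨g, ?_⟩, fun _ => ⟨a, g, hg⟩⟩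
  simpa [ha h] using hg
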